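/- arXiv:2412.11505 — 3 statements merged into one kernel-verified Lean document; each statement's English description precedes it below -/
import Mathlib

section
/- Suppose in addition that M is maximally monotone, i.e., whenever (z,u) ∈ H × H satisfies ⟨u − v, z − y⟩ ≥ 0 for all (y,v) with v ∈ M(y), one has u ∈ M(z). If Zer(M+F) is nonempty, then the sequence (z_k)_{k≥0} converges weakly to an element of Zer(M+F): there exists z̄ ∈ H with −F(z̄) ∈ M(z̄) such that ⟨z_k, y⟩ → ⟨z̄, y⟩ as k → +∞ for every y ∈ H. -/
open scoped RealInnerProductSpace Pointwise
open Filter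

section Real

/-- A deterministic Robbins–Siegmund lemma. -/
lemma bounded_and_summable_of_perturbed_decrease {E D ε : ℕ → ℝ}
    (hE : ∀ n, 0 ≤ E n) (hD : ∀ n, 0 ≤ D n) (hε : ∀ n, 0 ≤ ε n) (hεs : Summable ε)
    (h : ∀ n, E (n + 1) ≤ (1 + ε n) * E n - D n) :
    (∃ R, ∀ n, E n ≤ R) ∧ Summable D := by
  have hbound : ∀ n, E n ≤ Real.exp (∑ j ∈ Finset.range n, ε j) * E 0 := by
    intro n
    induction n with
    | zero => simp
    | succ n ih =>
      rw [Finset.sum_range_succ, Real.exp_add]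
      have h1 : 1 + ε n ≤ Real.exp (ε n) := by linarith [Real.add_one_le_exp (ε n)]
      calc E (n + 1) ≤ (1 + ε n) * E n := by linarith [h n, hD n]
        _ ≤ Real.exp (ε n) * (Real.exp (∑ j ∈ Finset.range n, ε j) * E 0) := by
          gcongr
          exact hE n
        _ = _ := by ring
  obtain ⟨R, hR⟩ : ∃ R, ∀ n, E n ≤ R := by
    refine ⟨Real.exp (∑' j, ε j) * E 0, fun n => (hbound n).trans ?_⟩
    have := hεs.sum_le_tsum (Finset.range n) (fun j _ => hε j)
    gcongr
    exact hE 0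
  refine ⟨⟨R, hR⟩, ?_⟩
  have hsum : ∀ n, ∑ j ∈ Finset.range n, D j ≤ E 0 - E n + R * ∑ j ∈ Finset.range n, ε j := by
    intro n
    induction n with
    | zero => simp
    | succ n ih =>
      rw [Finset.sum_range_succ, Finset.sum_range_succ]
      nlinarith [h n, mul_le_mul_of_nonneg_left (hR n) (hε n)]
  refine summable_of_sum_range_le (c := E 0 + R * ∑' j, ε j) hD fun n => (hsum n).trans ?_
  have := mul_le_mul_of_nonneg_left (hεs.sum_le_tsum (Finset.range n) (fun j _ => hε j))
    ((hE 0).trans (hR 0))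
  linarith [hE n]

lemma tendsto_zero_of_nat_mul_sub_add_mul {b : ℝ} (hb : 1 ≤ b) {ψ : ℕ → ℝ}
    (h : Tendsto (fun n : ℕ => ((n : ℝ) + 1) * (ψ (n + 1) - ψ n) + b * ψ (n + 1))
      atTop (nhds 0)) :
    Tendsto ψ atTop (nhds 0) := by
  rw [Metric.tendsto_atTop] at h ⊢
  intro η hη
  obtain ⟨N, hN⟩ := h (b * (η / 2)) (by positivity)
  have key : ∀ n, ((n + N : ℕ) + 1 : ℝ) * (|ψ (n + N)| - η / 2) ≤ ((N : ℝ) + 1) * |ψ N| := by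
    intro n
    induction n with
    | zero => simp; nlinarith [abs_nonneg (ψ N)]
    | succ n ih =>
      have h1 := hN (n + N) (by omega)
      rw [Real.dist_eq, sub_zero] at h1
      rw [show n + 1 + N = n + N + 1 by ring]
      set m := n + N
      have hm : (0 : ℝ) ≤ m := by positivity
      have hN0 : (0 : ℝ) ≤ N := by positivity
      have h2 : ((m : ℝ) + 1 + b) * |ψ (m + 1)| ≤ (m + 1) * |ψ m| + b * (η / 2) := by
        rw [← abs_of_nonneg (show (0 : ℝ) ≤ m + 1 + b by linarith), ← abs_mul,
          show ((m : ℝ) + 1 + b) * ψ (m + 1)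
            = (m + 1) * ψ m + ((m + 1) * (ψ (m + 1) - ψ m) + b * ψ (m + 1)) by ring]
        refine (abs_add_le _ _).trans ?_
        rw [abs_mul, abs_of_nonneg (show (0 : ℝ) ≤ m + 1 by linarith)]
        linarith
      push_cast
      by_cases h3 : η / 2 ≤ |ψ (m + 1)|
      · nlinarith [mul_nonneg (sub_nonneg.2 hb) (sub_nonneg.2 h3)]
      · push Not at h3
        nlinarith [abs_nonneg (ψ N), mul_nonneg hN0 (abs_nonneg (ψ N)),
          mul_nonneg (show (0 : ℝ) ≤ m + 1 + 1 by linarith) (sub_nonneg.2 h3.le)]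
  have hlim : Tendsto (fun n : ℕ => ((N : ℝ) + 1) * |ψ N| / ((n : ℝ) + 1)) atTop (nhds 0) :=
    tendsto_const_nhds.div_atTop
      (tendsto_atTop_add_const_right _ _ tendsto_natCast_atTop_atTop)
  obtain ⟨N', hN'⟩ := (Metric.tendsto_atTop.1 hlim) (η / 2) (by positivity)
  refine ⟨N + N', fun n hn => ?_⟩
  have h1 := key (n - N)
  have h2 := hN' n (by omega)
  rw [Nat.sub_add_cancel (by omega)] at h1
  rw [Real.dist_eq, sub_zero] at h2 ⊢
  have h3 := (le_abs_self _).trans_lt h2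
  rw [div_lt_iff₀ (by positivity)] at h3
  have h4 := lt_of_mul_lt_mul_left (b := |ψ n| - η / 2) (c := η / 2) (a := (n : ℝ) + 1)
    (by linarith) (by positivity)
  linarith

/-- If `n (ψ n - ψ (n - 1)) + b ψ n` converges with `1 ≤ b`, then so does `ψ`. -/
lemma exists_tendsto_of_nat_mul_sub_add_mul {b : ℝ} (hb : 1 ≤ b) {ψ : ℕ → ℝ} {l : ℝ}
    (h : Tendsto (fun n : ℕ => ((n : ℝ) + 1) * (ψ (n + 1) - ψ n) + b * ψ (n + 1))
      atTop (nhds l)) :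
    Tendsto ψ atTop (nhds (l / b)) := by
  have hb0 : b ≠ 0 := by linarith
  have h1 := tendsto_zero_of_nat_mul_sub_add_mul hb (ψ := fun n => ψ n - l / b) (by
    have := h.sub_const l
    rw [sub_self] at this
    refine this.congr fun n => ?_
    field_simp
    ring)
  simpa using h1.add_const (l / b)

end Real

section Energy

variable {H : Type*} [NormedAddCommGroup H] [InnerProductSpace ℝ H]

/-- The energy of the Fast RFB method at time `x`, as a function of the distance `y` to a zero,
the scaled velocity `m`, the operator value `u`, its error `e` and its last increment `b`. -/
noncomputable def rfbEnergy (α c δ x : ℝ) (y m u e b : H) : ℝ :=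
  1 / 2 * ‖(α - c) • y + m + (x + α - 1) • u‖ ^ 2 + 1 / 2 * ((α - c) * (c - 1)) * ‖y‖ ^ 2
    + δ * (-x * ⟪m, u + e⟫ - 1 / 2 * x ^ 2 * ‖u‖ ^ 2 + 1 / 4 * x ^ 2 * ‖b‖ ^ 2)

lemma rfbEnergy_succ_sub (α c δ x : ℝ) (y D u Δ e e' b : H) :
    rfbEnergy α c δ (x + 1) (y + D) ((x + 1) • D) (u + Δ) e' Δ
      - rfbEnergy α c δ x y ((x + α) • (D + Δ) + c • u) u e b
    = -(c - 1) * (α - c) * ⟪y, u⟫ - (c - 1) * (x + α) * ‖D + u‖ ^ 2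
      - (c - 1) * (x + α) * ⟪Δ, D + u⟫ - (c - 1) ^ 2 * ⟪u, D + u⟫
      + 1 / 2 * (c - 1) ^ 2 * ‖D + u‖ ^ 2 + 1 / 2 * ((α - c) * (c - 1)) * ‖D‖ ^ 2
      + δ * (-(x + 1) ^ 2 * ⟪D, (u + Δ + e') - (u + e)⟫ + ((α - 2) * x - 1) * ⟪D, u⟫
        + ((α - 2) * x - 1) * ⟪D, e⟫
        + (x * (c - 1) - 1 / 2) * ‖u‖ ^ 2 + x * c * ⟪u, e⟫ + ((α - 2) * x - 1) * ⟪u, Δ⟫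
        + x * (x + α) * ⟪Δ, e⟫ - 1 / 4 * (x + 1) ^ 2 * ‖Δ‖ ^ 2 - 1 / 4 * x ^ 2 * ‖b‖ ^ 2) := by
  unfold rfbEnergy
  simp only [← real_inner_self_eq_norm_sq, inner_add_left, inner_add_right, inner_sub_right,
    real_inner_smul_left, real_inner_smul_right]
  rw [real_inner_comm y D, real_inner_comm y u, real_inner_comm y Δ, real_inner_comm u D,
    real_inner_comm u Δ, real_inner_comm Δ D]
  ring

lemma le_rfbEnergy {α c δ r x : ℝ} (hα : 1 < α) (hδ0 : 0 < δ) (hδ : δ ≤ 1 / 128)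
    (hc : c < α) (hr : r < 1 / 2) (hx : 2 * (α - 1) ≤ x)
    {y m u e b : H} (he : ‖e‖ ≤ r * ‖b‖) (hy : 0 ≤ ⟪y, u + e⟫) :
    1 / 2 * ((α - c) * (c - 1)) * ‖y‖ ^ 2 + δ / 64 * x ^ 2 * (‖u‖ ^ 2 + ‖b‖ ^ 2)
      ≤ rfbEnergy α c δ x y m u e b := by
  unfold rfbEnergy
  set X := (α - c) • y + m + (x + α - 1) • u with hX
  have hm : ⟪m, u + e⟫ = ⟪X, u + e⟫ - (α - c) * ⟪y, u + e⟫
      - (x + α - 1) * (‖u‖ ^ 2 + ⟪u, e⟫) := by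
    rw [hX, ← real_inner_self_eq_norm_sq]
    simp only [inner_add_left, inner_add_right, real_inner_smul_left]
    ring
  have hx0 : 0 < x := by linarith
  have hB := norm_nonneg b
  have hU := norm_nonneg u
  have heB : ‖e‖ ≤ 1 / 2 * ‖b‖ := he.trans (by gcongr)
  have hue : -(1 / 2 * (‖u‖ * ‖b‖)) ≤ ⟪u, e⟫ := by
    have := (abs_le.1 (abs_real_inner_le_norm u e)).1
    nlinarith [mul_le_mul_of_nonneg_left heB hU]
  have hXe : ⟪X, u + e⟫ ≤ ‖X‖ * (‖u‖ + ‖b‖) := by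
    refine (real_inner_le_norm _ _).trans ?_
    gcongr
    exact (norm_add_le _ _).trans (by linarith)
  rw [hm]
  set U := ‖u‖
  set B := ‖b‖
  set Z := ‖X‖
  have hcross : δ * x * (Z * (U + B)) ≤ 1 / 4 * Z ^ 2 + δ * (1 / 64 * x ^ 2 * (U ^ 2 + B ^ 2)) := by
    have h1 : δ * x * (Z * (U + B)) ≤ 1 / 4 * Z ^ 2 + (δ * x * (U + B)) ^ 2 := by
      nlinarith [sq_nonneg (1 / 2 * Z - δ * x * (U + B))]
    have h2 : (δ * x * (U + B)) ^ 2 ≤ δ * (δ * x ^ 2 * (2 * (U ^ 2 + B ^ 2))) := by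
      have : 0 ≤ δ ^ 2 * x ^ 2 * (U - B) ^ 2 := by positivity
      nlinarith
    have h3 : δ * (δ * x ^ 2 * (2 * (U ^ 2 + B ^ 2)))
        ≤ δ * (1 / 128 * x ^ 2 * (2 * (U ^ 2 + B ^ 2))) := by gcongr
    linarith
  have hquad : 1 / 32 * x ^ 2 * (U ^ 2 + B ^ 2) ≤
      x * (x + α - 1) * (U ^ 2 - 1 / 2 * (U * B)) - 1 / 2 * x ^ 2 * U ^ 2
        + 1 / 4 * x ^ 2 * B ^ 2 := by
    have h1 : x ^ 2 * (1 / 16 * (U ^ 2 + B ^ 2))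
        ≤ x ^ 2 * (1 / 2 * U ^ 2 - 1 / 2 * (U * B) + 1 / 4 * B ^ 2) := by
      gcongr
      nlinarith [sq_nonneg (U - 4 / 7 * B), sq_nonneg B]
    have h2 : x * (α - 1) * (-(1 / 16) * B ^ 2) ≤ x * (α - 1) * (U ^ 2 - 1 / 2 * (U * B)) := by
      have : 0 < α - 1 := by linarith
      gcongr
      nlinarith [sq_nonneg (U - 1 / 4 * B)]
    have h3 : x * (α - 1) * (1 / 16 * B ^ 2) ≤ x * (x / 2) * (1 / 16 * B ^ 2) := by
      gcongr; linarith
    nlinarith [mul_nonneg (sq_nonneg x) (sq_nonneg U)]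
  have h1 : 0 ≤ δ * (x * ((α - c) * ⟪y, u + e⟫)) := by
    have : 0 < α - c := by linarith
    positivity
  have h2 := mul_le_mul_of_nonneg_left hXe (show 0 ≤ δ * x by positivity)
  have h3 : δ * (x * (x + α - 1) * (U ^ 2 - 1 / 2 * (U * B)))
      ≤ δ * (x * (x + α - 1) * (U ^ 2 + ⟪u, e⟫)) := by
    have : 0 < x + α - 1 := by linarith
    gcongr
    linarith
  have h4 := mul_le_mul_of_nonneg_left hquad hδ0.le
  nlinarith [sq_nonneg Z]

end Energy

section Step

variable {H : Type*} [NormedAddCommGroup H] [InnerProductSpace ℝ H]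

set_option maxHeartbeats 400000 in
lemma rfbEnergy_succ_le_add_cross {α c δ r x : ℝ} (hc1 : 1 < c) (hcu : c < α - 1)
    (hδ0 : 0 < δ) (hδ1 : δ ≤ 1) (hδ : δ * (α - 2) ^ 2 ≤ (c - 1) * (α - 1 - c))
    (hr0 : 0 ≤ r) (hr : r < 1 / 2) (hx1 : 1 ≤ x) (hxr : r * α ≤ (1 / 2 - r) / 2 * x)
    {y D u Δ e e' b : H} (he : ‖e‖ ≤ r * ‖b‖) (hmon : 0 ≤ ⟪D, (u + Δ + e') - (u + e)⟫) :
    rfbEnergy α c δ (x + 1) (y + D) ((x + 1) • D) (u + Δ) e' Δ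
      ≤ rfbEnergy α c δ x y ((x + α) • (D + Δ) + c • u) u e b
        - (c - 1) * (α - c) * ⟪y, u + e⟫ + (c - 1) * (α - c) * (‖y‖ * ‖b‖)
        - (c - 1) / 2 * x * ‖D + u‖ ^ 2 - δ * (α - 1 - c) / 2 * x * ‖u‖ ^ 2
        - δ * ((1 / 2 - r) / 4) * x ^ 2 * (‖Δ‖ ^ 2 + ‖b‖ ^ 2)
        + ((c - 1) * (1 + α) + 2 * (α - 1) + c) * (x * ((‖D + u‖ + ‖u‖) * (‖Δ‖ + ‖b‖)))
        + (2 * (c - 1) ^ 2 + (α - c) * (c - 1) + 2) * (‖D + u‖ ^ 2 + ‖u‖ ^ 2) := by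
  have hid := rfbEnergy_succ_sub α c δ x y D u Δ e e' b
  set E' := rfbEnergy α c δ (x + 1) (y + D) ((x + 1) • D) (u + Δ) e' Δ
  set E := rfbEnergy α c δ x y ((x + α) • (D + Δ) + c • u) u e b
  have hx0 : 0 < x := by linarith
  have ha : 0 < c - 1 := by linarith
  have hl : 0 < α - c := by linarith
  have hbt : 0 < α - 1 - c := by linarith
  have hα2 : 0 < α - 2 := by linarith
  have hα0 : 0 < α := by linarith
  have hα1 : 0 < α - 1 := by linarith
  have heb : ‖e‖ ≤ ‖b‖ := he.trans (mul_le_of_le_one_left (norm_nonneg b) (by linarith))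
  have hDn : ‖D‖ ≤ ‖D + u‖ + ‖u‖ := by simpa using norm_sub_le (D + u) u
  have hDu : ⟪D, u⟫ = ⟪D + u, u⟫ - ‖u‖ ^ 2 := by
    rw [inner_add_left, real_inner_self_eq_norm_sq]; ring
  have hyu : ⟪y, u⟫ = ⟪y, u + e⟫ - ⟪y, e⟫ := by rw [inner_add_right]; ring
  have hSu := abs_le.1 (abs_real_inner_le_norm (D + u) u)
  have huS := abs_le.1 (abs_real_inner_le_norm u (D + u))
  have hye := (real_inner_le_norm y e).trans
    (mul_le_mul_of_nonneg_left heb (norm_nonneg y))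
  have hΔS := (abs_le.1 (abs_real_inner_le_norm Δ (D + u))).1
  have hDe : |⟪D, e⟫| ≤ (‖D + u‖ + ‖u‖) * ‖b‖ :=
    (abs_real_inner_le_norm D e).trans (by gcongr)
  have hue : ⟪u, e⟫ ≤ ‖u‖ * ‖b‖ :=
    (real_inner_le_norm u e).trans (by gcongr)
  have huΔ := abs_real_inner_le_norm u Δ
  have hΔe : ⟪Δ, e⟫ ≤ ‖Δ‖ * (r * ‖b‖) := (real_inner_le_norm Δ e).trans (by gcongr)
  have hs := norm_nonneg (D + u)
  have hU := norm_nonneg u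
  have hA := norm_nonneg Δ
  have hB := norm_nonneg b
  have hD0 := norm_nonneg D
  set s := ‖D + u‖
  set U := ‖u‖
  set A := ‖Δ‖
  set B := ‖b‖
  set d := ‖D‖
  have hcoef : |(α - 2) * x - 1| ≤ (α - 1) * x := by
    have := mul_pos hα2 hx0
    rw [abs_le]; constructor <;> linarith
  have h1 : (c - 1) * (α - c) * ⟪y, e⟫ ≤ (c - 1) * (α - c) * (‖y‖ * B) := by gcongr
  have hxα : 0 < x + α := by linarith
  have h2 : -((c - 1) * (x + α) * ⟪Δ, D + u⟫) ≤ (c - 1) * (1 + α) * (x * (A * s)) := by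
    have t1 : (c - 1) * (x + α) * -⟪Δ, D + u⟫ ≤ (c - 1) * (x + α) * (A * s) := by
      gcongr
      linarith
    have t2 : (c - 1) * (x + α) * (A * s) ≤ (c - 1) * ((1 + α) * x) * (A * s) := by
      gcongr
      linarith [mul_nonneg hα0.le (sub_nonneg.2 hx1)]
    linarith
  have h3 : -((c - 1) ^ 2 * ⟪u, D + u⟫) + 1 / 2 * (c - 1) ^ 2 * s ^ 2
      + 1 / 2 * ((α - c) * (c - 1)) * d ^ 2
      ≤ (2 * (c - 1) ^ 2 + (α - c) * (c - 1)) * (s ^ 2 + U ^ 2) := by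
    have t1 : (c - 1) ^ 2 * -⟪u, D + u⟫ ≤ (c - 1) ^ 2 * (s ^ 2 + U ^ 2) := by
      gcongr
      linarith [sq_nonneg (s - U), sq_nonneg s, sq_nonneg U]
    have t2 : (α - c) * (c - 1) * (1 / 2 * d ^ 2) ≤ (α - c) * (c - 1) * (s ^ 2 + U ^ 2) := by
      gcongr
      linarith [sq_nonneg (s - U), mul_self_le_mul_self hD0 hDn]
    linarith [mul_nonneg (sq_nonneg (c - 1)) (sq_nonneg s),
      mul_nonneg (sq_nonneg (c - 1)) (sq_nonneg U)]
  have h4 : δ * (((α - 2) * x - 1) * ⟪D, u⟫ + (x * (c - 1) - 1 / 2) * U ^ 2)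
      ≤ (c - 1) / 2 * x * s ^ 2 - δ * (α - 1 - c) / 2 * x * U ^ 2 + 2 * (s ^ 2 + U ^ 2) := by
    have t1 : δ * ((α - 2) * (s * U)) ≤ (c - 1) / 2 * s ^ 2 + δ * (α - 1 - c) / 2 * U ^ 2 := by
      have p1 := sq_nonneg ((c - 1) * s - δ * (α - 2) * U)
      have p2 : δ * (δ * (α - 2) ^ 2) * U ^ 2 ≤ δ * ((c - 1) * (α - 1 - c)) * U ^ 2 := by gcongr
      refine le_of_mul_le_mul_left (a := 2 * (c - 1)) ?_ (by linarith)
      linarith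
    have t2 : δ * ((α - 2) * x * ⟪D + u, u⟫)
        ≤ x * ((c - 1) / 2 * s ^ 2 + δ * (α - 1 - c) / 2 * U ^ 2) := by
      calc δ * ((α - 2) * x * ⟪D + u, u⟫) ≤ δ * ((α - 2) * x * (s * U)) := by
            gcongr
            exact hSu.2
        _ = x * (δ * ((α - 2) * (s * U))) := by ring
        _ ≤ _ := by gcongr
    have t3 : δ * (-⟪D + u, u⟫ + 1 / 2 * U ^ 2) ≤ 1 * (2 * (s ^ 2 + U ^ 2)) := by
      calc _ ≤ δ * (2 * (s ^ 2 + U ^ 2)) := by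
            gcongr
            linarith [sq_nonneg (s - U), sq_nonneg s, sq_nonneg U]
        _ ≤ _ := by gcongr
    rw [hDu]
    linarith
  have h5 : δ * (((α - 2) * x - 1) * ⟪D, e⟫ + x * c * ⟪u, e⟫ + ((α - 2) * x - 1) * ⟪u, Δ⟫)
      ≤ (α - 1) * (x * ((s + U) * B)) + c * (x * (U * B)) + (α - 1) * (x * (U * A)) := by
    have t1 : ((α - 2) * x - 1) * ⟪D, e⟫ ≤ (α - 1) * x * ((s + U) * B) := by
      refine (le_abs_self _).trans ?_
      rw [abs_mul]
      gcongr
    have t2 : ((α - 2) * x - 1) * ⟪u, Δ⟫ ≤ (α - 1) * x * (U * A) := by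
      refine (le_abs_self _).trans ?_
      rw [abs_mul]
      gcongr
    have t3 : x * c * ⟪u, e⟫ ≤ x * c * (U * B) := by gcongr
    calc _ ≤ δ * ((α - 1) * (x * ((s + U) * B)) + c * (x * (U * B)) + (α - 1) * (x * (U * A))) := by
          refine mul_le_mul_of_nonneg_left ?_ hδ0.le
          linarith
      _ ≤ 1 * ((α - 1) * (x * ((s + U) * B)) + c * (x * (U * B)) + (α - 1) * (x * (U * A))) := by
          gcongr
      _ = _ := one_mul _
  have h6 : δ * (x * (x + α) * ⟪Δ, e⟫ - 1 / 4 * (x + 1) ^ 2 * A ^ 2 - 1 / 4 * x ^ 2 * B ^ 2)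
      ≤ δ * (-((1 / 2 - r) / 4) * x ^ 2 * (A ^ 2 + B ^ 2)) := by
    refine mul_le_mul_of_nonneg_left ?_ hδ0.le
    have t1 : x * (x + α) * ⟪Δ, e⟫ ≤ x * (x + α) * (A * (r * B)) := by gcongr
    have t2 : x * (r * (x + α)) * (A * B) ≤ x * ((1 / 2 + r) / 2 * x) * (A * B) := by
      have : r * (x + α) ≤ (1 / 2 + r) / 2 * x := by linarith
      gcongr
    have t3 : x ^ 2 * ((1 / 2 + r) / 2) * (A * B)
        ≤ x ^ 2 * ((1 / 2 + r) / 2) * (1 / 2 * (A ^ 2 + B ^ 2)) := by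
      refine mul_le_mul_of_nonneg_left ?_ (by positivity)
      linarith [sq_nonneg (A - B)]
    linarith [mul_nonneg hx0.le (sq_nonneg A), sq_nonneg A]
  have h7 : 0 ≤ δ * ((x + 1) ^ 2 * ⟪D, (u + Δ + e') - (u + e)⟫) := by positivity
  have h8 : 0 ≤ (c - 1) * α * s ^ 2 := by positivity
  have h9 : (c - 1) * (1 + α) * (x * (A * s)) + (α - 1) * (x * ((s + U) * B)) + c * (x * (U * B))
      + (α - 1) * (x * (U * A))
      ≤ ((c - 1) * (1 + α) + 2 * (α - 1) + c) * (x * ((s + U) * (A + B))) := by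
    have g1 : 0 ≤ x * (s * A) := by positivity
    have g2 : 0 ≤ x * (s * B) := by positivity
    have g3 : 0 ≤ x * (U * A) := by positivity
    have g4 : 0 ≤ x * (U * B) := by positivity
    have k1 : 0 ≤ (c - 1) * (1 + α) := by
      have : 0 < 1 + α := by linarith
      positivity
    have k2 : 0 ≤ α - 1 := by linarith
    have k3 : 0 ≤ c := by linarith
    have q (k w : ℝ) (hk : 0 ≤ k) (hw : 0 ≤ w) : 0 ≤ k * w := mul_nonneg hk hw
    linarith [q _ _ k1 g1, q _ _ k1 g2, q _ _ k1 g3, q _ _ k1 g4, q _ _ k2 g1, q _ _ k2 g2,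
      q _ _ k2 g3, q _ _ k2 g4, q _ _ k3 g1, q _ _ k3 g2, q _ _ k3 g3, q _ _ k3 g4]
  rw [hyu] at hid
  linarith

lemma exists_rfbEnergy_succ_le {α c δ r : ℝ} (hc1 : 1 < c) (hcu : c < α - 1)
    (hδ0 : 0 < δ) (hδ1 : δ ≤ 1) (hδ : δ * (α - 2) ^ 2 ≤ (c - 1) * (α - 1 - c))
    (hr0 : 0 ≤ r) (hr : r < 1 / 2) :
    ∃ μ > 0, ∃ C ≥ 0, ∃ K : ℝ, ∀ x ≥ K, ∀ {y D u Δ e e' b : H}, ‖e‖ ≤ r * ‖b‖ →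
      0 ≤ ⟪D, (u + Δ + e') - (u + e)⟫ →
      rfbEnergy α c δ (x + 1) (y + D) ((x + 1) • D) (u + Δ) e' Δ
        ≤ rfbEnergy α c δ x y ((x + α) • (D + Δ) + c • u) u e b
          + C * (1 / x ^ 2) * ‖y‖ ^ 2 - (c - 1) * (α - c) * ⟪y, u + e⟫
          - μ * (x * (‖D + u‖ ^ 2 + ‖u‖ ^ 2) + x ^ 2 * ‖b‖ ^ 2) := by
  have ha : 0 < c - 1 := by linarith
  have hl : 0 < α - c := by linarith
  have hbt : 0 < α - 1 - c := by linarith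
  have hσ : 0 < (1 / 2 - r) / 4 := by linarith
  obtain ⟨η, hη, hη4⟩ : ∃ η > 0, 4 * η = δ * ((1 / 2 - r) / 4) :=
    ⟨δ * ((1 / 2 - r) / 4) / 4, by positivity, by ring⟩
  obtain ⟨ν, hν, hν1, hν2⟩ : ∃ ν > 0, ν ≤ (c - 1) / 2 ∧ ν ≤ δ * (α - 1 - c) / 2 :=
    ⟨min ((c - 1) / 2) (δ * (α - 1 - c) / 2), lt_min (by positivity) (by positivity),
      min_le_left _ _, min_le_right _ _⟩
  set C1 := (c - 1) * (1 + α) + 2 * (α - 1) + c with hC1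
  set C2 := 2 * (c - 1) ^ 2 + (α - c) * (c - 1) + 2 with hC2
  set q := (c - 1) * (α - c) with hq
  refine ⟨min (ν / 2) η, lt_min (by positivity) hη, q ^ 2 / (4 * η), by positivity,
    max 1 (max (r * α / ((1 / 2 - r) / 2)) ((C1 ^ 2 / η + C2) / (ν / 2))), ?_⟩
  intro x hx y D u Δ e e' b he hmon
  obtain ⟨hx1, hx'⟩ := max_le_iff.1 hx
  obtain ⟨hx2, hx3⟩ := max_le_iff.1 hx'
  rw [div_le_iff₀ (by linarith)] at hx2
  rw [div_le_iff₀ (by linarith)] at hx3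
  have hx0 : 0 < x := by linarith
  have hmain := rfbEnergy_succ_le_add_cross hc1 hcu hδ0 hδ1 hδ hr0 hr hx1 (by linarith) he hmon
    (y := y)
  rw [← hC1, ← hC2, ← hq] at hmain
  set s := ‖D + u‖
  set U := ‖u‖
  set A := ‖Δ‖
  set B := ‖b‖
  have h1 : C1 * (x * ((s + U) * (A + B)))
      ≤ η * x ^ 2 * (A ^ 2 + B ^ 2) + C1 ^ 2 / η * (s ^ 2 + U ^ 2) := by
    have t1 : C1 * (x * ((s + U) * (A + B)))
        ≤ η / 2 * (x * (A + B)) ^ 2 + C1 ^ 2 / η / 2 * (s + U) ^ 2 := by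
      have : 0 ≤ (η * (x * (A + B)) - C1 * (s + U)) ^ 2 / (2 * η) := by positivity
      have e1 : (η * (x * (A + B)) - C1 * (s + U)) ^ 2 / (2 * η)
        = η / 2 * (x * (A + B)) ^ 2 + C1 ^ 2 / η / 2 * (s + U) ^ 2
          - C1 * (x * ((s + U) * (A + B))) := by
        field_simp
        ring
      linarith
    have t2 : 0 ≤ η / 2 * x ^ 2 * (A - B) ^ 2 := by positivity
    have t3 : 0 ≤ C1 ^ 2 / η / 2 * (s - U) ^ 2 := by positivity
    linarith
  have h2 : q * (‖y‖ * B) ≤ η * x ^ 2 * B ^ 2 + q ^ 2 / (4 * η) * (1 / x ^ 2) * ‖y‖ ^ 2 := by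
    have : 0 ≤ (2 * η * x ^ 2 * B - q * ‖y‖) ^ 2 / (4 * η * x ^ 2) := by positivity
    have e1 : (2 * η * x ^ 2 * B - q * ‖y‖) ^ 2 / (4 * η * x ^ 2)
      = η * x ^ 2 * B ^ 2 + q ^ 2 / (4 * η) * (1 / x ^ 2) * ‖y‖ ^ 2 - q * (‖y‖ * B) := by
      field_simp
      ring
    linarith
  have h3 : (C1 ^ 2 / η + C2) * (s ^ 2 + U ^ 2) ≤ x * (ν / 2) * (s ^ 2 + U ^ 2) := by gcongr
  have h4 : ν * x * s ^ 2 ≤ (c - 1) / 2 * x * s ^ 2 := by gcongr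
  have h5 : ν * x * U ^ 2 ≤ δ * (α - 1 - c) / 2 * x * U ^ 2 := by gcongr
  have h6 : min (ν / 2) η * (x * (s ^ 2 + U ^ 2)) ≤ ν / 2 * (x * (s ^ 2 + U ^ 2)) := by
    gcongr
    exact min_le_left _ _
  have h7 : min (ν / 2) η * (x ^ 2 * B ^ 2) ≤ η * (x ^ 2 * B ^ 2) := by
    gcongr
    exact min_le_right _ _
  have h8 : 0 ≤ η * x ^ 2 * A ^ 2 := by positivity
  have h9 : 0 ≤ η * x ^ 2 * B ^ 2 := by positivity
  rw [← hη4] at hmain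
  linarith

end Step

section Weak

variable {H : Type*} [NormedAddCommGroup H] [InnerProductSpace ℝ H] [CompleteSpace H]

/-- A bounded sequence in a Hilbert space converges weakly along every ultrafilter. -/
lemma exists_weak_limit_ultrafilter {ι : Type*} (U : Ultrafilter ι) {x : ι → H} {R : ℝ}
    (hx : ∀ n, ‖x n‖ ≤ R) :
    ∃ a : H, ∀ y : H, Tendsto (fun n => ⟪x n, y⟫) U (nhds ⟪a, y⟫) := by
  let φ : ι → WeakDual ℝ H := fun n => StrongDual.toWeakDual (InnerProductSpace.toDual ℝ H (x n))
  have hmem : ↑(U.map φ) ≤ 𝓟 (WeakDual.toStrongDual ⁻¹' Metric.closedBall (0 : StrongDual ℝ H) R) := by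
    rw [le_principal_iff]
    refine Filter.mem_map.2 (Filter.univ_mem' fun n => ?_)
    simpa [φ] using hx n
  obtain ⟨g, -, hg⟩ := (WeakDual.isCompact_closedBall (0 : StrongDual ℝ H) R).ultrafilter_le_nhds
    (U.map φ) hmem
  refine ⟨(InnerProductSpace.toDual ℝ H).symm (WeakDual.toStrongDual g), fun y => ?_⟩
  have h := ((WeakDual.eval_continuous y).tendsto g).comp (show Tendsto φ U (nhds g) from hg)
  rw [InnerProductSpace.toDual_symm_apply]
  exact h

lemma exists_real_limit_ultrafilter {ι : Type*} (U : Ultrafilter ι) {g : ι → ℝ} {R : ℝ}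
    (hg : ∀ n, |g n| ≤ R) : ∃ s, Tendsto g U (nhds s) := by
  obtain ⟨s, hs⟩ := exists_weak_limit_ultrafilter U (H := ℝ) (x := g) (R := R) hg
  exact ⟨s, by simpa using hs 1⟩

/-- Demiclosedness at `0` of `M + F`, for `M` maximally monotone and `F` monotone Lipschitz. -/
lemma neg_mem_of_weak_limit {M : H → Set H} {F : H → H} {L : ℝ}
    (hM : ∀ z y u' v', u' ∈ M z → v' ∈ M y → 0 ≤ ⟪v' - u', y - z⟫)
    (hMmax : ∀ z₀ u₀ : H, (∀ y₀ v₀ : H, v₀ ∈ M y₀ → 0 ≤ ⟪u₀ - v₀, z₀ - y₀⟫) → u₀ ∈ M z₀)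
    (hFmono : ∀ z y, 0 ≤ ⟪F y - F z, y - z⟫) (hL : 0 < L)
    (hFlip : ∀ z y, ‖F y - F z‖ ≤ L * ‖y - z‖)
    {U : Ultrafilter ℕ} (hU : (U : Filter ℕ) ≤ atTop) {z ξ : ℕ → H} {R : ℝ} (hz : ∀ n, ‖z n‖ ≤ R)
    (hξ : ∀ᶠ n in atTop, ξ n ∈ M (z n))
    (hp : Tendsto (fun n => ξ n + F (z n)) atTop (nhds 0))
    {a : H} (ha : ∀ y : H, Tendsto (fun n => ⟪z n, y⟫) U (nhds ⟪a, y⟫)) :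
    -F a ∈ M a := by
  have hR : 0 ≤ R := (norm_nonneg _).trans (hz 0)
  have hFz : ∀ n, ‖F (z n)‖ ≤ L * R + ‖F 0‖ := fun n => by
    have h1 := hFlip 0 (z n)
    have h2 := norm_add_le (F (z n) - F 0) (F 0)
    rw [sub_add_cancel] at h2
    rw [sub_zero] at h1
    nlinarith [hz n]
  obtain ⟨f, hf⟩ := exists_weak_limit_ultrafilter U hFz
  obtain ⟨s, hs⟩ := exists_real_limit_ultrafilter U (g := fun n => ⟪F (z n), z n⟫)
    (R := (L * R + ‖F 0‖) * R) fun n => (abs_real_inner_le_norm _ _).trans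
      (mul_le_mul (hFz n) (hz n) (norm_nonneg _) (by positivity))
  have hk : ∀ l, Tendsto (fun k => ⟪F (z k) - F (z l), z k - z l⟫) U
      (nhds (s - ⟪a, F (z l)⟫ - ⟪f, z l⟫ + ⟪F (z l), z l⟫)) := fun l => by
    refine (((hs.sub (ha (F (z l)))).sub (hf (z l))).add_const ⟪F (z l), z l⟫).congr fun k => ?_
    rw [inner_sub_left, inner_sub_right, inner_sub_right, real_inner_comm (F (z l)) (z k)]
    ring
  have hl : Tendsto (fun l => s - ⟪a, F (z l)⟫ - ⟪f, z l⟫ + ⟪F (z l), z l⟫) U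
      (nhds (s - ⟪f, a⟫ - ⟪a, f⟫ + s)) := by
    refine (((hf a).const_sub s).sub (ha f) |>.add hs).congr fun l => ?_
    rw [real_inner_comm a, real_inner_comm f]
  have hfa : ⟪a, f⟫ = ⟪f, a⟫ := real_inner_comm _ _
  have hsle : s ≤ ⟪f, a⟫ := by
    refine le_of_forall_pos_le_add fun ε hε => ?_
    have hpε : ∀ᶠ n in atTop, ξ n ∈ M (z n) ∧ ‖ξ n + F (z n)‖ * (4 * (R + 1)) < ε := by
      have := (hp.norm.mul_const (4 * (R + 1)))
      rw [norm_zero, zero_mul] at this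
      exact hξ.and (this.eventually_lt_const hε)
    have hpU := hpε.filter_mono hU
    have h1 : ∀ᶠ l in (U : Filter ℕ),
        s - ⟪a, F (z l)⟫ - ⟪f, z l⟫ + ⟪F (z l), z l⟫ ≤ ε := by
      filter_upwards [hpU] with l hl'
      refine le_of_tendsto (hk l) ?_
      filter_upwards [hpU] with k hk'
      have h2 := hM _ _ _ _ hl'.1 hk'.1
      have h3 : ⟪F (z k) - F (z l), z k - z l⟫
          = ⟪(ξ k + F (z k)) - (ξ l + F (z l)), z k - z l⟫ - ⟪ξ k - ξ l, z k - z l⟫ := by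
        rw [← inner_sub_left]; congr 1; abel
      have h4 := real_inner_le_norm ((ξ k + F (z k)) - (ξ l + F (z l))) (z k - z l)
      have h5 := norm_sub_le (ξ k + F (z k)) (ξ l + F (z l))
      have h6 := norm_sub_le (z k) (z l)
      have h7 : ‖(ξ k + F (z k)) - (ξ l + F (z l))‖ * ‖z k - z l‖
          ≤ (‖ξ k + F (z k)‖ + ‖ξ l + F (z l)‖) * (2 * (R + 1)) := by
        gcongr
        linarith [hz k, hz l]
      linarith [hl'.2, hk'.2]
    have h2 := le_of_tendsto hl h1
    linarith
  have hles : ⟪f, a⟫ ≤ s := by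
    have h1 := ge_of_tendsto' hl fun l => ge_of_tendsto' (hk l) fun k => hFmono (z l) (z k)
    linarith
  have hfeq : f = F a := by
    have hy : ∀ y, 0 ≤ ⟪f - F y, a - y⟫ := fun y => by
      have h1 : Tendsto (fun k => ⟪F (z k) - F y, z k - y⟫) U
          (nhds (s - ⟪f, y⟫ - ⟪a, F y⟫ + ⟪F y, y⟫)) := by
        refine (((hs.sub (hf y)).sub (ha (F y))).add_const ⟪F y, y⟫).congr fun k => ?_
        rw [inner_sub_left, inner_sub_right, inner_sub_right, real_inner_comm (F y) (z k)]
        ring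
      have h2 := ge_of_tendsto' h1 fun k => hFmono y (z k)
      rw [inner_sub_left, inner_sub_right, inner_sub_right, real_inner_comm a (F y)]
      linarith
    set h := F a - f with hh
    have h1 := hy (a - (1 / (2 * L)) • h)
    rw [sub_sub_cancel, real_inner_smul_right] at h1
    have h2 : 0 ≤ ⟪f - F (a - (1 / (2 * L)) • h), h⟫ :=
      nonneg_of_mul_nonneg_right h1 (by positivity)
    have h3 : ⟪f - F (a - (1 / (2 * L)) • h), h⟫
        = -‖h‖ ^ 2 + ⟪F a - F (a - (1 / (2 * L)) • h), h⟫ := by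
      rw [← real_inner_self_eq_norm_sq, ← inner_neg_left, ← inner_add_left, hh]
      congr 1; abel
    have h4 : ⟪F a - F (a - (1 / (2 * L)) • h), h⟫ ≤ 1 / 2 * ‖h‖ ^ 2 := by
      refine (real_inner_le_norm _ _).trans ?_
      have h5 := hFlip (a - (1 / (2 * L)) • h) a
      rw [sub_sub_cancel, norm_smul, Real.norm_of_nonneg (by positivity)] at h5
      calc _ ≤ L * (1 / (2 * L) * ‖h‖) * ‖h‖ := by gcongr
        _ = _ := by field_simp
    have h6 : ‖h‖ = 0 := by nlinarith [norm_nonneg h]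
    exact (sub_eq_zero.1 (norm_eq_zero.1 h6)).symm
  refine hMmax _ _ fun y u hu => ?_
  have hpz : Tendsto (fun k => ⟪ξ k + F (z k), z k - y⟫) U (nhds 0) := by
    have h1 : Tendsto (fun k => ‖ξ k + F (z k)‖ * (R + ‖y‖)) U (nhds 0) := by
      simpa using (hp.mono_left hU).norm.mul_const (R + ‖y‖)
    refine squeeze_zero_norm (fun k => ?_) h1
    refine (norm_inner_le_norm _ _).trans ?_
    gcongr
    exact (norm_sub_le _ _).trans (by linarith [hz k])
  have h1 : Tendsto (fun k => ⟪ξ k - u, z k - y⟫) U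
      (nhds (0 - s + ⟪f, y⟫ - (⟪a, u⟫ - ⟪y, u⟫))) := by
    refine (((hpz.sub hs).add (hf y)).sub ((ha u).sub_const ⟪y, u⟫)).congr fun k => ?_
    rw [inner_add_left, inner_sub_left, inner_sub_right (F (z k)), ← inner_sub_left,
      real_inner_comm u (z k - y)]
    ring
  have h2 := ge_of_tendsto h1 ((hξ.filter_mono hU).mono fun k hk => hM _ _ _ _ hu hk)
  rw [← hfeq, inner_sub_left, inner_neg_left, inner_sub_right, real_inner_comm _ u,
    inner_sub_left]
  linarith

/-- **Opial's lemma**, with weak cluster points expressed by ultrafilters. -/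
lemma exists_weak_limit_of_opial {S : Set H} {z : ℕ → H} {R : ℝ} (hz : ∀ n, ‖z n‖ ≤ R)
    (hnorm : ∀ a ∈ S, ∃ l, Tendsto (fun n => ‖z n - a‖) atTop (nhds l))
    (hcluster : ∀ U : Ultrafilter ℕ, (U : Filter ℕ) ≤ atTop → ∀ a : H,
      (∀ y : H, Tendsto (fun n => ⟪z n, y⟫) U (nhds ⟪a, y⟫)) → a ∈ S) :
    ∃ a ∈ S, ∀ y : H, Tendsto (fun n => ⟪z n, y⟫) atTop (nhds ⟪a, y⟫) := by
  obtain ⟨a, ha⟩ := exists_weak_limit_ultrafilter (Ultrafilter.of atTop) hz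
  have haS := hcluster _ (Ultrafilter.of_le _) a ha
  refine ⟨a, haS, fun y => ?_⟩
  rw [tendsto_iff_ultrafilter]
  intro U hU
  obtain ⟨b, hb⟩ := exists_weak_limit_ultrafilter U hz
  have hbS := hcluster U hU b hb
  obtain ⟨l, hl⟩ := hnorm a haS
  obtain ⟨m, hm⟩ := hnorm b hbS
  have hlim : Tendsto (fun n => ⟪z n, a - b⟫) atTop
      (nhds (1 / 2 * (m ^ 2 - l ^ 2 + ‖a‖ ^ 2 - ‖b‖ ^ 2))) := by
    refine ((((hm.pow 2).sub (hl.pow 2)).add_const (‖a‖ ^ 2)).sub_const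
      (‖b‖ ^ 2) |>.const_mul (1 / 2)).congr fun n => ?_
    rw [norm_sub_sq_real, norm_sub_sq_real, inner_sub_right]
    ring
  have h1 := tendsto_nhds_unique (ha (a - b)) (hlim.mono_left (Ultrafilter.of_le _))
  have h2 := tendsto_nhds_unique (hb (a - b)) (hlim.mono_left hU)
  have h3 : ⟪a - b, a - b⟫ = 0 := by rw [inner_sub_left, h1, h2, sub_self]
  rw [inner_self_eq_zero, sub_eq_zero] at h3
  rw [h3]
  exact hb y

end Weak

section Sequence

variable {H : Type*} [NormedAddCommGroup H] [InnerProductSpace ℝ H]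

/-- Energy estimates for the Fast RFB recursion: `y` is the distance to a zero, `v + e` the
operator value at the iterate and `e` the error made by reflecting. -/
lemma fastRFB_bounds {α c r : ℝ} (hc1 : 1 < c) (hcu : c < α - 1) (hr0 : 0 ≤ r) (hr : r < 1 / 2)
    {y v e : ℕ → H}
    (hrec : ∀ k : ℕ, 1 ≤ k → ((k : ℝ) + α) • (y (k + 1) - y k + (v (k + 1) - v k)) + c • v k
      = (k : ℝ) • (y k - y (k - 1)))
    (he : ∀ k : ℕ, 2 ≤ k → ‖e k‖ ≤ r * ‖v k - v (k - 1)‖)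
    (hmon : ∀ k : ℕ, 1 ≤ k → 0 ≤ ⟪y (k + 1) - y k, (v (k + 1) + e (k + 1)) - (v k + e k)⟫)
    (hzero : ∀ k : ℕ, 1 ≤ k → 0 ≤ ⟪y k, v k + e k⟫) :
    (∃ R, ∀ k, ‖y k‖ ≤ R) ∧ Summable (fun k : ℕ => (k : ℝ) * ‖y (k + 1) - y k‖ ^ 2) ∧
      Summable (fun k : ℕ => (k : ℝ) * ‖v k‖ ^ 2) ∧
      Summable (fun k : ℕ => (k : ℝ) ^ 2 * ‖v k - v (k - 1)‖ ^ 2) ∧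
      Summable (fun k : ℕ => ⟪y k, v k + e k⟫) := by
  have ha : 0 < c - 1 := by linarith
  have hl : 0 < α - c := by linarith
  have hbt : 0 < α - 1 - c := by linarith
  have hα2 : 0 < α - 2 := by linarith
  obtain ⟨δ, hδ0, hδ1, hδ2⟩ : ∃ δ > 0, δ ≤ 1 / 128 ∧
      δ * (α - 2) ^ 2 ≤ (c - 1) * (α - 1 - c) := by
    refine ⟨min (1 / 128) ((c - 1) * (α - 1 - c) / (α - 2) ^ 2),
      lt_min (by norm_num) (by positivity), min_le_left _ _, ?_⟩
    rw [← le_div_iff₀ (by positivity)]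
    exact min_le_right _ _
  obtain ⟨μ, hμ, C, hC, K, hstep⟩ := exists_rfbEnergy_succ_le (H := H) hc1 hcu hδ0
    (by linarith) hδ2 hr0 hr
  obtain ⟨N, hN⟩ := exists_nat_ge (max 2 (max K (2 * (α - 1))))
  obtain ⟨hN2, hN'⟩ := max_le_iff.1 hN
  obtain ⟨hNK, hNα⟩ := max_le_iff.1 hN'
  have hN2' : 2 ≤ N := by exact_mod_cast hN2
  set q := (c - 1) * (α - c) with hq
  have hq0 : 0 < q := by positivity
  let x : ℕ → ℝ := fun n => ((n + N : ℕ) : ℝ)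
  have hxN : ∀ n, (N : ℝ) ≤ x n := fun n => by simp [x]
  let E : ℕ → ℝ := fun n => rfbEnergy α c δ (x n) (y (n + N))
    (x n • (y (n + N) - y (n + N - 1))) (v (n + N)) (e (n + N)) (v (n + N) - v (n + N - 1))
  let D : ℕ → ℝ := fun n => q * ⟪y (n + N), v (n + N) + e (n + N)⟫
    + μ * (x n * (‖(y (n + N + 1) - y (n + N)) + v (n + N)‖ ^ 2 + ‖v (n + N)‖ ^ 2)
      + x n ^ 2 * ‖v (n + N) - v (n + N - 1)‖ ^ 2)
  have hx0 : ∀ n, 0 < x n := fun n => by linarith [hxN n]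
  have hz0 : ∀ n, 0 ≤ ⟪y (n + N), v (n + N) + e (n + N)⟫ := fun n => hzero _ (by omega)
  have hElow : ∀ n, q / 2 * ‖y (n + N)‖ ^ 2 ≤ E n := fun n => by
    have h1 := le_rfbEnergy (c := c) (r := r) (x := x n) (δ := δ) (α := α) (by linarith) hδ0 hδ1
      (by linarith) hr (by linarith [hxN n]) (he (n + N) (by omega)) (hz0 n)
      (m := x n • (y (n + N) - y (n + N - 1)))
    have h2 : 0 ≤ δ / 64 * x n ^ 2 * (‖v (n + N)‖ ^ 2 + ‖v (n + N) - v (n + N - 1)‖ ^ 2) := by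
      positivity
    have h3 : q / 2 * ‖y (n + N)‖ ^ 2
      = 1 / 2 * ((α - c) * (c - 1)) * ‖y (n + N)‖ ^ 2 := by rw [hq]; ring
    linarith
  have hD : ∀ n, 0 ≤ D n := fun n => by
    have := hz0 n
    have := hx0 n
    positivity
  have hdec : ∀ n, E (n + 1) ≤ (1 + 2 * C / q * (1 / x n ^ 2)) * E n - D n := fun n => by
    have h1 := hstep (x n) (by linarith [hxN n]) (y := y (n + N))
      (D := y (n + N + 1) - y (n + N)) (u := v (n + N)) (Δ := v (n + N + 1) - v (n + N))
      (e' := e (n + N + 1)) (he (n + N) (by omega)) (by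
        simpa using hmon (n + N) (by omega))
    rw [add_sub_cancel, add_sub_cancel, hrec (n + N) (by omega)] at h1
    have h2 : x (n + 1) = x n + 1 := by simp only [x]; push_cast; ring
    have h3 : E (n + 1) = rfbEnergy α c δ (x n + 1) (y (n + N + 1))
        ((x n + 1) • (y (n + N + 1) - y (n + N))) (v (n + N + 1)) (e (n + N + 1))
        (v (n + N + 1) - v (n + N)) := by
      simp only [E, h2, show n + 1 + N = n + N + 1 by ring, Nat.add_sub_cancel]
    have h4 : C * (1 / x n ^ 2) * ‖y (n + N)‖ ^ 2 ≤ 2 * C / q * (1 / x n ^ 2) * E n := by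
      calc _ = 2 * C / q * (1 / x n ^ 2) * (q / 2 * ‖y (n + N)‖ ^ 2) := by field_simp
        _ ≤ _ := by
          have := hx0 n
          have := hElow n
          gcongr
    rw [h3]
    simp only [D]
    linarith
  have hsq : Summable fun n : ℕ => 2 * C / q * (1 / x n ^ 2) :=
    ((summable_nat_add_iff N).2 (Real.summable_one_div_nat_pow.2 one_lt_two)).mul_left _
  obtain ⟨⟨R, hR⟩, hDs⟩ := bounded_and_summable_of_perturbed_decrease
    (fun n => (by positivity : 0 ≤ q / 2 * ‖y (n + N)‖ ^ 2).trans (hElow n)) hD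
    (fun n => by positivity) hsq hdec
  have hS : ∀ g : ℕ → ℝ, (∀ n, 0 ≤ g (n + N)) → ∀ B, (∀ n, g (n + N) ≤ B * D n) → Summable g :=
    fun g hg B hB => (summable_nat_add_iff N).1 (Summable.of_nonneg_of_le hg hB (hDs.mul_left B))
  have hDpart : ∀ n, 0 ≤ x n * ‖(y (n + N + 1) - y (n + N)) + v (n + N)‖ ^ 2 ∧
      0 ≤ x n * ‖v (n + N)‖ ^ 2 ∧ 0 ≤ x n ^ 2 * ‖v (n + N) - v (n + N - 1)‖ ^ 2 := fun n => by
    have := hx0 n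
    exact ⟨by positivity, by positivity, by positivity⟩
  have hDμ : ∀ n, x n * (‖(y (n + N + 1) - y (n + N)) + v (n + N)‖ ^ 2 + ‖v (n + N)‖ ^ 2)
      + x n ^ 2 * ‖v (n + N) - v (n + N - 1)‖ ^ 2 ≤ 1 / μ * D n := fun n => by
    rw [one_div, inv_mul_eq_div, le_div_iff₀ hμ]
    simp only [D]
    linarith [mul_nonneg hq0.le (hz0 n)]
  refine ⟨?_, ?_, ?_, ?_, ?_⟩
  · refine ⟨∑ k ∈ Finset.range N, ‖y k‖ + √(2 / q * R), fun k => ?_⟩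
    have hsum : 0 ≤ ∑ k ∈ Finset.range N, ‖y k‖ := Finset.sum_nonneg fun _ _ => norm_nonneg _
    rcases lt_or_ge k N with hk | hk
    · have := Finset.single_le_sum (f := fun k => ‖y k‖) (fun _ _ => norm_nonneg _)
        (Finset.mem_range.2 hk)
      linarith [Real.sqrt_nonneg (2 / q * R)]
    · have h1 := (hElow (k - N)).trans (hR _)
      rw [Nat.sub_add_cancel hk] at h1
      have h2 : ‖y k‖ ≤ √(2 / q * R) := by
        refine Real.le_sqrt_of_sq_le ?_
        rw [div_mul_eq_mul_div, le_div_iff₀ hq0]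
        linarith
      linarith
  · refine hS _ (fun n => by positivity) (2 * (1 / μ)) fun n => ?_
    have h1 : ‖y (n + N + 1) - y (n + N)‖ ≤
        ‖(y (n + N + 1) - y (n + N)) + v (n + N)‖ + ‖v (n + N)‖ := by
      simpa using norm_sub_le ((y (n + N + 1) - y (n + N)) + v (n + N)) (v (n + N))
    have h2 : ‖y (n + N + 1) - y (n + N)‖ ^ 2 ≤
        2 * (‖(y (n + N + 1) - y (n + N)) + v (n + N)‖ ^ 2 + ‖v (n + N)‖ ^ 2) := by
      refine (pow_le_pow_left₀ (norm_nonneg _) h1 2).trans ?_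
      linarith [sq_nonneg (‖(y (n + N + 1) - y (n + N)) + v (n + N)‖ - ‖v (n + N)‖)]
    have h3 := mul_le_mul_of_nonneg_left h2 (hx0 n).le
    have := hDμ n
    have := (hDpart n).2.2
    change x n * _ ≤ _
    linarith
  · refine hS _ (fun n => by positivity) (1 / μ) fun n => ?_
    have := hDμ n
    have := hDpart n
    change x n * _ ≤ _
    linarith
  · refine hS _ (fun n => by positivity) (1 / μ) fun n => ?_
    have := hDμ n
    have := hDpart n
    change x n ^ 2 * _ ≤ _
    linarith
  · refine hS _ hz0 (1 / q) fun n => ?_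
    rw [one_div, inv_mul_eq_div, le_div_iff₀ hq0]
    have : 0 ≤ μ * (x n * (‖(y (n + N + 1) - y (n + N)) + v (n + N)‖ ^ 2 + ‖v (n + N)‖ ^ 2)
      + x n ^ 2 * ‖v (n + N) - v (n + N - 1)‖ ^ 2) := by
      have := hx0 n
      positivity
    simp only [D]
    linarith

lemma fastRFB_exists_tendsto_norm {α c r : ℝ} (hc1 : 1 < c) (hcu : c < α - 1)
    (hr0 : 0 ≤ r) (hr : r < 1 / 2) {y v e : ℕ → H}
    (hrec : ∀ k : ℕ, 1 ≤ k → ((k : ℝ) + α) • (y (k + 1) - y k + (v (k + 1) - v k)) + c • v k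
      = (k : ℝ) • (y k - y (k - 1)))
    (he : ∀ k : ℕ, 2 ≤ k → ‖e k‖ ≤ r * ‖v k - v (k - 1)‖)
    (hmon : ∀ k : ℕ, 1 ≤ k → 0 ≤ ⟪y (k + 1) - y k, (v (k + 1) + e (k + 1)) - (v k + e k)⟫)
    (hzero : ∀ k : ℕ, 1 ≤ k → 0 ≤ ⟪y k, v k + e k⟫) :
    (∃ l, Tendsto (fun k => ‖y k‖) atTop (nhds l)) ∧ Tendsto v atTop (nhds 0) := by
  obtain ⟨⟨R, hR⟩, hy, hv, hΔ, hyV⟩ := fastRFB_bounds hc1 hcu hr0 hr hrec he hmon hzero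
  have hR0 : 0 ≤ R := (norm_nonneg _).trans (hR 0)
  have hv0 : Tendsto v atTop (nhds 0) := by
    rw [tendsto_zero_iff_norm_tendsto_zero]
    have h1 : Tendsto (fun k => ‖v k‖ ^ 2) atTop (nhds 0) := by
      refine squeeze_zero' (Eventually.of_forall fun _ => by positivity) ?_
        hv.tendsto_atTop_zero
      filter_upwards [eventually_ge_atTop 1] with k hk
      have : (1 : ℝ) ≤ k := by exact_mod_cast hk
      exact le_mul_of_one_le_left (by positivity) this
    simpa [Real.sqrt_sq] using h1.sqrt
  refine ⟨?_, hv0⟩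
  have hyv : Summable fun k => |⟪y k, v k⟫| := by
    refine (summable_nat_add_iff 2).1 ?_
    refine Summable.of_nonneg_of_le (fun _ => abs_nonneg _) (fun n => ?_)
      ((summable_nat_add_iff 2).2 (hyV.abs.add ((hΔ.add
        (Real.summable_one_div_nat_pow.2 one_lt_two)).mul_left R)))
    set k := n + 2 with hk
    have hk0 : (0 : ℝ) < k := by positivity
    have h1 : ⟪y k, v k⟫ = ⟪y k, v k + e k⟫ - ⟪y k, e k⟫ := by rw [inner_add_right]; ring
    have h2 : |⟪y k, e k⟫| ≤ R * ‖v k - v (k - 1)‖ := by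
      refine (abs_real_inner_le_norm _ _).trans ?_
      have h3 : ‖e k‖ ≤ ‖v k - v (k - 1)‖ :=
        (he k (by omega)).trans (mul_le_of_le_one_left (norm_nonneg _) (by linarith))
      gcongr
      exact hR k
    have h3 : ‖v k - v (k - 1)‖ ≤ (k : ℝ) ^ 2 * ‖v k - v (k - 1)‖ ^ 2 + 1 / (k : ℝ) ^ 2 := by
      set B := ‖v k - v (k - 1)‖
      have hB : 0 ≤ B := norm_nonneg _
      have h4 : B = (k * B) * (1 / k) := by field_simp
      have h5 : (k : ℝ) ^ 2 * B ^ 2 + 1 / (k : ℝ) ^ 2 = (k * B) ^ 2 + (1 / k) ^ 2 := by ring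
      rw [h5]
      nlinarith [sq_nonneg (k * B - 1 / k), sq_nonneg ((k : ℝ) * B), sq_nonneg (1 / (k : ℝ))]
    rw [h1]
    refine (abs_sub _ _).trans ?_
    gcongr
    exact h2.trans (by gcongr)
  let W : ℕ → ℝ := fun n => ((n : ℝ) + 1) * ⟪y (n + 1), y (n + 1) - y n⟫
    + (n + α) * ⟪y (n + 1), v (n + 1)⟫ + (α - 1) / 2 * ‖y (n + 1)‖ ^ 2
  have hWid : ∀ n : ℕ, W (n + 1) - W n = ((n : ℝ) + 1 + α) * ⟪y (n + 2) - y (n + 1), v (n + 2)⟫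
      + ((n : ℝ) + 2 + (α - 1) / 2) * ‖y (n + 2) - y (n + 1)‖ ^ 2
      - (c - 1) * ⟪y (n + 1), v (n + 1)⟫ := by
    intro n
    have h1 := congrArg (fun w => ⟪y (n + 1), w⟫) (hrec (n + 1) (by omega))
    simp only [Nat.add_sub_cancel, inner_add_right, inner_sub_right, real_inner_smul_right] at h1
    simp only [W, ← real_inner_self_eq_norm_sq, inner_sub_left, inner_sub_right]
    rw [real_inner_comm (y (n + 1)) (y (n + 2))]
    push_cast at h1 ⊢
    linear_combination h1
  obtain ⟨w, hw⟩ : ∃ w, Tendsto W atTop (nhds w) := by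
    have hs : Summable fun n => W (n + 1) - W n := by
      have hα0 : 0 < α := by linarith
      refine Summable.of_norm_bounded (g := fun n : ℕ =>
        (3 + 2 * α) * (((n + 1 : ℕ) : ℝ) * ‖y (n + 1 + 1) - y (n + 1)‖ ^ 2)
        + (3 + 2 * α) * (((n + 2 : ℕ) : ℝ) * ‖v (n + 2)‖ ^ 2)
        + (c - 1) * |⟪y (n + 1), v (n + 1)⟫|) ?_ fun n => ?_
      · exact ((((summable_nat_add_iff 1).2 hy).mul_left _).add
          (((summable_nat_add_iff 2).2 hv).mul_left _)).add
          (((summable_nat_add_iff 1).2 hyv).mul_left _)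
      · rw [hWid, Real.norm_eq_abs]
        have h1 := abs_le.1 (abs_real_inner_le_norm (y (n + 2) - y (n + 1)) (v (n + 2)))
        have h2 := abs_le.1 (le_refl |⟪y (n + 1), v (n + 1)⟫|)
        have hn : (0 : ℝ) ≤ n := n.cast_nonneg
        set d := ‖y (n + 2) - y (n + 1)‖ with hd
        set u := ‖v (n + 2)‖
        have h3 : |((n : ℝ) + 1 + α) * ⟪y (n + 2) - y (n + 1), v (n + 2)⟫|
            ≤ (n + 1 + α) * (1 / 2 * d ^ 2 + 1 / 2 * u ^ 2) := by
          rw [abs_mul, abs_of_nonneg (by positivity)]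
          gcongr
          rw [abs_le]
          constructor <;> linarith [sq_nonneg (d - u)]
        have h4 : |(c - 1) * ⟪y (n + 1), v (n + 1)⟫| = (c - 1) * |⟪y (n + 1), v (n + 1)⟫| := by
          rw [abs_mul, abs_of_pos (by linarith)]
        have h5 : 0 ≤ ((n : ℝ) + 2 + (α - 1) / 2) * d ^ 2 := by
          have : 0 < α - 1 := by linarith
          positivity
        have h6 : ((n : ℝ) + 1 + α) * (1 / 2 * d ^ 2) + ((n : ℝ) + 2 + (α - 1) / 2) * d ^ 2
            ≤ (3 + 2 * α) * ((n + 1) * d ^ 2) := by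
          have : 0 ≤ n * α := by positivity
          have : ((n : ℝ) + 1 + α) * (1 / 2) + ((n : ℝ) + 2 + (α - 1) / 2)
            ≤ (3 + 2 * α) * (n + 1) := by linarith
          linarith [mul_le_mul_of_nonneg_right this (sq_nonneg d)]
        have h7 : ((n : ℝ) + 1 + α) * (1 / 2 * u ^ 2) ≤ (3 + 2 * α) * ((n + 2) * u ^ 2) := by
          have : 0 ≤ n * α := by positivity
          have : ((n : ℝ) + 1 + α) * (1 / 2) ≤ (3 + 2 * α) * (n + 2) := by linarith
          linarith [mul_le_mul_of_nonneg_right this (sq_nonneg u)]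
        refine (abs_sub _ _).trans ?_
        refine (add_le_add_left (abs_add_le _ _) _).trans ?_
        rw [h4, abs_of_nonneg h5]
        push_cast
        linarith
    refine ⟨_, (hs.hasSum.tendsto_sum_nat.add_const (W 0)).congr fun n => ?_⟩
    rw [Finset.sum_range_sub]
    ring
  have hS := hyv.of_abs.hasSum.tendsto_sum_nat
  set T := ∑' k, ⟪y k, v k⟫
  let S : ℕ → ℝ := fun n => ∑ k ∈ Finset.range (n + 1), ⟪y k, v k⟫
  have hS1 : Tendsto S atTop (nhds T) := (tendsto_add_atTop_iff_nat 1).2 hS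
  have hd0 : Tendsto (fun n : ℕ => ((n : ℝ) + 1) / 2 * ‖y (n + 1) - y n‖ ^ 2) atTop (nhds 0) := by
    refine squeeze_zero' (Eventually.of_forall fun _ => by positivity) ?_ hy.tendsto_atTop_zero
    filter_upwards [eventually_ge_atTop 1] with n hn
    have : (1 : ℝ) ≤ n := by exact_mod_cast hn
    gcongr
    linarith
  have hyv0 : Tendsto (fun n => ⟪y (n + 1), v (n + 1)⟫) atTop (nhds 0) :=
    (tendsto_add_atTop_iff_nat 1).2 hyv.of_abs.tendsto_atTop_zero
  have hψ := exists_tendsto_of_nat_mul_sub_add_mul (b := α - 1) (by linarith)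
    (ψ := fun n => 1 / 2 * ‖y n‖ ^ 2 + S n)
    (((hw.sub hd0).sub (hyv0.const_mul (α - 1))).add
      (((tendsto_add_atTop_iff_nat 1).2 hS1).const_mul (α - 1)) |>.congr fun n => by
        have h1 : S (n + 1) = S n + ⟪y (n + 1), v (n + 1)⟫ := Finset.sum_range_succ _ _
        have h2 := norm_sub_sq_real (y (n + 1)) (y n)
        simp only [W]
        rw [h1, h2, inner_sub_right, real_inner_self_eq_norm_sq]
        ring)
  have hfin := ((hψ.sub hS1).const_mul 2).sqrt
  refine ⟨_, hfin.congr fun n => ?_⟩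
  rw [add_sub_cancel_right, ← mul_assoc, mul_one_div_cancel two_ne_zero, one_mul,
    Real.sqrt_sq (norm_nonneg _)]

end Sequence

theorem stmt_9
    {H : Type*} [NormedAddCommGroup H] [InnerProductSpace ℝ H] [CompleteSpace H]
    (M : H → Set H) (F : H → H) (L α c γ : ℝ)
    (hM : ∀ z y u' v', u' ∈ M z → v' ∈ M y → 0 ≤ ⟪v' - u', y - z⟫)
    (hFmono : ∀ z y, 0 ≤ ⟪F y - F z, y - z⟫)
    (hL : 0 < L)
    (hFlip : ∀ z y, ‖F y - F z‖ ≤ L * ‖y - z‖)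
    (hα : 2 < α) (hcl : α / 2 < c) (hcu : c < α - 1)
    (hγ0 : 0 < γ) (hγ : γ < 1 / (2 * L))
    (z w ξ v : ℕ → H)
    (hξ : ∀ k : ℕ, 1 ≤ k → ξ k ∈ M (z k))
    (hv : ∀ k : ℕ, 1 ≤ k → v k = ξ k + F (w (k - 1)))
    (hw : ∀ k : ℕ, 1 ≤ k →
      w k = z k + ((k : ℝ) / ((k : ℝ) + α)) • (z k - z (k - 1)) - ((c / ((k : ℝ) + α)) * γ) • v k)
    (hz : ∀ k : ℕ, 1 ≤ k → z (k + 1) = w k - γ • (v (k + 1) - v k))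
    (hMmax : ∀ z₀ u₀ : H, (∀ y₀ v₀ : H, v₀ ∈ M y₀ → 0 ≤ ⟪u₀ - v₀, z₀ - y₀⟫) → u₀ ∈ M z₀)
    (hne : ∃ zs : H, -F zs ∈ M zs) :
    ∃ zbar : H, -F zbar ∈ M zbar ∧
      ∀ y : H, Tendsto (fun k : ℕ => ⟪z k, y⟫) atTop (nhds ⟪zbar, y⟫) := by
  obtain ⟨hγL0, hγL⟩ : 0 ≤ γ * L ∧ γ * L < 1 / 2 := by
    refine ⟨by positivity, ?_⟩
    rw [lt_div_iff₀ (by positivity)] at hγ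
    linarith
  have hrec : ∀ k : ℕ, 1 ≤ k → ((k : ℝ) + α) • (z (k + 1) - z k + (γ • v (k + 1) - γ • v k))
      + c • (γ • v k) = (k : ℝ) • (z k - z (k - 1)) := fun k hk => by
    have hkα : (k : ℝ) + α ≠ 0 := by positivity
    rw [hz k hk, hw k hk]
    match_scalars <;> field_simp <;> ring
  have hV : ∀ k : ℕ, 1 ≤ k →
      γ • v k + γ • (F (z k) - F (w (k - 1))) = γ • (ξ k + F (z k)) := fun k hk => by
    rw [hv k hk]
    module
  have herr : ∀ k : ℕ, 2 ≤ k → ‖γ • (F (z k) - F (w (k - 1)))‖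
      ≤ γ * L * ‖γ • v k - γ • v (k - 1)‖ := fun k hk => by
    obtain ⟨j, rfl⟩ : ∃ j, k = j + 1 := ⟨k - 1, by omega⟩
    have h1 : z (j + 1) - w j = -(γ • v (j + 1) - γ • v j) := by
      rw [hz j (by omega)]
      module
    rw [Nat.add_sub_cancel, norm_smul, Real.norm_of_nonneg hγ0.le, mul_assoc,
      ← norm_neg (γ • v (j + 1) - γ • v j), ← h1]
    gcongr
    exact hFlip _ _
  have hmono : ∀ a b u t, u ∈ M a → t ∈ M b → 0 ≤ ⟪b - a, γ • (t + F b) - γ • (u + F a)⟫ :=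
    fun a b u t hu ht => by
      rw [← smul_sub, real_inner_smul_right, real_inner_comm, add_sub_add_comm, inner_add_left]
      have := hM a b u t hu ht
      have := hFmono a b
      positivity
  have hconv : ∀ zs, -F zs ∈ M zs → (∃ l, Tendsto (fun k => ‖z k - zs‖) atTop (nhds l)) ∧
      Tendsto (fun k => γ • v k) atTop (nhds 0) := fun zs hzs => by
    refine fastRFB_exists_tendsto_norm (α := α) (c := c) (r := γ * L) (by linarith) hcu hγL0 hγL
      (e := fun k => γ • (F (z k) - F (w (k - 1)))) (fun k hk => ?_) herr (fun k hk => ?_)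
      fun k hk => ?_
    · rw [sub_sub_sub_cancel_right, sub_sub_sub_cancel_right]
      exact hrec k hk
    · rw [sub_sub_sub_cancel_right, hV k hk, hV (k + 1) (by omega)]
      exact hmono _ _ _ _ (hξ k hk) (hξ (k + 1) (by omega))
    · rw [hV k hk]
      simpa using hmono _ _ _ _ hzs (hξ k hk)
  obtain ⟨zs, hzs⟩ := hne
  obtain ⟨⟨l, hl⟩, hγv⟩ := hconv zs hzs
  obtain ⟨R, hR⟩ : ∃ R, ∀ k, ‖z k‖ ≤ R := by
    obtain ⟨B, hB⟩ := hl.bddAbove_range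
    refine ⟨B + ‖zs‖, fun k => ?_⟩
    have h1 : ‖z k - zs‖ ≤ B := hB ⟨k, rfl⟩
    linarith [norm_le_norm_sub_add (z k) zs]
  have hp : Tendsto (fun k => ξ k + F (z k)) atTop (nhds 0) := by
    have hΔ : Tendsto (fun k => γ * L * ‖γ • v k - γ • v (k - 1)‖) atTop (nhds 0) := by
      simpa using ((hγv.sub (hγv.comp (tendsto_sub_atTop_nat 1))).norm.const_mul (γ * L))
    have herr0 : Tendsto (fun k => γ • (F (z k) - F (w (k - 1)))) atTop (nhds 0) :=
      squeeze_zero_norm' ((eventually_ge_atTop 2).mono herr) hΔ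
    have h1 := (hγv.add herr0).const_smul γ⁻¹
    rw [add_zero, smul_zero] at h1
    refine h1.congr' ((eventually_ge_atTop 1).mono fun k hk => ?_)
    rw [hV k hk, inv_smul_smul₀ hγ0.ne']
  exact exists_weak_limit_of_opial (S := {a | -F a ∈ M a}) hR (fun a ha => (hconv a ha).1)
    fun U hU a ha => neg_mem_of_weak_limit hM hMmax hFmono hL hFlip hU hR
      ((eventually_ge_atTop 1).mono hξ) hp ha
end

section
/- Suppose Zer(M+F) is nonempty and let z* ∈ Zer(M+F). Then the following convergence rates of order o(1/k) hold as k → +∞: k·‖z_k − z_{k−1}‖ → 0, k·‖ξ_k + F(z_k)‖ → 0, k·⟨ξ_k + F(z_k), z_k − z*⟩ → 0, and k·dist(0, {u + F(z_k) : u ∈ M(z_k)}) → 0, where dist denotes the distance from the point 0 ∈ H to the given subset of H. -/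
open scoped RealInnerProductSpace Pointwise
open Filter

namespace FastRFB

variable {H : Type*} [NormedAddCommGroup H] [InnerProductSpace ℝ H]

lemma exists_pos_le_quadratic_form {A B C : ℝ} (hA : 0 < A) (hC : 0 < C)
    (hB : B ^ 2 < 4 * A * C) :
    ∃ κ > 0, ∀ p q : H, κ * (‖p‖ ^ 2 + ‖q‖ ^ 2) ≤ A * ‖p‖ ^ 2 + B * ⟪p, q⟫ + C * ‖q‖ ^ 2 := by
  obtain ⟨κ, hκ⟩ : ∃ κ, κ = (4 * A * C - B ^ 2) / (4 * (A + C)) := ⟨_, rfl⟩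
  have hκ0 : 0 < κ := hκ ▸ div_pos (by linarith) (by linarith)
  have hκe : κ * (A + C) = A * C - B ^ 2 / 4 := by
    rw [hκ]; field_simp
  have hκA : κ < A := by nlinarith [sq_nonneg B]
  refine ⟨κ, hκ0, fun p q => ?_⟩
  have hpq := real_inner_mul_inner_self_le p q
  rw [real_inner_self_eq_norm_sq, real_inner_self_eq_norm_sq] at hpq
  have hn : 0 ≤ ‖(A - κ) • p + (B / 2) • q‖ ^ 2 := sq_nonneg _
  rw [norm_add_sq_real, norm_smul, norm_smul, real_inner_smul_left, real_inner_smul_right,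
    mul_pow, mul_pow, Real.norm_eq_abs, Real.norm_eq_abs, sq_abs, sq_abs] at hn
  have hq : 0 ≤ ‖q‖ ^ 2 := sq_nonneg _
  have : 0 ≤ (A - κ) * ((A - κ) * ‖p‖ ^ 2 + B * ⟪p, q⟫ + (C - κ) * ‖q‖ ^ 2) := by
    nlinarith [mul_nonneg (sq_nonneg κ) hq]
  have := nonneg_of_mul_nonneg_right this (by linarith)
  linarith

/-- If `E` decreases by `d` up to a relative error of order `1 / k ^ 2`, then `E` converges and
`d` is summable. -/
lemma exists_tendsto_and_summable_of_le {E d : ℕ → ℝ} {C : ℝ} (hC : 0 ≤ C)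
    (hE : ∀ᶠ k in atTop, 0 ≤ E k) (hd : ∀ᶠ k in atTop, 0 ≤ d k)
    (hstep : ∀ᶠ k : ℕ in atTop, E (k + 1) ≤ E k - d k + C / (k : ℝ) ^ 2 * E (k + 1)) :
    (∃ l, Tendsto E atTop (nhds l)) ∧ Summable d := by
  obtain ⟨K, hK⟩ := eventually_atTop.1 ((hE.and hd).and
    (hstep.and (eventually_ge_atTop (⌈4 * C⌉₊ + 1))))
  set p : ℕ → ℝ := fun k => 1 + 4 * C / k with hp
  have hp1 : ∀ k, 1 ≤ p k := fun k => by
    have : 0 ≤ 4 * C / (k : ℝ) := by positivity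
    simp only [hp]; linarith
  have hplim : Tendsto p atTop (nhds 1) := by
    simpa using (tendsto_const_div_atTop_nhds_zero_nat (4 * C)).const_add 1
  have hpE : ∀ k ≥ K, p (k + 1) * E (k + 1) ≤ p k * E k - d k := by
    intro k hk
    obtain ⟨⟨-, hdk⟩, hs, hkC⟩ := hK k hk
    have hE1 := (hK (k + 1) (by omega)).1.1
    have hk1 : (1 : ℝ) ≤ k := by exact_mod_cast (by omega : 1 ≤ k)
    have hk4 : 4 * C ≤ k := (Nat.le_ceil _).trans (by exact_mod_cast (by omega : ⌈4 * C⌉₊ ≤ k))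
    have hpk : p (k + 1) ≤ p k * (1 - C / (k : ℝ) ^ 2) := by
      have h0 : (0 : ℝ) < k := by linarith
      have : p k * (1 - C / (k : ℝ) ^ 2) - p (k + 1) =
          C * (3 * k ^ 2 - k - 4 * C * k - 4 * C) / (k ^ 3 * (k + 1)) := by
        simp only [hp]; push_cast; field_simp; ring
      have h2 : 0 ≤ C * (3 * (k : ℝ) ^ 2 - k - 4 * C * k - 4 * C) / (k ^ 3 * (k + 1)) := by
        refine div_nonneg (mul_nonneg hC ?_) (by positivity)
        nlinarith
      linarith
    have h3 : p (k + 1) * E (k + 1) ≤ p k * (1 - C / (k : ℝ) ^ 2) * E (k + 1) :=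
      mul_le_mul_of_nonneg_right hpk hE1
    have h4 : p k * ((1 - C / (k : ℝ) ^ 2) * E (k + 1)) ≤ p k * (E k - d k) :=
      mul_le_mul_of_nonneg_left (by linarith) (by linarith [hp1 k])
    nlinarith [hp1 k]
  have hG0 : ∀ k, 0 ≤ p (k + K) * E (k + K) := fun k =>
    mul_nonneg (by linarith [hp1 (k + K)]) (hK (k + K) (by omega)).1.1
  have hanti : Antitone fun k => p (k + K) * E (k + K) := by
    refine antitone_nat_of_succ_le fun k => ?_
    have := hpE (k + K) (by omega)
    have h2 := (hK (k + K) (by omega)).1.2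
    rw [show k + 1 + K = k + K + 1 by omega]
    linarith
  constructor
  · have h1 := tendsto_atTop_ciInf hanti ⟨0, by rintro _ ⟨k, rfl⟩; exact hG0 k⟩
    have h2 := (tendsto_add_atTop_iff_nat (f := fun k => p k * E k) K).1 h1
    refine ⟨_, (h2.div hplim one_ne_zero).congr fun k => ?_⟩
    have : p k ≠ 0 := by linarith [hp1 k]
    simp only [Pi.div_apply]
    field_simp
  · refine (summable_nat_add_iff K).1 (summable_of_sum_range_le (c := p K * E K)
      (fun k => (hK (k + K) (by omega)).1.2) fun n => ?_)
    have : ∀ n, ∑ i ∈ Finset.range n, d (i + K) ≤ p K * E K - p (n + K) * E (n + K) := by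
      intro n
      induction n with
      | zero => simp
      | succ n ih =>
        rw [Finset.sum_range_succ, show n + 1 + K = n + K + 1 by omega]
        linarith [hpE (n + K) (by omega)]
    linarith [this n, hG0 n]

lemma exists_absorption {κ₁ κ₂ C₀ : ℝ} (h₁ : 0 < κ₁) (h₂ : 0 < κ₂) (h₀ : 0 < C₀) :
    ∃ K ≥ 1, ∃ C ≥ 0, ∀ k ≥ K, ∀ a b ρ W Y : ℝ,
      C₀ * ((a + b + ρ) ^ 2 + k * ((a + b + ρ) * (ρ + W)) + Y * ρ) ≤
        κ₁ / 2 * k * (a ^ 2 + b ^ 2) + κ₂ / 2 * k ^ 2 * (ρ ^ 2 + W ^ 2) + C / k ^ 2 * Y ^ 2 := by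
  obtain ⟨ε, hε⟩ : ∃ ε, ε = κ₂ / (20 * C₀) := ⟨_, rfl⟩
  have hε0 : 0 < ε := hε ▸ by positivity
  have hεC : C₀ * ε = κ₂ / 20 := by rw [hε]; field_simp
  refine ⟨max 1 (max (C₀ * (3 + 1 / ε) / (κ₁ / 2)) (C₀ * 6 / (κ₂ / 4))), le_max_left _ _,
    C₀ / ε, by positivity, fun k hk a b ρ W Y => ?_⟩
  have hk1 : 1 ≤ k := (le_max_left _ _).trans hk
  have hkA : C₀ * (3 + 1 / ε) ≤ k * (κ₁ / 2) :=
    (div_le_iff₀ (by positivity)).1 (((le_max_left _ _).trans (le_max_right _ _)).trans hk)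
  have hkB : C₀ * 6 ≤ k * (κ₂ / 4) :=
    (div_le_iff₀ (by positivity)).1 (((le_max_right _ _).trans (le_max_right _ _)).trans hk)
  have hk0 : 0 < k := by linarith
  have e1 : (a + b + ρ) ^ 2 ≤ 3 * (a ^ 2 + b ^ 2) + 3 * k * (ρ ^ 2 + W ^ 2) := by
    nlinarith [sq_nonneg (a - b), sq_nonneg (a - ρ), sq_nonneg (b - ρ), sq_nonneg W,
      mul_nonneg (sub_nonneg.2 hk1) (add_nonneg (sq_nonneg ρ) (sq_nonneg W))]
  have young : ∀ s t : ℝ, s * t ≤ 1 / ε * s ^ 2 / 4 + ε * t ^ 2 := fun s t => by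
    have : 1 / ε * s ^ 2 / 4 + ε * t ^ 2 - s * t = (s / 2 - ε * t) ^ 2 / ε := by
      field_simp; ring
    have h2 : 0 ≤ (s / 2 - ε * t) ^ 2 / ε := by positivity
    linarith
  have hε1 : 0 < 1 / ε := by positivity
  have e2 : k * ((a + b) * (ρ + W)) ≤
      1 / ε * (a ^ 2 + b ^ 2) + 2 * ε * k ^ 2 * (ρ ^ 2 + W ^ 2) := by
    have h := young (a + b) (k * (ρ + W))
    have h3 : 1 / ε * (a + b) ^ 2 / 4 ≤ 1 / ε * (a ^ 2 + b ^ 2) := by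
      rw [mul_div_assoc]
      exact mul_le_mul_of_nonneg_left (by nlinarith [sq_nonneg (a - b)]) hε1.le
    have h4 : ε * (k * (ρ + W)) ^ 2 ≤ 2 * ε * k ^ 2 * (ρ ^ 2 + W ^ 2) := by
      have : 0 ≤ ε * k ^ 2 * (ρ - W) ^ 2 := by positivity
      nlinarith
    linarith
  have e3 : k * (ρ * (ρ + W)) ≤ 2 * k * (ρ ^ 2 + W ^ 2) := by
    nlinarith [mul_nonneg hk0.le (sq_nonneg (ρ - W)), mul_nonneg hk0.le (sq_nonneg ρ),
      mul_nonneg hk0.le (sq_nonneg W)]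
  have e4 : Y * ρ ≤ 1 / ε / k ^ 2 * Y ^ 2 + ε * k ^ 2 * (ρ ^ 2 + W ^ 2) := by
    have h := young (Y / k) (k * ρ)
    have h3 : Y / k * (k * ρ) = Y * ρ := by field_simp
    have h4 : 1 / ε * (Y / k) ^ 2 = 1 / ε / k ^ 2 * Y ^ 2 := by field_simp
    have h5 : 0 ≤ 1 / ε / k ^ 2 * Y ^ 2 := by positivity
    have h6 : 0 ≤ ε * k ^ 2 * W ^ 2 := by positivity
    nlinarith
  have hB : 0 ≤ ρ ^ 2 + W ^ 2 := by positivity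
  have hA : 0 ≤ a ^ 2 + b ^ 2 := by positivity
  have f1 := mul_le_mul_of_nonneg_right hkA hA
  have f2 := mul_le_mul_of_nonneg_right (mul_le_mul_of_nonneg_right hkB hk0.le) hB
  have f3 := mul_le_mul_of_nonneg_left (add_le_add (add_le_add e1 e2) (add_le_add e3 e4)) h₀.le
  have f4 : C₀ / ε / k ^ 2 * Y ^ 2 = C₀ * (1 / ε / k ^ 2 * Y ^ 2) := by ring
  have f5 : C₀ * (ε * k ^ 2 * (ρ ^ 2 + W ^ 2)) = κ₂ / 20 * (k ^ 2 * (ρ ^ 2 + W ^ 2)) := by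
    rw [← hεC]; ring
  have f6 : 0 ≤ κ₂ * (k ^ 2 * (ρ ^ 2 + W ^ 2)) := by positivity
  rw [f4]
  nlinarith

/-- The part of the energy that is multiplied by the free parameter. -/
noncomputable def anchorTerm (α k : ℝ) (x D V : H) : ℝ :=
  (α - 1) / 2 * ‖x‖ ^ 2 + k * ⟪x, D + V⟫

/-- The part of the energy that does not depend on the free parameter. -/
noncomputable def kineticTerm (k : ℝ) (D V e : H) (W : ℝ) : ℝ :=
  k ^ 2 * (‖D‖ ^ 2 / 2 + ⟪D, V⟫ / 2 + ‖V‖ ^ 2 / 4 + ⟪D, e⟫ / 2 + W ^ 2 / 8)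

lemma le_energy {α lam k θ W : ℝ} {x D V e : H} (hlam : 0 ≤ lam)
    (hk : 0 ≤ k) (hθ : θ ≤ 1 / 2) (hW : 0 ≤ W) (he : ‖e‖ ≤ θ * W) (hx : ⟪x, e⟫ ≤ ⟪x, V⟫) :
    lam * (α - 1 - lam) / 2 * ‖x‖ ^ 2 ≤
      lam * anchorTerm α k x D V + kineticTerm k D V e W := by
  have he' : ‖e‖ ≤ W / 2 := he.trans (by nlinarith)
  have hVe : -(‖V‖ * (W / 2)) ≤ -⟪V, e⟫ :=
    neg_le_neg ((real_inner_le_norm V e).trans (mul_le_mul_of_nonneg_left he' (norm_nonneg _)))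
  have hx' := mul_le_mul_of_nonneg_left hx (mul_nonneg hlam hk)
  have hy : 0 ≤ ‖lam • x + k • D + (k / 2) • V + (k / 2) • e‖ ^ 2 := sq_nonneg _
  have hee : ‖e‖ ^ 2 ≤ (W / 2) ^ 2 := by gcongr
  have hkk : 0 ≤ k ^ 2 := sq_nonneg k
  have h1 := mul_le_mul_of_nonneg_left hee hkk
  have h2 := mul_le_mul_of_nonneg_left hVe hkk
  have h3 := mul_nonneg hkk (sq_nonneg (‖V‖ - W / 2))
  have h4 := mul_nonneg hkk (sq_nonneg W)
  simp only [← real_inner_self_eq_norm_sq, anchorTerm, kineticTerm, inner_add_left,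
    inner_add_right, real_inner_smul_left, real_inner_smul_right] at *
  rw [real_inner_comm x D, real_inner_comm x V, real_inner_comm x e, real_inner_comm D V,
    real_inner_comm D e, real_inner_comm V e] at *
  simp only [real_inner_self_eq_norm_sq] at *
  nlinarith

lemma energy_add_one_eq {α c lam k W : ℝ} {y D V p q e f g : H}
    (hg : g = -(α • p) - c • q - (α - c) • (q - V))
    (hrec : (k + α) • (p + q) = k • D + (k + α - c) • V) :
    lam * anchorTerm α (k + 1) y p q + kineticTerm (k + 1) p q f ‖q - V‖ =
      lam * anchorTerm α k (y - p) D V + kineticTerm k D V e W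
      - k * ((α - 1 - lam) * ‖p‖ ^ 2 + (c - 1 + α / 2 - lam) * ⟪p, q⟫ + (c - 1) / 2 * ‖q‖ ^ 2)
      + k ^ 2 * (-⟪p, q - V⟫ / 2 + ⟪p, f - e⟫ / 2 - ⟪q - V, e⟫ / 2 - ‖q - V‖ ^ 2 / 8 - W ^ 2 / 8)
      + (-(lam * ⟪p, g⟫) - lam * (c - 1) * ⟪y, q⟫ - lam * (α - c) * ⟪y, q - V⟫
        - lam * (α - 1) / 2 * ‖p‖ ^ 2
        + (‖p‖ ^ 2 / 2 + ⟪p, q⟫ / 2 + ‖q‖ ^ 2 / 4)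
        - k * (α - c) * (⟪p, q - V⟫ + ⟪q, q - V⟫ / 2) + k * ⟪q - V, g⟫ / 2 - ‖g‖ ^ 2 / 2
        + (k + 1 / 2) * ⟪p, f⟫ + (2 * k + 1) / 8 * ‖q - V‖ ^ 2 + k * ⟪g, e⟫ / 2) := by
  obtain ⟨r, rfl⟩ : ∃ r, V = q - r := ⟨q - V, by abel⟩
  have hD : k • D = k • (p + r) - g := by
    rw [hg, ← sub_eq_iff_eq_add.2 hrec]
    module
  have h1 : k * ⟪y, D⟫ = k * ⟪y, p⟫ + k * ⟪y, r⟫ - ⟪y, g⟫ := by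
    rw [← real_inner_smul_right, hD]
    simp only [inner_add_right, inner_sub_right, real_inner_smul_right]; ring
  have h2 : k * ⟪p, D⟫ = k * ⟪p, p⟫ + k * ⟪p, r⟫ - ⟪p, g⟫ := by
    rw [← real_inner_smul_right, hD]
    simp only [inner_add_right, inner_sub_right, real_inner_smul_right]; ring
  have h3 : k ^ 2 * ‖D‖ ^ 2 = ‖k • (p + r) - g‖ ^ 2 := by
    rw [← hD, norm_smul, mul_pow, Real.norm_eq_abs, sq_abs]
  have h4 : ∀ u, k * ⟪D, u⟫ = k * ⟪p, u⟫ + k * ⟪r, u⟫ - ⟪g, u⟫ := fun u => by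
    rw [← real_inner_smul_left, hD]
    simp only [inner_add_left, inner_sub_left, real_inner_smul_left]; ring
  have h5 : ⟪y, g⟫ = -(α * ⟪y, p⟫) - c * ⟪y, q⟫ - (α - c) * ⟪y, r⟫ := by
    rw [hg, sub_sub_cancel]
    simp only [inner_neg_right, inner_sub_right, real_inner_smul_right]
  have h6 : ∀ u, ⟪g, u⟫ = -(α * ⟪p, u⟫) - c * ⟪q, u⟫ - (α - c) * ⟪r, u⟫ := fun u => by
    rw [hg, sub_sub_cancel]
    simp only [inner_neg_left, inner_sub_left, real_inner_smul_left]
  have h7 := h4 q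
  have h8 := h4 r
  have h9 := h4 e
  have h10 := h6 p
  have h11 := h6 q
  simp only [anchorTerm, kineticTerm, sub_sub_cancel]
  simp only [← real_inner_self_eq_norm_sq, inner_add_left, inner_sub_left,
    inner_add_right, inner_sub_right, real_inner_smul_left, real_inner_smul_right] at *
  simp only [real_inner_comm p y, real_inner_comm p q, real_inner_comm p r, real_inner_comm p g,
    real_inner_comm q r, real_inner_comm q g, real_inner_comm r g] at *
  linear_combination -lam * h1 + lam * h2 - h3 / 2 - k / 2 * (h7 - h8) - k / 2 * h9 + lam * h5
    + k * h10 + k / 2 * h11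

lemma norm_correction_le {α c a b ρ : ℝ} (hc : 0 ≤ c) (hcα : c ≤ α) {p q r : H}
    (hp : ‖p‖ ≤ a) (hq : ‖q‖ ≤ b) (hr : ‖r‖ ≤ ρ) :
    ‖-(α • p) - c • q - (α - c) • r‖ ≤ α * (a + b + ρ) := by
  have h1 := norm_sub_le (-(α • p) - c • q) ((α - c) • r)
  have h2 := norm_sub_le (-(α • p)) (c • q)
  rw [norm_neg] at h2
  rw [norm_smul, Real.norm_of_nonneg (by linarith)] at h1
  rw [norm_smul, norm_smul, Real.norm_of_nonneg hc, Real.norm_of_nonneg (by linarith)] at h2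
  nlinarith [norm_nonneg p, norm_nonneg q, norm_nonneg r]

lemma inner_le_mul {a b : ℝ} {u v : H} (hu : ‖u‖ ≤ a) (hv : ‖v‖ ≤ b) : ⟪u, v⟫ ≤ a * b :=
  (real_inner_le_norm u v).trans
    (mul_le_mul hu hv (norm_nonneg _) ((norm_nonneg _).trans hu))

lemma neg_inner_le_mul {a b : ℝ} {u v : H} (hu : ‖u‖ ≤ a) (hv : ‖v‖ ≤ b) : -⟪u, v⟫ ≤ a * b := by
  rw [← inner_neg_left]
  exact inner_le_mul (by rwa [norm_neg]) hv

set_option maxHeartbeats 400000 in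
lemma energy_add_one_le {α c lam k θ W : ℝ} (hc : 1 < c) (hcα : c < α) (hlam : 0 ≤ lam)
    (hk : 1 ≤ k) (hθ0 : 0 ≤ θ) (hθ : θ ≤ 1 / 2) (hW : 0 ≤ W) {y D V p q e f : H}
    (hrec : (k + α) • (p + q) = k • D + (k + α - c) • V)
    (hmono : ⟪p, f - e⟫ ≤ ⟪p, q - V⟫) (hf : ‖f‖ ≤ θ * ‖q - V‖) (he : ‖e‖ ≤ θ * W)
    (hy : ⟪y, f⟫ ≤ ⟪y, q⟫) :
    lam * anchorTerm α (k + 1) y p q + kineticTerm (k + 1) p q f ‖q - V‖ ≤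
      lam * anchorTerm α k (y - p) D V + kineticTerm k D V e W
      - k * ((α - 1 - lam) * ‖p‖ ^ 2 + (c - 1 + α / 2 - lam) * ⟪p, q⟫ + (c - 1) / 2 * ‖q‖ ^ 2)
      - (1 / 8 - θ / 4) * k ^ 2 * (‖q - V‖ ^ 2 + W ^ 2)
      + (lam + 1) * (3 * α + 3) * ((‖p‖ + ‖q‖ + ‖q - V‖) ^ 2
        + k * ((‖p‖ + ‖q‖ + ‖q - V‖) * (‖q - V‖ + W)) + ‖y‖ * ‖q - V‖) := by
  obtain ⟨g, hg⟩ : ∃ g, g = -(α • p) - c • q - (α - c) • (q - V) := ⟨_, rfl⟩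
  rw [energy_add_one_eq (W := W) (e := e) hg hrec]
  have hgn : ‖g‖ ≤ α * (‖p‖ + ‖q‖ + ‖q - V‖) :=
    hg ▸ norm_correction_le (by linarith) hcα.le le_rfl le_rfl le_rfl
  generalize q - V = r at *
  obtain ⟨n, hn⟩ : ∃ n, n = ‖p‖ + ‖q‖ + ‖r‖ := ⟨_, rfl⟩
  rw [← hn] at hgn ⊢
  have hp0 := norm_nonneg p
  have hq0 := norm_nonneg q
  have hr0 := norm_nonneg r
  have hy0 := norm_nonneg y
  have hpn : ‖p‖ ≤ n := by linarith
  have hqn : ‖q‖ ≤ n := by linarith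
  have hrn : ‖r‖ ≤ n := by linarith
  have hn0 : 0 ≤ n := by linarith
  have hfr : ‖f‖ ≤ ‖r‖ := hf.trans (by nlinarith)
  have heW : ‖e‖ ≤ W := he.trans (by nlinarith)
  have hk0 : 0 ≤ k := by linarith
  have a1 := mul_le_mul_of_nonneg_left (neg_inner_le_mul hpn hgn) hlam
  have a2 := mul_le_mul_of_nonneg_left hy (mul_nonneg hlam (sub_nonneg.2 hc.le))
  have a3 := mul_le_mul_of_nonneg_left (neg_inner_le_mul (le_refl ‖y‖) hfr)
    (mul_nonneg hlam (sub_nonneg.2 hc.le))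
  have a4 := mul_le_mul_of_nonneg_left (neg_inner_le_mul (le_refl ‖y‖) (le_refl ‖r‖))
    (mul_nonneg hlam (sub_nonneg.2 hcα.le))
  have a5 : 0 ≤ lam * (α - 1) / 2 * ‖p‖ ^ 2 :=
    mul_nonneg (div_nonneg (mul_nonneg hlam (by linarith)) (by norm_num)) (sq_nonneg _)
  have a6 : ‖p‖ ^ 2 / 2 + ⟪p, q⟫ / 2 + ‖q‖ ^ 2 / 4 ≤ n ^ 2 := by
    nlinarith [real_inner_le_norm p q, mul_nonneg hp0 hq0, mul_nonneg hp0 hr0,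
      mul_nonneg hq0 hr0, sq_nonneg ‖p‖, sq_nonneg ‖q‖, sq_nonneg ‖r‖]
  have hkc := mul_nonneg hk0 (sub_nonneg.2 hcα.le)
  have a7 := mul_le_mul_of_nonneg_left (neg_inner_le_mul hpn (le_refl ‖r‖)) hkc
  have a8 := mul_le_mul_of_nonneg_left (neg_inner_le_mul hqn (le_refl ‖r‖)) hkc
  have a9 := mul_le_mul_of_nonneg_left (inner_le_mul (le_refl ‖r‖) hgn) hk0
  have a10 : 0 ≤ ‖g‖ ^ 2 := sq_nonneg _
  have a11 := mul_le_mul_of_nonneg_left (inner_le_mul hpn hfr) (by linarith : 0 ≤ k + 1 / 2)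
  have a12 := mul_le_mul_of_nonneg_left (mul_le_mul_of_nonneg_right hrn hr0)
    (by linarith : 0 ≤ (2 * k + 1) / 8)
  have a13 := mul_le_mul_of_nonneg_left (inner_le_mul hgn heW) hk0
  have hkk : 0 ≤ k ^ 2 := sq_nonneg k
  have a14 : -⟪r, e⟫ ≤ θ / 2 * (‖r‖ ^ 2 + W ^ 2) := by
    nlinarith [neg_inner_le_mul (le_refl ‖r‖) he, mul_nonneg hθ0 (sq_nonneg (‖r‖ - W))]
  have b1 := mul_le_mul_of_nonneg_left a14 hkk
  have b2 := mul_le_mul_of_nonneg_left hmono hkk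
  have hα : 0 ≤ α := by linarith
  have u1 : 0 ≤ n ^ 2 := sq_nonneg n
  have u2 : 0 ≤ k * (n * ‖r‖) := by positivity
  have u3 : 0 ≤ k * (n * W) := by positivity
  have u4 : 0 ≤ ‖y‖ * ‖r‖ := by positivity
  have u5 : n * ‖r‖ ≤ k * (n * ‖r‖) := le_mul_of_one_le_left (mul_nonneg hn0 hr0) hk
  have w1 : 0 ≤ lam * α * n ^ 2 := by positivity
  have w2 : 0 ≤ lam * α * (k * (n * ‖r‖)) := by positivity
  have w3 : 0 ≤ lam * α * (k * (n * W)) := by positivity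
  have w4 : 0 ≤ lam * α * (‖y‖ * ‖r‖) := by positivity
  have w5 : 0 ≤ α * n ^ 2 := by positivity
  have w6 : 0 ≤ α * (k * (n * ‖r‖)) := by positivity
  have w7 : 0 ≤ α * (k * (n * W)) := by positivity
  have w8 : 0 ≤ α * (‖y‖ * ‖r‖) := by positivity
  have w9 : 0 ≤ c * (k * (n * ‖r‖)) := by positivity
  have w10 : 0 ≤ lam * n ^ 2 := by positivity
  have w11 : 0 ≤ lam * (k * (n * ‖r‖)) := by positivity
  have w12 : 0 ≤ lam * (k * (n * W)) := by positivity
  have w13 : 0 ≤ lam * (‖y‖ * ‖r‖) := by positivity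
  have u6 : 0 ≤ lam * (c * (‖y‖ * ‖r‖)) := by positivity
  rw [inner_sub_right] at b2 ⊢
  linarith only [a1, a2, a3, a4, a5, a6, a7, a8, a9, a10, a11, a12, a13, b1, b2, u1, u2, u3, u4, u5,
    u6, w1, w2, w3, w4, w5, w6, w7, w8, w9, w10, w11, w12, w13]

lemma kineticTerm_ge {k θ W : ℝ} {D V e : H} (hθ : θ ≤ 1 / 2) (hW : 0 ≤ W) (he : ‖e‖ ≤ θ * W) :
    k ^ 2 * (‖D‖ ^ 2 + ‖V‖ ^ 2) / 16 ≤ kineticTerm k D V e W + k ^ 2 * W ^ 2 := by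
  have h1 := neg_inner_le_mul (le_refl ‖D‖) (he.trans (by nlinarith : θ * W ≤ W / 2))
  have h2 := neg_inner_le_mul (le_refl ‖D‖) (le_refl ‖V‖)
  have h3 : (‖D‖ ^ 2 + ‖V‖ ^ 2) / 16 ≤
      ‖D‖ ^ 2 / 2 + ⟪D, V⟫ / 2 + ‖V‖ ^ 2 / 4 + ⟪D, e⟫ / 2 + W ^ 2 / 8 + W ^ 2 := by
    nlinarith [sq_nonneg (4 * ‖D‖ - 3 * ‖V‖), sq_nonneg (‖D‖ - 9 * W), sq_nonneg ‖D‖,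
      sq_nonneg ‖V‖, sq_nonneg W]
  have := mul_le_mul_of_nonneg_left h3 (sq_nonneg k)
  rw [kineticTerm]
  linarith

lemma abs_kineticTerm_le {k θ W : ℝ} {D V e : H} (hθ : θ ≤ 1 / 2) (hW : 0 ≤ W)
    (he : ‖e‖ ≤ θ * W) :
    |kineticTerm k D V e W| ≤ k ^ 2 * (‖D‖ ^ 2 + ‖V‖ ^ 2 + W ^ 2) := by
  have he' := he.trans (by nlinarith : θ * W ≤ W / 2)
  have h1 := neg_inner_le_mul (le_refl ‖D‖) he'
  have h2 := neg_inner_le_mul (le_refl ‖D‖) (le_refl ‖V‖)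
  have h3 := inner_le_mul (le_refl ‖D‖) he'
  have h4 := inner_le_mul (le_refl ‖D‖) (le_refl ‖V‖)
  rw [kineticTerm, abs_mul, abs_of_nonneg (sq_nonneg k)]
  refine mul_le_mul_of_nonneg_left (abs_le.2 ⟨?_, ?_⟩) (sq_nonneg k) <;>
    nlinarith [sq_nonneg (‖D‖ - ‖V‖), sq_nonneg (‖D‖ - W), sq_nonneg ‖D‖, sq_nonneg ‖V‖,
      sq_nonneg W]

lemma eq_zero_of_tendsto_of_summable_div {f : ℕ → ℝ} {l : ℝ} (hf : Tendsto f atTop (nhds l))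
    (hs : Summable fun k : ℕ => |f k| / k) : l = 0 := by
  by_contra hl
  have hl0 : 0 < |l| := abs_pos.2 hl
  have h1 : ∀ᶠ k in atTop, |l| / 2 < |f k| :=
    hf.abs.eventually_const_lt (by linarith)
  refine Real.not_summable_natCast_inv ?_
  refine Summable.of_norm_bounded_eventually_nat (hs.mul_left (2 / |l|)) ?_
  filter_upwards [h1] with k hk
  rw [Real.norm_of_nonneg (by positivity), ← one_div, ← mul_div_assoc]
  refine div_le_div_of_nonneg_right ?_ (Nat.cast_nonneg k)
  rw [div_mul_eq_mul_div, le_div_iff₀ hl0]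
  linarith

lemma tendsto_mul_of_tendsto_sq_mul_sq {a : ℕ → ℝ} (ha : ∀ k, 0 ≤ a k)
    (h : Tendsto (fun k : ℕ => (k : ℝ) ^ 2 * a k ^ 2) atTop (nhds 0)) :
    Tendsto (fun k : ℕ => (k : ℝ) * a k) atTop (nhds 0) := by
  have := h.sqrt
  rw [Real.sqrt_zero] at this
  refine this.congr fun k => ?_
  rw [← mul_pow, Real.sqrt_sq (mul_nonneg (Nat.cast_nonneg k) (ha k))]

/-- The energy along the sequences `x`, `D`, `V`, `e` with free parameter `lam`. -/
noncomputable def energy (α lam : ℝ) (x D V e : ℕ → H) (k : ℕ) : ℝ :=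
  lam * anchorTerm α k (x k) (D k) (V k) + kineticTerm k (D k) (V k) (e k) ‖V k - V (k - 1)‖

section Sequences

variable {α c θ : ℝ} {x D V e : ℕ → H}

lemma energy_tendsto {lam : ℝ} (hc : 1 < c) (hcα : c < α) (hθ0 : 0 ≤ θ) (hθ : θ < 1 / 2)
    (hx : ∀ k ≥ 1, x (k + 1) = x k + D (k + 1))
    (hrec : ∀ k : ℕ, 1 ≤ k →
      ((k : ℝ) + α) • (D (k + 1) + V (k + 1)) = (k : ℝ) • D k + (k + α - c) • V k)
    (hmono : ∀ k ≥ 2, ⟪D (k + 1), e (k + 1) - e k⟫ ≤ ⟪D (k + 1), V (k + 1) - V k⟫)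
    (he : ∀ k ≥ 2, ‖e k‖ ≤ θ * ‖V k - V (k - 1)‖)
    (hxe : ∀ k ≥ 1, ⟪x k, e k⟫ ≤ ⟪x k, V k⟫)
    (hlam : 0 < lam) (hlamα : lam < α - 1)
    (hdisc : (c - 1 + α / 2 - lam) ^ 2 < 2 * (α - 1 - lam) * (c - 1)) :
    (∃ l, Tendsto (energy α lam x D V e) atTop (nhds l)) ∧
    (Summable fun k : ℕ => (k : ℝ) * (‖D k‖ ^ 2 + ‖V k‖ ^ 2)) ∧
    (Summable fun k : ℕ => (k : ℝ) ^ 2 * ‖V k - V (k - 1)‖ ^ 2) ∧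
    ∃ B, ∀ᶠ k in atTop, ‖x k‖ ≤ B := by
  obtain ⟨κ₁, hκ₁, hform⟩ := exists_pos_le_quadratic_form (H := H)
    (A := α - 1 - lam) (B := c - 1 + α / 2 - lam) (C := (c - 1) / 2)
    (by linarith) (by linarith) (by linarith)
  obtain ⟨κ₂, hκ₂e⟩ : ∃ κ₂, κ₂ = 1 / 8 - θ / 4 := ⟨_, rfl⟩
  have hκ₂ : 0 < κ₂ := by linarith
  obtain ⟨K, -, C, hC, hK⟩ := exists_absorption hκ₁ hκ₂
    (show 0 < (lam + 1) * (3 * α + 3) by nlinarith)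
  obtain ⟨m, hm⟩ : ∃ m, m = lam * (α - 1 - lam) / 2 := ⟨_, rfl⟩
  have hm0 : 0 < m := by rw [hm]; exact div_pos (mul_pos hlam (by linarith)) two_pos
  have hlow : ∀ k ≥ 2, m * ‖x k‖ ^ 2 ≤ energy α lam x D V e k := fun k hk => by
    rw [hm]
    exact le_energy hlam.le (Nat.cast_nonneg k) hθ.le (norm_nonneg _) (he k hk)
      (hxe k (by omega))
  set d : ℕ → ℝ := fun k => κ₁ / 2 * k * (‖D (k + 1)‖ ^ 2 + ‖V (k + 1)‖ ^ 2)
    + κ₂ / 2 * (k : ℝ) ^ 2 * (‖V (k + 1) - V k‖ ^ 2 + ‖V k - V (k - 1)‖ ^ 2) with hd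
  have hd0 : ∀ k, 0 ≤ d k := fun k => by positivity
  have hstep : ∀ᶠ k : ℕ in atTop, energy α lam x D V e (k + 1) ≤
      energy α lam x D V e k - d k + C / m / (k : ℝ) ^ 2 * energy α lam x D V e (k + 1) := by
    filter_upwards [eventually_ge_atTop 2, tendsto_natCast_atTop_atTop.eventually_ge_atTop K]
      with k hk2 hkK
    have hk1 : (1 : ℝ) ≤ k := by exact_mod_cast (by omega : 1 ≤ k)
    have h1 := energy_add_one_le (W := ‖V k - V (k - 1)‖) (y := x (k + 1)) hc hcα hlam.le hk1 hθ0
      hθ.le (norm_nonneg _) (hrec k (by omega)) (hmono k hk2) (he (k + 1) (by omega)) (he k hk2)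
      (hxe (k + 1) (by omega))
    have h2 := mul_le_mul_of_nonneg_left (hform (D (k + 1)) (V (k + 1)))
      (by linarith : (0 : ℝ) ≤ k)
    have h3 := hK k hkK ‖D (k + 1)‖ ‖V (k + 1)‖ ‖V (k + 1) - V k‖ ‖V k - V (k - 1)‖ ‖x (k + 1)‖
    have h4 : C / (k : ℝ) ^ 2 * ‖x (k + 1)‖ ^ 2 ≤
        C / m / (k : ℝ) ^ 2 * energy α lam x D V e (k + 1) := by
      have h5 := mul_le_mul_of_nonneg_left (hlow (k + 1) (by omega))
        (by positivity : 0 ≤ C / m / (k : ℝ) ^ 2)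
      refine le_trans (le_of_eq ?_) h5
      field_simp
    rw [hx k (by omega), add_sub_cancel_right, ← hx k (by omega), ← hκ₂e] at h1
    have h6 : energy α lam x D V e (k + 1) = lam * anchorTerm α (k + 1) (x (k + 1)) (D (k + 1))
        (V (k + 1)) + kineticTerm (k + 1) (D (k + 1)) (V (k + 1)) (e (k + 1))
        ‖V (k + 1) - V k‖ := by
      simp [energy]
    have h7 : energy α lam x D V e k = lam * anchorTerm α k (x k) (D k) (V k)
      + kineticTerm k (D k) (V k) (e k) ‖V k - V (k - 1)‖ := rfl
    rw [← h6, ← h7] at h1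
    simp only [hd]
    linarith
  have hE0 : ∀ᶠ k in atTop, 0 ≤ energy α lam x D V e k := by
    filter_upwards [eventually_ge_atTop 2] with k hk
    exact le_trans (by positivity) (hlow k hk)
  obtain ⟨⟨l, hl⟩, hsum⟩ := exists_tendsto_and_summable_of_le (div_nonneg hC hm0.le) hE0
    (Eventually.of_forall hd0) hstep
  refine ⟨⟨l, hl⟩, ?_, ?_, ?_⟩
  · rw [← summable_nat_add_iff 1]
    refine Summable.of_norm_bounded_eventually_nat (hsum.mul_left (4 / κ₁)) ?_
    filter_upwards [eventually_ge_atTop 1] with k hk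
    have hk1 : (1 : ℝ) ≤ k := by exact_mod_cast hk
    rw [Real.norm_of_nonneg (by positivity)]
    have h1 : κ₁ / 2 * k * (‖D (k + 1)‖ ^ 2 + ‖V (k + 1)‖ ^ 2) ≤ d k :=
      le_add_of_nonneg_right (by positivity)
    have h2 := mul_le_mul_of_nonneg_left h1 (by positivity : 0 ≤ 4 / κ₁)
    have h3 : 4 / κ₁ * (κ₁ / 2 * k * (‖D (k + 1)‖ ^ 2 + ‖V (k + 1)‖ ^ 2)) =
        2 * k * (‖D (k + 1)‖ ^ 2 + ‖V (k + 1)‖ ^ 2) := by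
      field_simp; norm_num
    rw [h3] at h2
    exact (mul_le_mul_of_nonneg_right (by push_cast; linarith) (by positivity)).trans h2
  · refine Summable.of_nonneg_of_le (fun k => by positivity) (fun k => ?_)
      (hsum.mul_left (2 / κ₂))
    have h1 : κ₂ / 2 * (k : ℝ) ^ 2 * ‖V k - V (k - 1)‖ ^ 2 ≤ d k := by
      have : 0 ≤ κ₁ / 2 * k * (‖D (k + 1)‖ ^ 2 + ‖V (k + 1)‖ ^ 2) := by positivity
      have : 0 ≤ κ₂ / 2 * (k : ℝ) ^ 2 * ‖V (k + 1) - V k‖ ^ 2 := by positivity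
      simp only [hd]
      linarith
    have h2 := mul_le_mul_of_nonneg_left h1 (by positivity : 0 ≤ 2 / κ₂)
    refine le_trans (le_of_eq ?_) h2
    field_simp
  · refine ⟨Real.sqrt ((l + 1) / m), ?_⟩
    filter_upwards [eventually_ge_atTop 2, hl.eventually_lt_const (lt_add_one l)] with k hk hkl
    refine Real.le_sqrt_of_sq_le ((le_div_iff₀ hm0).2 ?_)
    linarith [hlow k hk]

lemma rates_of_recursion (hc : 1 < c) (hcα : c < α - 1) (hθ0 : 0 ≤ θ)
    (hθ : θ < 1 / 2)
    (hx : ∀ k ≥ 1, x (k + 1) = x k + D (k + 1))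
    (hrec : ∀ k : ℕ, 1 ≤ k →
      ((k : ℝ) + α) • (D (k + 1) + V (k + 1)) = (k : ℝ) • D k + (k + α - c) • V k)
    (hmono : ∀ k ≥ 2, ⟪D (k + 1), e (k + 1) - e k⟫ ≤ ⟪D (k + 1), V (k + 1) - V k⟫)
    (he : ∀ k ≥ 2, ‖e k‖ ≤ θ * ‖V k - V (k - 1)‖)
    (hxe : ∀ k ≥ 1, ⟪x k, e k⟫ ≤ ⟪x k, V k⟫) :
    Tendsto (fun k : ℕ => (k : ℝ) * ‖D k‖) atTop (nhds 0) ∧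
    Tendsto (fun k : ℕ => (k : ℝ) * ‖V k‖) atTop (nhds 0) ∧
    Tendsto (fun k : ℕ => (k : ℝ) * ‖V k - V (k - 1)‖) atTop (nhds 0) ∧
    ∃ B, ∀ᶠ k in atTop, ‖x k‖ ≤ B := by
  obtain ⟨ε, hε, hεα, hεc⟩ : ∃ ε > 0, ε < α / 2 - 1 ∧ ε ^ 2 < (c - 1) * (α - 1 - c) := by
    have h0 : 0 < (c - 1) * (α - 1 - c) := mul_pos (by linarith) (by linarith)
    obtain ⟨ε, hε, hlt⟩ := exists_between (lt_min (show 0 < α / 2 - 1 by linarith)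
      (lt_min one_pos h0))
    obtain ⟨h1, h2⟩ := lt_min_iff.1 hlt
    obtain ⟨h2, h3⟩ := lt_min_iff.1 h2
    exact ⟨ε, hε, h1, by nlinarith⟩
  obtain ⟨⟨l₁, hl₁⟩, hsDV, hsW, hB⟩ := energy_tendsto (lam := α / 2) hc (by linarith) hθ0 hθ hx
    hrec hmono he hxe (by linarith) (by linarith) (by nlinarith)
  obtain ⟨⟨l₂, hl₂⟩, -⟩ := energy_tendsto (lam := α / 2 + ε) hc (by linarith) hθ0 hθ hx
    hrec hmono he hxe (by linarith) (by linarith) (by nlinarith)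
  set T : ℕ → ℝ := fun k => kineticTerm k (D k) (V k) (e k) ‖V k - V (k - 1)‖ with hT
  have hTlim : Tendsto T atTop (nhds (l₁ - α / 2 * ((l₂ - l₁) / ε))) := by
    refine (hl₁.sub (((hl₂.sub hl₁).div_const ε).const_mul (α / 2))).congr fun k => ?_
    simp only [energy, hT]
    field_simp
    ring
  have hT0 : Tendsto T atTop (nhds 0) := by
    have hz : l₁ - α / 2 * ((l₂ - l₁) / ε) = 0 := by
      refine eq_zero_of_tendsto_of_summable_div hTlim ?_
      refine Summable.of_norm_bounded_eventually_nat (hsDV.add hsW) ?_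
      filter_upwards [eventually_ge_atTop 2] with k hk
      have hk1 : (1 : ℝ) ≤ k := by exact_mod_cast (by omega : 1 ≤ k)
      rw [Real.norm_of_nonneg (by positivity), div_le_iff₀ (by linarith)]
      refine (abs_kineticTerm_le hθ.le (norm_nonneg _) (he k hk)).trans ?_
      have : (k : ℝ) ^ 2 * ‖V k - V (k - 1)‖ ^ 2 ≤ k * ((k : ℝ) ^ 2 * ‖V k - V (k - 1)‖ ^ 2) :=
        le_mul_of_one_le_left (by positivity) hk1
      linarith
    rwa [hz] at hTlim
  have hW0 := hsW.tendsto_atTop_zero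
  have hDV : Tendsto (fun k : ℕ => 16 * (T k + (k : ℝ) ^ 2 * ‖V k - V (k - 1)‖ ^ 2)) atTop
      (nhds 0) := by
    simpa using (hT0.add hW0).const_mul 16
  have hle : ∀ᶠ k : ℕ in atTop, (k : ℝ) ^ 2 * ‖D k‖ ^ 2 + (k : ℝ) ^ 2 * ‖V k‖ ^ 2 ≤
      16 * (T k + (k : ℝ) ^ 2 * ‖V k - V (k - 1)‖ ^ 2) := by
    filter_upwards [eventually_ge_atTop 2] with k hk
    have := kineticTerm_ge (k := k) (D := D k) (V := V k) hθ.le (norm_nonneg _) (he k hk)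
    simp only [hT]
    linarith
  refine ⟨tendsto_mul_of_tendsto_sq_mul_sq (fun k => norm_nonneg _) ?_,
    tendsto_mul_of_tendsto_sq_mul_sq (fun k => norm_nonneg _) ?_,
    tendsto_mul_of_tendsto_sq_mul_sq (fun k => norm_nonneg _) hW0, hB⟩
  · exact squeeze_zero' (Eventually.of_forall fun k => by positivity)
      (hle.mono fun k hk => (le_add_of_nonneg_right (by positivity)).trans hk) hDV
  · exact squeeze_zero' (Eventually.of_forall fun k => by positivity)
      (hle.mono fun k hk => (le_add_of_nonneg_left (by positivity)).trans hk) hDV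

end Sequences

end FastRFB

theorem stmt_10
    {H : Type*} [NormedAddCommGroup H] [InnerProductSpace ℝ H] [CompleteSpace H]
    (M : H → Set H) (F : H → H) (L α c γ : ℝ)
    (hM : ∀ z y u' v', u' ∈ M z → v' ∈ M y → 0 ≤ ⟪v' - u', y - z⟫)
    (hFmono : ∀ z y, 0 ≤ ⟪F y - F z, y - z⟫)
    (hL : 0 < L)
    (hFlip : ∀ z y, ‖F y - F z‖ ≤ L * ‖y - z‖)
    (hα : 2 < α) (hcl : α / 2 < c) (hcu : c < α - 1)
    (hγ0 : 0 < γ) (hγ : γ < 1 / (2 * L))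
    (z w ξ v : ℕ → H)
    (hξ : ∀ k : ℕ, 1 ≤ k → ξ k ∈ M (z k))
    (hv : ∀ k : ℕ, 1 ≤ k → v k = ξ k + F (w (k - 1)))
    (hw : ∀ k : ℕ, 1 ≤ k →
      w k = z k + ((k : ℝ) / ((k : ℝ) + α)) • (z k - z (k - 1)) - ((c / ((k : ℝ) + α)) * γ) • v k)
    (hz : ∀ k : ℕ, 1 ≤ k → z (k + 1) = w k - γ • (v (k + 1) - v k))
    (zs : H) (hzs : -F zs ∈ M zs) :
    Tendsto (fun k : ℕ => (k : ℝ) * ‖z k - z (k - 1)‖) atTop (nhds 0) ∧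
    Tendsto (fun k : ℕ => (k : ℝ) * ‖ξ k + F (z k)‖) atTop (nhds 0) ∧
    Tendsto (fun k : ℕ => (k : ℝ) * ⟪ξ k + F (z k), z k - zs⟫) atTop (nhds 0) ∧
    Tendsto (fun k : ℕ =>
      (k : ℝ) * Metric.infDist (0 : H) ((fun m => m + F (z k)) '' M (z k))) atTop (nhds 0) := by
  have hθ : γ * L < 1 / 2 := by
    rw [lt_div_iff₀ (by positivity)] at hγ
    linarith
  obtain ⟨x, hx⟩ : ∃ x : ℕ → H, ∀ k, x k = z k - zs := ⟨_, fun _ => rfl⟩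
  obtain ⟨D, hD⟩ : ∃ D : ℕ → H, ∀ k, D k = z k - z (k - 1) := ⟨_, fun _ => rfl⟩
  obtain ⟨V, hV⟩ : ∃ V : ℕ → H, ∀ k, V k = γ • v k := ⟨_, fun _ => rfl⟩
  obtain ⟨e, he⟩ : ∃ e : ℕ → H, ∀ k, e k = γ • (F (w (k - 1)) - F (z k)) := ⟨_, fun _ => rfl⟩
  have hres : ∀ k ≥ 1, V k - e k = γ • (ξ k + F (z k)) := fun k hk => by
    rw [hV, he, hv k hk]
    module
  have hDk : ∀ k, D (k + 1) = z (k + 1) - z k := fun k => by rw [hD, Nat.add_sub_cancel]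
  have hres0 : ∀ k ≥ 1, 0 ≤ ⟪ξ k + F (z k), z k - zs⟫ := fun k hk => by
    have h1 := hM zs (z k) _ _ hzs (hξ k hk)
    have h2 := hFmono zs (z k)
    rw [show ξ k + F (z k) = (ξ k - -F zs) + (F (z k) - F zs) by abel, inner_add_left]
    linarith
  have heW : ∀ k ≥ 2, ‖e k‖ ≤ γ * L * ‖V k - V (k - 1)‖ := by
    intro k hk
    obtain ⟨j, rfl⟩ : ∃ j, k = j + 1 := ⟨k - 1, by omega⟩
    rw [he, norm_smul, Real.norm_of_nonneg hγ0.le, mul_assoc]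
    refine mul_le_mul_of_nonneg_left ((hFlip _ _).trans (le_of_eq ?_)) hγ0.le
    rw [Nat.add_sub_cancel, hz j (by omega), sub_sub_cancel, hV, hV, smul_sub]
  obtain ⟨hDlim, hVlim, hWlim, B, hB⟩ := FastRFB.rates_of_recursion (α := α) (c := c)
    (θ := γ * L) (x := x) (D := D) (V := V) (e := e) (by linarith) hcu (by positivity) hθ
    (fun k _ => by rw [hDk, hx, hx]; abel)
    (fun k hk => by
      have hk0 : (k : ℝ) + α ≠ 0 := by positivity
      have h1 : D (k + 1) + V (k + 1) = ((k : ℝ) / ((k : ℝ) + α)) • D k + V k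
          - (c / ((k : ℝ) + α)) • V k := by
        rw [hDk, hz k hk, hw k hk, hV, hV, hD]
        module
      rw [h1, smul_sub, smul_add, smul_smul, smul_smul, mul_div_cancel₀ _ hk0,
        mul_div_cancel₀ _ hk0]
      module)
    (fun k hk => by
      have h1 := hM (z k) (z (k + 1)) _ _ (hξ k (by omega)) (hξ (k + 1) (by omega))
      have h2 := hFmono (z k) (z (k + 1))
      have h3 : (V (k + 1) - V k) - (e (k + 1) - e k) =
          γ • ((ξ (k + 1) - ξ k) + (F (z (k + 1)) - F (z k))) := by
        rw [sub_sub_sub_comm, hres k (by omega), hres (k + 1) (by omega)]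
        module
      rw [← sub_nonneg, ← inner_sub_right, h3, hDk, real_inner_comm, real_inner_smul_left,
        inner_add_left]
      exact mul_nonneg hγ0.le (add_nonneg h1 h2))
    heW
    (fun k hk => by
      rw [← sub_nonneg, ← inner_sub_right, hres k hk, hx, real_inner_comm, real_inner_smul_left]
      exact mul_nonneg hγ0.le (hres0 k hk))
  have hres_le : ∀ k ≥ 2, ‖ξ k + F (z k)‖ ≤ γ⁻¹ * (‖V k‖ + γ * L * ‖V k - V (k - 1)‖) := by
    intro k hk
    rw [← inv_smul_smul₀ hγ0.ne' (ξ k + F (z k)), ← hres k (by omega), norm_smul,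
      Real.norm_of_nonneg (inv_nonneg.2 hγ0.le)]
    exact mul_le_mul_of_nonneg_left ((norm_sub_le _ _).trans (by linarith [heW k hk]))
      (inv_nonneg.2 hγ0.le)
  have hreslim : Tendsto (fun k : ℕ => (k : ℝ) * ‖ξ k + F (z k)‖) atTop (nhds 0) := by
    have h1 : Tendsto (fun k : ℕ => γ⁻¹ * ((k : ℝ) * ‖V k‖
        + γ * L * ((k : ℝ) * ‖V k - V (k - 1)‖))) atTop (nhds 0) := by
      simpa using (hVlim.add (hWlim.const_mul (γ * L))).const_mul γ⁻¹
    refine squeeze_zero' (Eventually.of_forall fun k => by positivity) ?_ h1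
    filter_upwards [eventually_ge_atTop 2] with k hk
    refine (mul_le_mul_of_nonneg_left (hres_le k hk) (Nat.cast_nonneg k)).trans (le_of_eq ?_)
    ring
  refine ⟨hDlim.congr fun k => by rw [hD], hreslim, ?_, ?_⟩
  · have h1 : Tendsto (fun k : ℕ => (k : ℝ) * ‖ξ k + F (z k)‖ * B) atTop (nhds 0) := by
      simpa using hreslim.mul_const B
    refine squeeze_zero' ?_ ?_ h1
    · filter_upwards [eventually_ge_atTop 1] with k hk
      exact mul_nonneg (Nat.cast_nonneg k) (hres0 k hk)
    · filter_upwards [hB] with k hkB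
      rw [hx] at hkB
      rw [mul_assoc]
      exact mul_le_mul_of_nonneg_left (FastRFB.inner_le_mul le_rfl hkB) (Nat.cast_nonneg k)
  · refine squeeze_zero' (Eventually.of_forall fun k =>
      mul_nonneg (Nat.cast_nonneg k) Metric.infDist_nonneg) ?_ hreslim
    filter_upwards [eventually_ge_atTop 1] with k hk
    refine mul_le_mul_of_nonneg_left ?_ (Nat.cast_nonneg k)
    rw [← dist_zero_left]
    exact Metric.infDist_le_dist_of_mem ⟨ξ k, hξ k hk, rfl⟩
end

section
/- Suppose Ψ has at least one saddle point. Then the sequence (x_k, λ_k)_{k≥0} converges weakly to a saddle point of Ψ: there exists (x̄, λ̄) ∈ X × Y with Ψ(x̄, λ) ≤ Ψ(x̄, λ̄) ≤ Ψ(x, λ̄) for all (x, λ) ∈ X × Y, such that ⟨x_k, p⟩ → ⟨x̄, p⟩ for every p ∈ X and ⟨λ_k, q⟩ → ⟨λ̄, q⟩ for every q ∈ Y as k → +∞. -/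
open scoped RealInnerProductSpace Pointwise
open Filter

/-- The discrete Lyapunov function: `ζ` is the distance vector to a saddle point, `Δ` the last
increment, `p` the residual, `D` the last increment of the residual and `e` the extragradient
error. -/
noncomputable def ogdaEnergy {H : Type*} [NormedAddCommGroup H] [InnerProductSpace ℝ H]
    (α c ν l k : ℝ) (ζ Δ p D e : H) : ℝ :=
  ‖l • ζ + k • Δ + (k / 2) • p‖ ^ 2 + l * (α - 1 - l) * ‖ζ‖ ^ 2
    + l * (k + 2 * (α - c)) * ⟪ζ, p⟫ + k ^ 2 / 4 * ‖p‖ ^ 2 + k ^ 2 * ⟪Δ, e⟫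
    + ν / 2 * k ^ 2 * ‖D‖ ^ 2

section Energy

variable {H : Type*} [NormedAddCommGroup H] [InnerProductSpace ℝ H]

lemma ogdaEnergy_sub (α c ν l l' k : ℝ) (ζ Δ p D e : H) :
    ogdaEnergy α c ν l k ζ Δ p D e - ogdaEnergy α c ν l' k ζ Δ p D e
      = (l - l') * ((α - 1) * ‖ζ‖ ^ 2 + 2 * k * ⟪ζ, Δ⟫ + 2 * (k + (α - c)) * ⟪ζ, p⟫) := by
  simp only [ogdaEnergy, ← real_inner_self_eq_norm_sq, inner_add_left, inner_add_right,
    real_inner_smul_left, real_inner_smul_right, real_inner_comm ζ Δ, real_inner_comm ζ p,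
    real_inner_comm Δ p]
  ring

lemma ogdaEnergy_step_eq {α c ν l k : ℝ} {ζ Δ p D e ζ' Δ' p' D' e' : H}
    (hζ : ζ = ζ' - Δ') (hp : p = p' - D')
    (hΔ : k • Δ = (k + α) • Δ' + (k + α - c) • D' + c • p') :
    ogdaEnergy α c ν l (k + 1) ζ' Δ' p' D' e' - ogdaEnergy α c ν l k ζ Δ p D e
      = -(2 * l * (c - 1) * ⟪ζ', p' - e'⟫) - 2 * l * (c - 1) * ⟪ζ, e'⟫
        - 2 * l * (c - 1) * ⟪Δ', e'⟫
        - k * (2 * (α - 1 - l) * ‖Δ'‖ ^ 2 + 2 * (α / 2 + c - 1 - l) * ⟪Δ', p'⟫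
            + (c - 1) * ‖p'‖ ^ 2)
        - k ^ 2 / 2 * ‖D'‖ ^ 2 + ν / 2 * (k + 1) ^ 2 * ‖D'‖ ^ 2 - ν / 2 * k ^ 2 * ‖D‖ ^ 2
        - k ^ 2 * ⟪(p' - e') - (p - e), Δ'⟫ - k ^ 2 * ⟪D', e⟫
        - (α - 1 - l) * (α + 1) * ‖Δ'‖ ^ 2
        - ((3 * α - 2 * c) * k + 2 * (α - c) * α) * ⟪Δ', D'⟫
        - ((2 * c - 1) * (α - l) + (α - 1 - l) - 2 * l * (α - c)) * ⟪Δ', p'⟫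
        - (c ^ 2 - 1 / 2) * ‖p'‖ ^ 2
        - (α * k + 2 * c * (α - c)) * ⟪D', p'⟫
        - (2 * (α - c) * k / 2 + (α - c) ^ 2) * ‖D'‖ ^ 2
        + (2 * k + 1) * ⟪Δ', e'⟫ - α * k * ⟪Δ', e⟫ - (α - c) * k * ⟪D', e⟫
        - c * k * ⟪p', e⟫ := by
  have h1 : k ^ 2 * ⟪Δ, e⟫ = k * ⟪(k + α) • Δ' + (k + α - c) • D' + c • p', e⟫ := by
    rw [← hΔ, real_inner_smul_left]; ring
  simp only [ogdaEnergy, h1]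
  rw [hΔ]
  subst hζ hp
  simp only [← real_inner_self_eq_norm_sq, inner_add_left, inner_add_right, inner_sub_left,
    inner_sub_right,
    real_inner_smul_left, real_inner_smul_right, real_inner_comm ζ' Δ', real_inner_comm ζ' p',
    real_inner_comm Δ' p', real_inner_comm ζ' D', real_inner_comm Δ' D', real_inner_comm p' D',
    real_inner_comm Δ' e', real_inner_comm Δ' e]
  ring

lemma exists_quadratic_form_lower_bound {a b h : ℝ} (ha : 0 < a) (hb : 0 < b)
    (hh : h ^ 2 < a * b) :
    ∃ δ > 0, ∀ x y : H, δ * (‖x‖ ^ 2 + ‖y‖ ^ 2) ≤ a * ‖x‖ ^ 2 + 2 * h * ⟪x, y⟫ + b * ‖y‖ ^ 2 := by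
  have hab : 0 < a + b := by positivity
  obtain ⟨δ, hδ⟩ : ∃ δ, δ = (a * b - h ^ 2) / (a + b) := ⟨_, rfl⟩
  have hδ' : δ * (a + b) = a * b - h ^ 2 := by rw [hδ]; field_simp
  have hδ0 : 0 < δ := by rw [hδ]; exact div_pos (by linarith) hab
  have hδa : 0 < a - δ := by
    by_contra! hcon
    nlinarith [mul_nonneg (sub_nonneg.2 hcon) hb.le, sq_nonneg h, sq_nonneg a]
  refine ⟨δ, hδ0, fun x y => ?_⟩
  have hsq : 0 ≤ ‖(a - δ) • x + h • y‖ ^ 2 := by positivity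
  rw [← real_inner_self_eq_norm_sq] at hsq
  simp only [inner_add_left, inner_add_right, real_inner_smul_left, real_inner_smul_right,
    real_inner_comm x y, real_inner_self_eq_norm_sq, norm_smul, mul_pow, Real.norm_eq_abs,
    sq_abs] at hsq
  have hprod : h ^ 2 ≤ (a - δ) * (b - δ) := by nlinarith [sq_nonneg δ]
  have h3 : 0 ≤ (a - δ) * ((a - δ) * ‖x‖ ^ 2 + 2 * h * ⟪x, y⟫ + (b - δ) * ‖y‖ ^ 2) := by
    nlinarith [mul_le_mul_of_nonneg_right hprod (sq_nonneg ‖y‖)]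
  have h4 := nonneg_of_mul_nonneg_right h3 hδa
  linarith

lemma mul_abs_inner_le_of_sq_le {N k : ℝ} (hN : 1 ≤ N) (hk : N ^ 2 ≤ k) (x y : H) :
    k * |⟪x, y⟫| ≤ (k * ‖x‖ ^ 2 + k ^ 2 * ‖y‖ ^ 2) / N := by
  have hk0 : 0 < k := by nlinarith
  have h1 := abs_real_inner_le_norm x y
  rw [le_div_iff₀ (by linarith)]
  have h2 : k * |⟪x, y⟫| * N ≤ k * (‖x‖ * ‖y‖) * N := by gcongr
  have h3 : 2 * (N * ‖y‖ * ‖x‖) ≤ ‖x‖ ^ 2 + N ^ 2 * ‖y‖ ^ 2 := by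
    nlinarith [sq_nonneg (‖x‖ - N * ‖y‖)]
  have h4 : N ^ 2 * ‖y‖ ^ 2 ≤ k * ‖y‖ ^ 2 := by gcongr
  have h5 : 0 ≤ N * ‖y‖ * ‖x‖ := by positivity
  nlinarith [mul_le_mul_of_nonneg_left (h3.trans (add_le_add_right h4 _)) hk0.le,
    mul_nonneg hk0.le h5]

lemma mul_le_abs_mul_of_abs_le {r t B : ℝ} (h : |t| ≤ B) : r * t ≤ |r| * B :=
  (le_abs_self _).trans ((abs_mul r t).le.trans (by gcongr))

lemma neg_mul_le_abs_mul_of_abs_le {r t B : ℝ} (h : |t| ≤ B) : -(r * t) ≤ |r| * B :=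
  (neg_le_abs _).trans ((abs_mul r t).le.trans (by gcongr))

set_option maxHeartbeats 2000000 in
lemma exists_ogdaEnergy_step_le {α c κ ν l : ℝ} (hc : 1 < c) (hl : l < α - 1)
    (hquad : (α / 2 + c - 1 - l) ^ 2 < 2 * (α - 1 - l) * (c - 1)) (hκ0 : 0 ≤ κ) (hκν : κ < ν)
    (hν : ν < 1 / 2) :
    ∃ K C δ : ℝ, 0 ≤ C ∧ 0 < δ ∧ ∀ k ≥ K, ∀ ζ Δ p D e ζ' Δ' p' D' e' : H,
      ζ = ζ' - Δ' → p = p' - D' →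
      k • Δ = (k + α) • Δ' + (k + α - c) • D' + c • p' →
      ‖e‖ ≤ κ * ‖D‖ → ‖e'‖ ≤ κ * ‖D'‖ → 0 ≤ ⟪(p' - e') - (p - e), Δ'⟫ →
      ogdaEnergy α c ν l (k + 1) ζ' Δ' p' D' e' ≤ ogdaEnergy α c ν l k ζ Δ p D e
        + C / k ^ 2 * ‖ζ‖ ^ 2 - 2 * l * (c - 1) * ⟪ζ', p' - e'⟫ - δ * (k ^ 2 * ‖D'‖ ^ 2) := by
  obtain ⟨δ₀, hδ₀, hform⟩ := exists_quadratic_form_lower_bound (H := H)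
    (a := 2 * (α - 1 - l)) (b := c - 1) (h := α / 2 + c - 1 - l) (by linarith) (by linarith) hquad
  obtain ⟨δ, hδ, hδ1, hδ2, hδ3⟩ : ∃ δ > 0, δ ≤ δ₀ ∧ δ ≤ 1 / 2 - ν / 2 - κ / 2 ∧ δ ≤ (ν - κ) / 2 :=
    ⟨min δ₀ (min (1 / 2 - ν / 2 - κ / 2) ((ν - κ) / 2)),
      lt_min hδ₀ (lt_min (by linarith) (by linarith)), min_le_left _ _,
      (min_le_right _ _).trans (min_le_left _ _), (min_le_right _ _).trans (min_le_right _ _)⟩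
  obtain ⟨M, hM⟩ : ∃ M, M = |2 * l * (c - 1)| + |2 * l * (c - 1)| + |ν| + |ν / 2|
      + |(α - 1 - l) * (α + 1)| + |3 * α - 2 * c| + |2 * (α - c) * α|
      + |(2 * c - 1) * (α - l) + (α - 1 - l) - 2 * l * (α - c)| + |c ^ 2 - 1 / 2| + |α|
      + |2 * c * (α - c)| + |α - c| + |(α - c) ^ 2| + |(2 : ℝ)| + |(1 : ℝ)| + |α| + |α - c|
      + |c| := ⟨_, rfl⟩
  have hM0 : 0 ≤ M := by rw [hM]; positivity
  obtain ⟨N, hN1, hNM⟩ : ∃ N : ℝ, 1 ≤ N ∧ 2 * M / δ ≤ N :=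
    ⟨max 1 (2 * M / δ), le_max_left _ _, le_max_right _ _⟩
  have hN0 : 0 < N := by linarith
  have hMN : M / N ≤ δ / 2 := by
    rw [div_le_iff₀ hδ] at hNM
    rw [div_le_iff₀ hN0]; linarith
  refine ⟨N ^ 2, |2 * l * (c - 1)| * N, δ / 2, by positivity, by positivity, ?_⟩
  intro k hk ζ Δ p D e ζ' Δ' p' D' e' hζ hp hΔ he he' hmono
  have hk' : N ^ 2 ≤ k := hk
  have hk1 : 1 ≤ k := by nlinarith
  have hNk : N ≤ k := by nlinarith
  have hk0 : 0 < k := by linarith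
  have heD : ‖e‖ ≤ ‖D‖ := he.trans (by nlinarith [norm_nonneg D])
  have heD' : ‖e'‖ ≤ ‖D'‖ := he'.trans (by nlinarith [norm_nonneg D'])
  obtain ⟨Q, hQ⟩ : ∃ Q, Q = k * ‖Δ'‖ ^ 2 + k * ‖p'‖ ^ 2 + k ^ 2 * ‖D'‖ ^ 2 + k ^ 2 * ‖D‖ ^ 2 :=
    ⟨_, rfl⟩
  have hA : 0 ≤ k * ‖Δ'‖ ^ 2 := by positivity
  have hB : 0 ≤ k * ‖p'‖ ^ 2 := by positivity
  have hd' : 0 ≤ k ^ 2 * ‖D'‖ ^ 2 := by positivity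
  have hd : 0 ≤ k ^ 2 * ‖D‖ ^ 2 := by positivity
  have he2 : k ^ 2 * ‖e‖ ^ 2 ≤ k ^ 2 * ‖D‖ ^ 2 := by gcongr
  have he2' : k ^ 2 * ‖e'‖ ^ 2 ≤ k ^ 2 * ‖D'‖ ^ 2 := by gcongr
  have drop : ∀ {t : ℝ}, |k * t| ≤ Q / N → |t| ≤ Q / N := fun {t} h => by
    rw [abs_mul, abs_of_pos hk0] at h
    nlinarith [abs_nonneg t]
  have pair : ∀ x y : H, k * ‖x‖ ^ 2 + k ^ 2 * ‖y‖ ^ 2 ≤ Q → |k * ⟪x, y⟫| ≤ Q / N := by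
    intro x y h
    rw [abs_mul, abs_of_pos hk0]
    exact (mul_abs_inner_le_of_sq_le hN1 hk' x y).trans (by gcongr)
  have kk : ∀ x : H, k * ‖x‖ ^ 2 ≤ k ^ 2 * ‖x‖ ^ 2 := fun x => by gcongr; nlinarith
  have single : ∀ x : H, k * ‖x‖ ^ 2 ≤ Q → |‖x‖ ^ 2| ≤ Q / N := by
    intro x h
    rw [abs_of_nonneg (by positivity), le_div_iff₀ hN0]
    nlinarith [sq_nonneg ‖x‖]
  have tΔΔ : |‖Δ'‖ ^ 2| ≤ Q / N := single _ (by linarith)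
  have tpp : |‖p'‖ ^ 2| ≤ Q / N := single _ (by linarith)
  have tΔp : |⟪Δ', p'⟫| ≤ Q / N := by
    refine (abs_real_inner_le_norm _ _).trans ?_
    rw [le_div_iff₀ hN0]
    nlinarith [sq_nonneg (‖Δ'‖ - ‖p'‖), norm_nonneg Δ', norm_nonneg p',
      mul_nonneg (norm_nonneg Δ') (norm_nonneg p')]
  have tΔD := pair Δ' D' (by linarith)
  have tDp : |k * ⟪D', p'⟫| ≤ Q / N := by
    rw [real_inner_comm]; exact pair p' D' (by linarith)
  have tDD : |k * ‖D'‖ ^ 2| ≤ Q / N := by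
    rw [abs_of_nonneg (by positivity), le_div_iff₀ hN0]
    nlinarith [sq_nonneg ‖D'‖, mul_nonneg hk0.le (sq_nonneg ‖D'‖)]
  have tΔe' := pair Δ' e' (by linarith)
  have tΔe := pair Δ' e (by linarith)
  have tDe := pair D' e (by linarith [kk D'])
  have tpe := pair p' e (by linarith)
  have hζe : -(2 * l * (c - 1) * ⟪ζ, e'⟫)
      ≤ |2 * l * (c - 1)| * (Q / N) + |2 * l * (c - 1)| * N / k ^ 2 * ‖ζ‖ ^ 2 := by
    have h1 : |⟪ζ, e'⟫| ≤ Q / N + N / k ^ 2 * ‖ζ‖ ^ 2 := by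
      have h2 : |⟪ζ, e'⟫| ≤ ‖ζ‖ * ‖D'‖ := (abs_real_inner_le_norm _ _).trans (by gcongr)
      have h3 : ‖ζ‖ * ‖D'‖ ≤ k ^ 2 * ‖D'‖ ^ 2 / N + N / k ^ 2 * ‖ζ‖ ^ 2 := by
        have h4 : k ^ 2 * ‖D'‖ ^ 2 / N + N / k ^ 2 * ‖ζ‖ ^ 2 - ‖ζ‖ * ‖D'‖
            = ((k ^ 2 * ‖D'‖ - N * ‖ζ‖) ^ 2 + k ^ 2 * N * ‖ζ‖ * ‖D'‖) / (k ^ 2 * N) := by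
          field_simp; ring
        have h5 : 0 ≤ ((k ^ 2 * ‖D'‖ - N * ‖ζ‖) ^ 2 + k ^ 2 * N * ‖ζ‖ * ‖D'‖) / (k ^ 2 * N) := by
          positivity
        linarith
      have h6 : k ^ 2 * ‖D'‖ ^ 2 / N ≤ Q / N := by gcongr; linarith
      linarith
    calc _ ≤ |2 * l * (c - 1)| * (Q / N + N / k ^ 2 * ‖ζ‖ ^ 2) := neg_mul_le_abs_mul_of_abs_le h1
      _ = _ := by ring
  have hDe : -(k ^ 2 * ⟪D', e⟫) ≤ κ / 2 * (k ^ 2 * ‖D'‖ ^ 2) + κ / 2 * (k ^ 2 * ‖D‖ ^ 2) := by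
    have h1 : -⟪D', e⟫ ≤ κ / 2 * ‖D'‖ ^ 2 + κ / 2 * ‖D‖ ^ 2 := by
      have h2 : |⟪D', e⟫| ≤ ‖D'‖ * (κ * ‖D‖) := (abs_real_inner_le_norm _ _).trans (by gcongr)
      nlinarith [neg_le_abs ⟪D', e⟫, mul_nonneg hκ0 (sq_nonneg (‖D'‖ - ‖D‖))]
    nlinarith [sq_nonneg k]
  have hquad' := mul_le_mul_of_nonneg_left (hform Δ' p') hk0.le
  have hmono' : 0 ≤ k ^ 2 * ⟪(p' - e') - (p - e), Δ'⟫ := by positivity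
  have e1 := neg_mul_le_abs_mul_of_abs_le (r := 2 * l * (c - 1)) (drop tΔe')
  have e2 := mul_le_abs_mul_of_abs_le (r := ν) tDD
  have e3 := mul_le_abs_mul_of_abs_le (r := ν / 2) (drop tDD)
  have e4 := neg_mul_le_abs_mul_of_abs_le (r := (α - 1 - l) * (α + 1)) tΔΔ
  have e5 := neg_mul_le_abs_mul_of_abs_le (r := 3 * α - 2 * c) tΔD
  have e6 := neg_mul_le_abs_mul_of_abs_le (r := 2 * (α - c) * α) (drop tΔD)
  have e7 := neg_mul_le_abs_mul_of_abs_le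
    (r := (2 * c - 1) * (α - l) + (α - 1 - l) - 2 * l * (α - c)) tΔp
  have e8 := neg_mul_le_abs_mul_of_abs_le (r := c ^ 2 - 1 / 2) tpp
  have e9 := neg_mul_le_abs_mul_of_abs_le (r := α) tDp
  have e10 := neg_mul_le_abs_mul_of_abs_le (r := 2 * c * (α - c)) (drop tDp)
  have e11 := neg_mul_le_abs_mul_of_abs_le (r := α - c) tDD
  have e12 := neg_mul_le_abs_mul_of_abs_le (r := (α - c) ^ 2) (drop tDD)
  have e13 := mul_le_abs_mul_of_abs_le (r := 2) tΔe'
  have e14 := mul_le_abs_mul_of_abs_le (r := 1) (drop tΔe')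
  have e15 := neg_mul_le_abs_mul_of_abs_le (r := α) tΔe
  have e16 := neg_mul_le_abs_mul_of_abs_le (r := α - c) tDe
  have e17 := neg_mul_le_abs_mul_of_abs_le (r := c) tpe
  have hsum : M * (Q / N) ≤ δ / 2 * Q := by
    have hQ0 : 0 ≤ Q := by linarith
    calc M * (Q / N) = M / N * Q := by ring
      _ ≤ δ / 2 * Q := by gcongr
  have f1 := mul_le_mul_of_nonneg_right hδ1 hA
  have f2 := mul_le_mul_of_nonneg_right hδ1 hB
  have f3 := mul_le_mul_of_nonneg_right hδ2 hd'
  have f4 := mul_le_mul_of_nonneg_right hδ3 hd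
  have f5 := mul_nonneg hδ.le hA
  have f6 := mul_nonneg hδ.le hB
  have f7 := mul_nonneg hδ.le hd
  have heq := ogdaEnergy_step_eq (ν := ν) (l := l) (D := D) (e := e) (e' := e') hζ hp hΔ
  rw [hM] at hsum
  rw [hQ] at hsum
  rw [hQ] at hζe e1 e2 e3 e4 e5 e6 e7 e8 e9 e10 e11 e12 e13 e14 e15 e16 e17
  linarith

lemma exists_ogdaEnergy_lower_bound {α c κ ν l : ℝ} (hcα : c < α) (hl0 : 0 < l) (hl : l < α - 1)
    (hκ0 : 0 ≤ κ) (hκν : κ < ν) (hν : ν < 1 / 2) :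
    ∃ K δ : ℝ, 0 < δ ∧ ∀ k ≥ K, ∀ ζ Δ p D e : H, ‖e‖ ≤ κ * ‖D‖ → 0 ≤ ⟪ζ, p - e⟫ →
      δ * ‖ζ‖ ^ 2 + ‖l • ζ + k • Δ‖ ^ 2 / 4 + ‖l • ζ + k • Δ + k • p‖ ^ 2 / 2
        ≤ ogdaEnergy α c ν l k ζ Δ p D e := by
  obtain ⟨μ, hμ⟩ : ∃ μ, μ = ν / 2 - κ ^ 2 := ⟨_, rfl⟩
  have hμ0 : 0 < μ := by nlinarith
  obtain ⟨η, hη⟩ : ∃ η, η = l * (α - 1 - l) := ⟨_, rfl⟩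
  have hη0 : 0 < η := by rw [hη]; exact mul_pos hl0 (by linarith)
  obtain ⟨N, hN0, hNη, hNμ⟩ : ∃ N : ℝ, 0 < N ∧ l * (α - c) / N ≤ η / 2 ∧ l * (α - c) / N ≤ μ := by
    have hlc : 0 < l * (α - c) := mul_pos hl0 (by linarith)
    refine ⟨max (l * (α - c) / (η / 2)) (l * (α - c) / μ), lt_max_of_lt_right (by positivity),
      ?_, ?_⟩
    · rw [div_le_comm₀ (lt_max_of_lt_right (by positivity)) (by positivity)]
      exact le_max_left _ _
    · rw [div_le_comm₀ (lt_max_of_lt_right (by positivity)) (by positivity)]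
      exact le_max_right _ _
  refine ⟨N, η / 2, by positivity, fun k hk ζ Δ p D e he hmono => ?_⟩
  have hk0 : 0 < k := lt_of_lt_of_le hN0 hk
  have hlc : 0 < l * (α - c) := mul_pos hl0 (by linarith)
  have hkη : l * (α - c) / k ≤ η / 2 := le_trans (by gcongr) hNη
  have hkμ : l * (α - c) / k ≤ μ := le_trans (by gcongr) hNμ
  have heD : ‖e‖ ^ 2 ≤ κ ^ 2 * ‖D‖ ^ 2 := by
    rw [← mul_pow]; gcongr
  have heD1 : ‖e‖ ^ 2 ≤ ‖D‖ ^ 2 := heD.trans (by nlinarith [sq_nonneg ‖D‖])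
  have hcross : -(2 * l * (α - c) * ⟪ζ, e⟫) ≤ η / 2 * ‖ζ‖ ^ 2 + μ * (k ^ 2 * ‖D‖ ^ 2) := by
    have h1 := abs_real_inner_le_norm ζ e
    have h2 : -(2 * ⟪ζ, e⟫) ≤ (‖ζ‖ ^ 2 + k ^ 2 * ‖e‖ ^ 2) / k := by
      rw [le_div_iff₀ hk0]
      nlinarith [neg_le_abs ⟪ζ, e⟫, sq_nonneg (‖ζ‖ - k * ‖e‖)]
    calc _ = l * (α - c) * (-(2 * ⟪ζ, e⟫)) := by ring
      _ ≤ l * (α - c) * ((‖ζ‖ ^ 2 + k ^ 2 * ‖e‖ ^ 2) / k) := by gcongr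
      _ = l * (α - c) / k * ‖ζ‖ ^ 2 + l * (α - c) / k * (k ^ 2 * ‖e‖ ^ 2) := by ring
      _ ≤ _ := by gcongr
  have hpe : 0 ≤ l * (k + 2 * (α - c)) * ⟪ζ, p - e⟫ :=
    mul_nonneg (mul_nonneg hl0.le (by linarith)) hmono
  have hsq : 0 ≤ ‖(1 / 2 : ℝ) • (l • ζ + k • Δ) + k • e‖ ^ 2 := by positivity
  have heDk : k ^ 2 * ‖e‖ ^ 2 ≤ k ^ 2 * (κ ^ 2 * ‖D‖ ^ 2) := by gcongr
  rw [ogdaEnergy, ← hη]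
  simp only [← real_inner_self_eq_norm_sq, inner_add_left, inner_add_right, inner_sub_right,
    real_inner_smul_left, real_inner_smul_right, real_inner_comm ζ Δ, real_inner_comm ζ p,
    real_inner_comm Δ p, real_inner_comm ζ e, real_inner_comm Δ e] at *
  have hν2 : ν / 2 = μ + κ ^ 2 := by linarith
  rw [hν2]
  linarith

end Energy

section Sequences

lemma tendsto_and_summable_of_le_one_add_mul_sub {a b ε : ℕ → ℝ} (ha : ∀ n, 0 ≤ a n)
    (hb : ∀ n, 0 ≤ b n) (hε : ∀ n, 0 ≤ ε n) (hsum : Summable ε)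
    (h : ∀ n, a (n + 1) ≤ (1 + ε n) * a n - b n) :
    (∃ l, Tendsto a atTop (nhds l)) ∧ Summable b := by
  obtain ⟨T, hT⟩ : ∃ T : ℕ → ℝ, T = fun n => Real.exp (-∑ i ∈ Finset.range n, ε i) := ⟨_, rfl⟩
  have hT0 : ∀ n, 0 < T n := fun n => by rw [hT]; exact Real.exp_pos _
  have hTs : ∀ n, T (n + 1) * (1 + ε n) ≤ T n := fun n => by
    have h1 : T n = T (n + 1) * Real.exp (ε n) := by
      simp only [hT, ← Real.exp_add, Finset.sum_range_succ]
      congr 1; ring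
    rw [h1]
    exact mul_le_mul_of_nonneg_left (by linarith [Real.add_one_le_exp (ε n)]) (hT0 _).le
  have hTlim : Tendsto T atTop (nhds (Real.exp (-∑' i, ε i))) := by
    rw [hT]
    exact (Real.continuous_exp.tendsto _).comp hsum.hasSum.tendsto_sum_nat.neg
  have hTlow : ∀ n, Real.exp (-∑' i, ε i) ≤ T n := fun n => by
    rw [hT]
    exact Real.exp_le_exp.2 (neg_le_neg (hsum.sum_le_tsum _ fun i _ => hε i))
  have hstep : ∀ n, T (n + 1) * a (n + 1) + Real.exp (-∑' i, ε i) * b n ≤ T n * a n := fun n => by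
    have h1 := mul_le_mul_of_nonneg_left (h n) (hT0 (n + 1)).le
    have h2 := mul_le_mul_of_nonneg_right (hTs n) (ha n)
    have h3 := mul_le_mul_of_nonneg_right (hTlow (n + 1)) (hb n)
    linarith
  have hE := Real.exp_pos (-∑' i, ε i)
  constructor
  · have hanti : Antitone fun n => T n * a n := antitone_nat_of_succ_le fun n => by
      have := hstep n
      have := mul_nonneg hE.le (hb n)
      linarith
    have hbdd : BddBelow (Set.range fun n => T n * a n) := by
      refine ⟨0, ?_⟩
      rintro _ ⟨n, rfl⟩
      exact mul_nonneg (hT0 n).le (ha n)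
    have hlim := (tendsto_atTop_ciInf hanti hbdd).div hTlim hE.ne'
    refine ⟨_, hlim.congr fun n => ?_⟩
    have := (hT0 n).ne'
    simp only [Pi.div_apply]
    field_simp
  · have hpart : ∀ n, T n * a n + Real.exp (-∑' i, ε i) * ∑ i ∈ Finset.range n, b i
        ≤ T 0 * a 0 := fun n => by
      induction n with
      | zero => simp
      | succ n ih =>
        rw [Finset.sum_range_succ]
        linarith [hstep n]
    refine summable_of_sum_range_le (c := T 0 * a 0 / Real.exp (-∑' i, ε i)) hb fun n => ?_
    rw [le_div_iff₀ hE]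
    linarith [hpart n, mul_nonneg (hT0 n).le (ha n)]

lemma tendsto_zero_of_mul_le_add {a ε : ℕ → ℝ} {r : ℝ} (hr : 0 < r) (ha : ∀ n, 0 ≤ a n)
    (hε : Tendsto ε atTop (nhds 0))
    (h : ∀ᶠ n : ℕ in atTop, (r + (n + 1)) * a (n + 1) ≤ (n + 1) * a n + ε (n + 1)) :
    Tendsto a atTop (nhds 0) := by
  refine tendsto_order.2 ⟨fun x hx => Eventually.of_forall fun n => hx.trans_le (ha n), ?_⟩
  intro x hx
  have hεx := (tendsto_order.1 hε).2 (r * (x / 2)) (by positivity)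
  obtain ⟨K, hK⟩ := eventually_atTop.1 (h.and ((tendsto_add_atTop_nat 1).eventually hεx))
  obtain ⟨ψ, hψ⟩ : ∃ ψ : ℕ → ℝ, ψ = fun n => max (a n - x / 2) 0 := ⟨_, rfl⟩
  have hψ0 : ∀ n, 0 ≤ ψ n := fun n => by rw [hψ]; exact le_max_right _ _
  have hψa : ∀ n, a n ≤ ψ n + x / 2 := fun n => by
    rw [hψ]; linarith [le_max_left (a n - x / 2) 0]
  have hstep : ∀ n ≥ K, (r + (n + 1)) * ψ (n + 1) ≤ (n + 1) * ψ n := fun n hn => by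
    obtain ⟨h1, h2⟩ := hK n hn
    have hn1 : (0 : ℝ) ≤ (n : ℝ) + 1 := by positivity
    have h3 := mul_le_mul_of_nonneg_left (hψa n) hn1
    rcases le_total (a (n + 1) - x / 2) 0 with h4 | h4
    · have : ψ (n + 1) = 0 := by rw [hψ]; exact max_eq_right h4
      rw [this]
      have := mul_nonneg hn1 (hψ0 n)
      linarith
    · have : ψ (n + 1) = a (n + 1) - x / 2 := by rw [hψ]; exact max_eq_left h4
      rw [this]
      linarith
  have hanti : Antitone fun n => ψ (n + K) := antitone_nat_of_succ_le fun n => by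
    have h1 := hstep (n + K) (by omega)
    rw [show n + 1 + K = n + K + 1 by ring]
    have h2 : (0 : ℝ) < ((n + K : ℕ) : ℝ) + 1 := by positivity
    have h3 := mul_nonneg hr.le (hψ0 (n + K + 1))
    exact le_of_mul_le_mul_left (by linarith) h2
  by_contra hcon
  have hlow : ∀ n, x / 2 ≤ ψ (n + K) := fun n => by
    by_contra! hlt
    refine hcon (eventually_atTop.2 ⟨n + K, fun m hm => ?_⟩)
    have h1 : ψ (m - K + K) ≤ ψ (n + K) := hanti (by omega)
    rw [Nat.sub_add_cancel (by omega)] at h1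
    linarith [hψa m]
  have hdec : ∀ n, r * (x / 2) * ∑ i ∈ Finset.range n, (((i + K : ℕ) : ℝ) + 1)⁻¹ ≤ ψ K := by
    have haux : ∀ n, ψ (n + K) + r * (x / 2) * ∑ i ∈ Finset.range n, (((i + K : ℕ) : ℝ) + 1)⁻¹
        ≤ ψ K := fun n => by
      induction n with
      | zero => simp
      | succ n ih =>
        rw [Finset.sum_range_succ, show n + 1 + K = n + K + 1 by ring]
        have h1 := hstep (n + K) (by omega)
        have h2 : (0 : ℝ) < ((n + K : ℕ) : ℝ) + 1 := by positivity
        have h3 := hlow (n + 1)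
        rw [show n + 1 + K = n + K + 1 by ring] at h3
        have h4 : r * (x / 2) * (((n + K : ℕ) : ℝ) + 1)⁻¹ ≤ ψ (n + K) - ψ (n + K + 1) := by
          rw [← div_eq_mul_inv, div_le_iff₀ h2]
          have := mul_le_mul_of_nonneg_left h3 hr.le
          linarith
        linarith
    exact fun n => by linarith [haux n, hψ0 (n + K)]
  have hs : Summable fun i : ℕ => (((i + K : ℕ) : ℝ) + 1)⁻¹ := by
    refine summable_of_sum_range_le (c := ψ K / (r * (x / 2))) (fun i => by positivity)
      fun n => ?_
    rw [le_div_iff₀ (by positivity)]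
    linarith [hdec n]
  refine Real.not_summable_natCast_inv ((summable_nat_add_iff (K + 1)).1 (hs.congr fun i => ?_))
  push_cast
  ring

lemma tendsto_of_mul_add_mul_sub {a : ℕ → ℝ} {r l : ℝ} (hr : 0 < r)
    (h : Tendsto (fun n : ℕ => r * a (n + 1) + (n + 1) * (a (n + 1) - a n)) atTop (nhds l)) :
    Tendsto a atTop (nhds (l / r)) := by
  rw [tendsto_iff_norm_sub_tendsto_zero]
  obtain ⟨ε, hε⟩ : ∃ ε : ℕ → ℝ,
      ε = fun n => |r * a n + n * (a n - a (n - 1)) - l| := ⟨_, rfl⟩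
  have hε0 : Tendsto ε atTop (nhds 0) := by
    rw [← tendsto_add_atTop_iff_nat 1, hε]
    have := (tendsto_iff_norm_sub_tendsto_zero.1 h)
    simpa using this
  refine tendsto_zero_of_mul_le_add hr (fun n => norm_nonneg _) hε0 (Eventually.of_forall fun n => ?_)
  have hn1 : (0 : ℝ) ≤ (n : ℝ) + 1 := by positivity
  have hn2 : (0 : ℝ) ≤ r + ((n : ℝ) + 1) := by positivity
  simp only [hε, Real.norm_eq_abs, Nat.add_sub_cancel, Nat.cast_add, Nat.cast_one]
  rw [← abs_of_nonneg hn2, ← abs_mul,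
    show ((n : ℝ) + 1) * |a n - l / r| = |((n : ℝ) + 1) * (a n - l / r)| by
      rw [abs_mul, abs_of_nonneg hn1]]
  refine le_trans (le_of_eq ?_) (abs_add_le _ _)
  congr 1
  field_simp
  ring

end Sequences

section Convergence

variable {H : Type*} [NormedAddCommGroup H] [InnerProductSpace ℝ H]

lemma ogdaEnergy_convergence {α c κ ν l : ℝ} (hc : 1 < c) (hcα : c < α) (hl0 : 0 < l)
    (hl : l < α - 1) (hquad : (α / 2 + c - 1 - l) ^ 2 < 2 * (α - 1 - l) * (c - 1)) (hκ0 : 0 ≤ κ)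
    (hκν : κ < ν) (hν : ν < 1 / 2) {z p P : ℕ → H} {s : H}
    (hrec : ∀ k : ℕ, 1 ≤ k → ((k : ℝ) + α) • (z (k + 1) - z k + p (k + 1))
      = (k : ℝ) • (z k - z (k - 1)) + ((k : ℝ) + α - c) • p k)
    (herr : ∀ k : ℕ, 1 ≤ k → ‖p (k + 1) - P (k + 1)‖ ≤ κ * ‖p (k + 1) - p k‖)
    (hmono : ∀ k : ℕ, 1 ≤ k → 0 ≤ ⟪P (k + 1) - P k, z (k + 1) - z k⟫)
    (hs : ∀ k : ℕ, 1 ≤ k → 0 ≤ ⟪z k - s, P k⟫) :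
    (∃ G, Tendsto (fun k : ℕ => ogdaEnergy α c ν l k (z k - s) (z k - z (k - 1)) (p k)
        (p k - p (k - 1)) (p k - P k)) atTop (nhds G)) ∧
      (Summable fun k : ℕ => ⟪z k - s, P k⟫) ∧
      (Summable fun k : ℕ => (k : ℝ) ^ 2 * ‖p k - p (k - 1)‖ ^ 2) ∧
      ∃ B : ℝ, ∀ᶠ k : ℕ in atTop, ‖z k - s‖ ≤ B ∧ k * ‖z k - z (k - 1)‖ ≤ B ∧ k * ‖p k‖ ≤ B := by
  obtain ⟨K₁, C, δ₁, hC, hδ₁, hstep⟩ :=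
    exists_ogdaEnergy_step_le (H := H) hc hl hquad hκ0 hκν hν
  obtain ⟨K₂, δ₂, hδ₂, hlow⟩ := exists_ogdaEnergy_lower_bound (H := H) hcα hl0 hl hκ0 hκν hν
  obtain ⟨K, hK⟩ := exists_nat_ge (max (max K₁ K₂) 2)
  have hK2 : 2 ≤ K := by exact_mod_cast (le_max_right _ _).trans hK
  have hKK₁ : K₁ ≤ K := (le_max_left _ _).trans ((le_max_left _ _).trans hK)
  have hKK₂ : K₂ ≤ K := (le_max_right _ _).trans ((le_max_left _ _).trans hK)
  obtain ⟨G, hG⟩ : ∃ G : ℕ → ℝ, G = fun k : ℕ => ogdaEnergy α c ν l k (z k - s)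
    (z k - z (k - 1)) (p k) (p k - p (k - 1)) (p k - P k) := ⟨_, rfl⟩
  have herr' : ∀ k : ℕ, 2 ≤ k → ‖p k - P k‖ ≤ κ * ‖p k - p (k - 1)‖ := fun k hk => by
    have := herr (k - 1) (by omega)
    rwa [Nat.sub_add_cancel (by omega)] at this
  have hGlow : ∀ k : ℕ, K ≤ k → δ₂ * ‖z k - s‖ ^ 2 + ‖l • (z k - s) + (k : ℝ) • (z k - z (k - 1))‖ ^ 2 / 4
      + ‖l • (z k - s) + (k : ℝ) • (z k - z (k - 1)) + (k : ℝ) • p k‖ ^ 2 / 2 ≤ G k := fun k hk => by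
    rw [hG]
    refine hlow k (hKK₂.trans (by exact_mod_cast hk)) _ _ _ _ _ (herr' k (by omega)) ?_
    rw [sub_sub_cancel]
    exact hs k (by omega)
  obtain ⟨b, hb⟩ : ∃ b : ℕ → ℝ, b = fun k : ℕ => 2 * l * (c - 1) * ⟪z (k + 1) - s, P (k + 1)⟫
    + δ₁ * ((k : ℝ) ^ 2 * ‖p (k + 1) - p k‖ ^ 2) := ⟨_, rfl⟩
  have hlc : 0 < 2 * l * (c - 1) := mul_pos (by positivity) (by linarith)
  have hGstep : ∀ k : ℕ, K ≤ k → G (k + 1) ≤ (1 + C / δ₂ / (k : ℝ) ^ 2) * G k - b k := fun k hk => by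
    have h1 := hstep k (hKK₁.trans (by exact_mod_cast hk)) (z k - s) (z k - z (k - 1)) (p k)
      (p k - p (k - 1)) (p k - P k) (z (k + 1) - s) (z (k + 1) - z k) (p (k + 1))
      (p (k + 1) - p k) (p (k + 1) - P (k + 1)) (by abel) (by abel) ?_ (herr' k (by omega))
      (herr k (by omega)) ?_
    · rw [sub_sub_cancel] at h1
      have h2 : δ₂ * ‖z k - s‖ ^ 2 ≤ G k := le_trans (by
        rw [add_assoc]; exact le_add_of_nonneg_right (by positivity)) (hGlow k hk)
      have h3 : C / (k : ℝ) ^ 2 * ‖z k - s‖ ^ 2 ≤ C / δ₂ / (k : ℝ) ^ 2 * G k := by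
        calc _ = C / δ₂ / (k : ℝ) ^ 2 * (δ₂ * ‖z k - s‖ ^ 2) := by field_simp
          _ ≤ _ := by gcongr
      simp only [hG, hb, Nat.cast_add, Nat.cast_one, Nat.add_sub_cancel] at *
      linarith
    · have h2 : (k : ℝ) • (z k - z (k - 1))
          = ((k : ℝ) + α) • (z (k + 1) - z k + p (k + 1)) - ((k : ℝ) + α - c) • p k := by
        rw [hrec k (by omega)]; abel
      rw [h2]
      module
    · simpa using hmono k (by omega)
  have hb0 : ∀ k : ℕ, 0 ≤ b k := fun k => by
    rw [hb]
    exact add_nonneg (mul_nonneg hlc.le (hs _ (by omega))) (by positivity)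
  have hG0 : ∀ k : ℕ, K ≤ k → 0 ≤ G k := fun k hk => le_trans (by positivity) (hGlow k hk)
  have hε : Summable fun n : ℕ => C / δ₂ / ((n + K : ℕ) : ℝ) ^ 2 := by
    refine (summable_nat_add_iff (f := fun n : ℕ => C / δ₂ / (n : ℝ) ^ 2) K).2 ?_
    simp only [div_eq_mul_inv]
    exact (Real.summable_nat_pow_inv.2 one_lt_two).mul_left _
  obtain ⟨⟨Glim, hGlim⟩, hbsum⟩ := tendsto_and_summable_of_le_one_add_mul_sub
    (a := fun n => G (n + K)) (b := fun n => b (n + K))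
    (ε := fun n : ℕ => C / δ₂ / ((n + K : ℕ) : ℝ) ^ 2)
    (fun n => hG0 _ (by omega)) (fun n => hb0 _) (fun n => by positivity) hε (fun n => by
      rw [show n + 1 + K = n + K + 1 by ring]
      exact hGstep (n + K) (by omega))
  have hGlim' : Tendsto G atTop (nhds Glim) := (tendsto_add_atTop_iff_nat K).1 hGlim
  refine ⟨⟨Glim, hG ▸ hGlim'⟩, ?_, ?_, ?_⟩
  · refine (summable_nat_add_iff (K + 1)).1 (Summable.of_nonneg_of_le
      (fun n => hs _ (by omega)) (fun n => ?_) (hbsum.mul_left (2 * l * (c - 1))⁻¹))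
    rw [le_inv_mul_iff₀ hlc, hb]
    exact le_add_of_nonneg_right (by positivity)
  · refine (summable_nat_add_iff (K + 1)).1 (Summable.of_nonneg_of_le
      (fun n => by positivity) (fun n => ?_) (hbsum.mul_left (4 / δ₁)))
    rw [div_mul_eq_mul_div, le_div_iff₀ hδ₁, ← add_assoc]
    have h1 : (1 : ℝ) ≤ ((n + K : ℕ) : ℝ) := by exact_mod_cast (by omega : 1 ≤ n + K)
    have h2 : (((n + K + 1 : ℕ) : ℝ)) ^ 2 ≤ 4 * ((n + K : ℕ) : ℝ) ^ 2 := by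
      rw [Nat.cast_succ]; nlinarith
    have h3 := mul_nonneg hlc.le (hs (n + K + 1) (by omega))
    have h4 := mul_le_mul_of_nonneg_right h2
      (mul_nonneg hδ₁.le (sq_nonneg ‖p (n + K + 1) - p (n + K)‖))
    rw [hb]
    simp only [Nat.add_sub_cancel]
    linarith
  · obtain ⟨R, hR⟩ := hGlim'.bddAbove_range
    have hR0 : ∀ k, G k ≤ R := fun k => hR ⟨k, rfl⟩
    obtain ⟨A, hA⟩ : ∃ A, A = max (√(R / δ₂)) (max √(4 * R) √(2 * R)) := ⟨_, rfl⟩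
    have hA0 : 0 ≤ A := by rw [hA]; exact le_max_of_le_left (Real.sqrt_nonneg _)
    refine ⟨(2 + l) * A, eventually_atTop.2 ⟨K, fun k hk => ?_⟩⟩
    have h := (hGlow k hk).trans (hR0 k)
    have n1 : 0 ≤ δ₂ * ‖z k - s‖ ^ 2 := by positivity
    have n2 := sq_nonneg ‖l • (z k - s) + (k : ℝ) • (z k - z (k - 1))‖
    have n3 := sq_nonneg ‖l • (z k - s) + (k : ℝ) • (z k - z (k - 1)) + (k : ℝ) • p k‖
    have h1 : ‖z k - s‖ ≤ A := by
      rw [hA]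
      refine le_max_of_le_left (Real.le_sqrt_of_sq_le ?_)
      rw [le_div_iff₀ hδ₂]; linarith
    have h2 : ‖l • (z k - s) + (k : ℝ) • (z k - z (k - 1))‖ ≤ A := by
      rw [hA]
      exact le_max_of_le_right (le_max_of_le_left (Real.le_sqrt_of_sq_le (by linarith)))
    have h3 : ‖l • (z k - s) + (k : ℝ) • (z k - z (k - 1)) + (k : ℝ) • p k‖ ≤ A := by
      rw [hA]
      exact le_max_of_le_right (le_max_of_le_right (Real.le_sqrt_of_sq_le (by linarith)))
    refine ⟨by nlinarith, ?_, ?_⟩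
    · have h4 := norm_sub_le (l • (z k - s) + (k : ℝ) • (z k - z (k - 1))) (l • (z k - s))
      rw [add_sub_cancel_left, norm_smul, norm_smul, Real.norm_natCast,
        Real.norm_of_nonneg hl0.le] at h4
      nlinarith
    · have h4 := norm_sub_le (l • (z k - s) + (k : ℝ) • (z k - z (k - 1)) + (k : ℝ) • p k)
        (l • (z k - s) + (k : ℝ) • (z k - z (k - 1)))
      rw [add_sub_cancel_left, norm_smul, Real.norm_natCast] at h4
      nlinarith

theorem ogda_dist_tendsto {α c κ : ℝ} (hc : 1 < c) (hcα : c < α - 1) (hκ0 : 0 ≤ κ)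
    (hκ : κ < 1 / 2) {z p P : ℕ → H} {s : H}
    (hrec : ∀ k : ℕ, 1 ≤ k → ((k : ℝ) + α) • (z (k + 1) - z k + p (k + 1))
      = (k : ℝ) • (z k - z (k - 1)) + ((k : ℝ) + α - c) • p k)
    (herr : ∀ k : ℕ, 1 ≤ k → ‖p (k + 1) - P (k + 1)‖ ≤ κ * ‖p (k + 1) - p k‖)
    (hmono : ∀ k : ℕ, 1 ≤ k → 0 ≤ ⟪P (k + 1) - P k, z (k + 1) - z k⟫)
    (hs : ∀ k : ℕ, 1 ≤ k → 0 ≤ ⟪z k - s, P k⟫) :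
    (∃ d, Tendsto (fun k => ‖z k - s‖ ^ 2) atTop (nhds d)) ∧ Tendsto P atTop (nhds 0) := by
  obtain ⟨ν, hκν, hν⟩ := exists_between hκ
  obtain ⟨τ, hτ0, hτ⟩ : ∃ τ : ℝ, 0 < τ ∧ τ ^ 2 < (c - 1) * (α - 1 - c) := by
    have : 0 < (c - 1) * (α - 1 - c) := mul_pos (by linarith) (by linarith)
    refine ⟨√((c - 1) * (α - 1 - c)) / 2, by positivity, ?_⟩
    rw [div_pow, Real.sq_sqrt this.le]; linarith
  have hτs : τ < (α - 2) / 2 := by nlinarith [sq_nonneg (α - 2 * c)]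
  obtain ⟨⟨G₁, hG₁⟩, hσP, hD, B, hB⟩ := ogdaEnergy_convergence (ν := ν) (l := α / 2) hc
    (by linarith) (by linarith) (by linarith) (by nlinarith) hκ0 hκν hν hrec herr hmono hs
  obtain ⟨⟨G₂, hG₂⟩, -⟩ := ogdaEnergy_convergence (ν := ν) (l := α / 2 + τ) hc
    (by linarith) (by linarith) (by linarith) (by nlinarith) hκ0 hκν hν hrec herr hmono hs
  have herr' : ∀ k : ℕ, 2 ≤ k → ‖p k - P k‖ ≤ κ * ‖p k - p (k - 1)‖ := fun k hk => by
    have := herr (k - 1) (by omega)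
    rwa [Nat.sub_add_cancel (by omega)] at this
  have hinv : Tendsto (fun k : ℕ => B * (k : ℝ)⁻¹) atTop (nhds 0) := by
    simpa using (tendsto_inv_atTop_nhds_zero_nat (𝕜 := ℝ)).const_mul B
  have hinv2 : Tendsto (fun k : ℕ => B ^ 2 * (k : ℝ)⁻¹) atTop (nhds 0) := by
    simpa using (tendsto_inv_atTop_nhds_zero_nat (𝕜 := ℝ)).const_mul (B ^ 2)
  have hp0 : Tendsto p atTop (nhds 0) := by
    refine squeeze_zero_norm' ?_ hinv
    filter_upwards [hB, eventually_ge_atTop 1] with k hk hk1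
    have : (0 : ℝ) < k := by exact_mod_cast hk1
    rw [← div_eq_mul_inv, le_div_iff₀ this]; linarith [hk.2.2]
  have hp0' : Tendsto (fun k => p (k - 1)) atTop (nhds 0) :=
    hp0.comp (tendsto_sub_atTop_nat 1)
  have he0 : Tendsto (fun k => p k - P k) atTop (nhds 0) := by
    refine squeeze_zero_norm' (a := fun k => κ * ‖p k - p (k - 1)‖)
      ((eventually_ge_atTop 2).mono herr') ?_
    simpa using ((hp0.sub hp0').norm.const_mul κ)
  refine ⟨?_, by simpa using hp0.sub he0⟩
  have hσ : Summable fun k : ℕ => ⟪z k - s, p k⟫ := by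
    have hmaj : Summable fun k : ℕ => ⟪z k - s, P k⟫
        + (B * ((k : ℝ) ^ 2)⁻¹ + B * ((k : ℝ) ^ 2 * ‖p k - p (k - 1)‖ ^ 2)) :=
      hσP.add (((Real.summable_nat_pow_inv.2 one_lt_two).mul_left B).add (hD.mul_left B))
    refine hmaj.of_norm_bounded_eventually_nat ?_
    filter_upwards [hB, eventually_ge_atTop 2] with k hk hk2
    have hk0 : (0 : ℝ) < k := by exact_mod_cast (by omega : 0 < k)
    have h1 : ⟪z k - s, p k⟫ = ⟪z k - s, P k⟫ + ⟪z k - s, p k - P k⟫ := by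
      rw [← inner_add_right]; congr 1; abel
    have h2 : ‖p k - P k‖ ≤ ‖p k - p (k - 1)‖ :=
      (herr' k hk2).trans (by nlinarith [norm_nonneg (p k - p (k - 1))])
    have h3 : ‖p k - p (k - 1)‖ ≤ ((k : ℝ) ^ 2)⁻¹ + (k : ℝ) ^ 2 * ‖p k - p (k - 1)‖ ^ 2 := by
      have h5 : ((k : ℝ) ^ 2)⁻¹ + (k : ℝ) ^ 2 * ‖p k - p (k - 1)‖ ^ 2 - ‖p k - p (k - 1)‖
          = ((1 - (k : ℝ) ^ 2 * ‖p k - p (k - 1)‖) ^ 2 + (k : ℝ) ^ 2 * ‖p k - p (k - 1)‖)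
            * ((k : ℝ) ^ 2)⁻¹ := by
        field_simp; ring
      have h6 : 0 ≤ ((1 - (k : ℝ) ^ 2 * ‖p k - p (k - 1)‖) ^ 2
          + (k : ℝ) ^ 2 * ‖p k - p (k - 1)‖) * ((k : ℝ) ^ 2)⁻¹ := by positivity
      linarith
    have h4 : ‖⟪z k - s, p k - P k⟫‖ ≤ B * ‖p k - p (k - 1)‖ :=
      (norm_inner_le_norm _ _).trans (mul_le_mul hk.1 h2 (norm_nonneg _)
        ((norm_nonneg _).trans hk.1))
    rw [h1]
    refine (norm_add_le _ _).trans ?_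
    rw [Real.norm_of_nonneg (hs k (by omega)), ← mul_add]
    gcongr
    exact h4.trans (mul_le_mul_of_nonneg_left h3 ((norm_nonneg _).trans hk.1))
  have hQ : Tendsto (fun k : ℕ => (α - 1) * ‖z k - s‖ ^ 2
      + 2 * k * ⟪z k - s, z k - z (k - 1)⟫ + 2 * (k + (α - c)) * ⟪z k - s, p k⟫) atTop
      (nhds (τ⁻¹ * (G₂ - G₁))) := by
    refine ((hG₂.sub hG₁).const_mul τ⁻¹).congr fun k => ?_
    rw [ogdaEnergy_sub, add_sub_cancel_left, inv_mul_cancel_left₀ hτ0.ne']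
  have hΔ : Tendsto (fun k : ℕ => (k : ℝ) * ‖z k - z (k - 1)‖ ^ 2) atTop (nhds 0) := by
    refine squeeze_zero' (Eventually.of_forall fun k => by positivity) ?_ hinv2
    filter_upwards [hB, eventually_ge_atTop 1] with k hk hk1
    have h0 : (0 : ℝ) < k := by exact_mod_cast hk1
    rw [← div_eq_mul_inv, le_div_iff₀ h0]
    calc _ = (k * ‖z k - z (k - 1)‖) ^ 2 := by ring
      _ ≤ B ^ 2 := by gcongr; exact hk.2.1
  obtain ⟨S, hS⟩ : ∃ S : ℕ → ℝ, S = fun k => ∑ i ∈ Finset.range (k + 1), ⟪z i - s, p i⟫ :=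
    ⟨_, rfl⟩
  have hSlim : Tendsto S atTop (nhds (∑' i, ⟪z i - s, p i⟫)) := by
    rw [hS]
    exact hσ.hasSum.tendsto_sum_nat.comp (tendsto_add_atTop_nat 1)
  have hφ := tendsto_of_mul_add_mul_sub (a := fun k => ‖z k - s‖ ^ 2 + 2 * S k) (r := α - 1)
    (l := τ⁻¹ * (G₂ - G₁) - 2 * (α - c) * 0 + 2 * (α - 1) * (∑' i, ⟪z i - s, p i⟫) - 0)
    (by linarith) (by
      refine (((((hQ.sub (hσ.tendsto_atTop_zero.const_mul (2 * (α - c)))).add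
        (hSlim.const_mul (2 * (α - 1)))).sub hΔ).comp (tendsto_add_atTop_nat 1)).congr fun k => ?_)
      have h1 : S (k + 1) = S k + ⟪z (k + 1) - s, p (k + 1)⟫ := by
        rw [hS]; exact Finset.sum_range_succ _ _
      have h2 : ‖z k - s‖ ^ 2 = ‖z (k + 1) - s‖ ^ 2 - 2 * ⟪z (k + 1) - s, z (k + 1) - z k⟫
          + ‖z (k + 1) - z k‖ ^ 2 := by
        rw [← norm_sub_sq_real]; congr 2; abel
      simp only [Function.comp_apply, Nat.add_sub_cancel, Nat.cast_add, Nat.cast_one]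
      rw [h1, h2]
      ring)
  refine ⟨_, (hφ.sub (hSlim.const_mul 2)).congr fun k => ?_⟩
  ring

end Convergence

section WeakConvergence

variable {H : Type*} [NormedAddCommGroup H] [InnerProductSpace ℝ H]

lemma ConvexOn.add_inner_gradient_le [CompleteSpace H] {φ : H → ℝ} {a G : H}
    (hφ : ConvexOn ℝ Set.univ φ) (hG : HasGradientAt φ G a) (x : H) :
    φ a + ⟪G, x - a⟫ ≤ φ x := by
  have h1 : ConvexOn ℝ Set.univ (φ ∘ AffineMap.lineMap (k := ℝ) a x) :=
    hφ.comp_affineMap (AffineMap.lineMap a x)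
  have h2 : HasDerivAt (φ ∘ AffineMap.lineMap (k := ℝ) a x) ⟪G, x - a⟫ 0 := by
    have h3 : HasFDerivAt φ (InnerProductSpace.toDual ℝ H G)
        (AffineMap.lineMap (k := ℝ) a x 0) := by
      simpa using hG.hasFDerivAt
    simpa using h3.comp_hasDerivAt 0 (AffineMap.hasDerivAt_lineMap (a := a) (b := x))
  have h4 := h1.le_slope_of_hasDerivAt (Set.mem_univ 0) (Set.mem_univ 1) one_pos h2
  simp only [slope_def_field, Function.comp_apply, AffineMap.lineMap_apply_one,
    AffineMap.lineMap_apply_zero] at h4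
  linarith

lemma Convex.mem_of_tendsto_inner [CompleteSpace H] {C : Set H} (hC : Convex ℝ C)
    (hCc : IsClosed C) {ι : Type*} {l : Filter ι} [l.NeBot] {z : ι → H} {b : H}
    (hz : ∀ q, Tendsto (fun i => ⟪z i, q⟫) l (nhds ⟪b, q⟫)) (hmem : ∀ᶠ i in l, z i ∈ C) :
    b ∈ C := by
  by_contra hb
  obtain ⟨φ, r, hr, hrb⟩ := geometric_hahn_banach_closed_point hC hCc hb
  have h1 := hz ((InnerProductSpace.toDual ℝ H).symm φ)
  have h2 : ∀ y, ⟪y, (InnerProductSpace.toDual ℝ H).symm φ⟫ = φ y := fun y => by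
    rw [real_inner_comm, InnerProductSpace.toDual_symm_apply]
  simp only [h2] at h1
  exact hrb.not_ge (le_of_tendsto h1 (hmem.mono fun i hi => (hr _ hi).le))

lemma exists_tendsto_inner_of_ultrafilter [CompleteSpace H] {ι : Type*} (U : Ultrafilter ι)
    {z : ι → H} {R : ℝ} (hz : ∀ᶠ i in U, ‖z i‖ ≤ R) :
    ∃ b : H, ∀ q, Tendsto (fun i => ⟪z i, q⟫) U (nhds ⟪b, q⟫) := by
  obtain ⟨T, hT⟩ : ∃ T : ι → WeakDual ℝ H,
      T = fun i => StrongDual.toWeakDual (InnerProductSpace.toDual ℝ H (z i)) := ⟨_, rfl⟩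
  have hmem : ((U.map T : Ultrafilter _) : Filter (WeakDual ℝ H))
      ≤ 𝓟 (WeakDual.toStrongDual ⁻¹' Metric.closedBall (0 : StrongDual ℝ H) R) := by
    rw [le_principal_iff, Ultrafilter.coe_map, mem_map]
    filter_upwards [hz] with i hi
    simpa [hT] using hi
  obtain ⟨φ, -, hφ⟩ := (WeakDual.isCompact_closedBall (0 : StrongDual ℝ H) R).ultrafilter_le_nhds
    (U.map T) hmem
  refine ⟨(InnerProductSpace.toDual ℝ H).symm (WeakDual.toStrongDual φ), fun q => ?_⟩
  have h1 : Tendsto T U (nhds φ) := hφ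
  have h2 := ((WeakDual.eval_continuous q).tendsto φ).comp h1
  rw [InnerProductSpace.toDual_symm_apply]
  simpa [hT, Function.comp_def] using h2

/-- Opial's lemma. -/
lemma exists_tendsto_inner_of_opial [CompleteSpace H] {S : Set H} (hS : S.Nonempty) {z : ℕ → H}
    (hdist : ∀ s ∈ S, ∃ d, Tendsto (fun k => ‖z k - s‖ ^ 2) atTop (nhds d))
    (hclust : ∀ U : Ultrafilter ℕ, (U : Filter ℕ) ≤ atTop → ∀ b : H,
      (∀ q, Tendsto (fun k => ⟪z k, q⟫) U (nhds ⟪b, q⟫)) → b ∈ S) :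
    ∃ b ∈ S, ∀ q, Tendsto (fun k => ⟪z k, q⟫) atTop (nhds ⟪b, q⟫) := by
  obtain ⟨s, hs⟩ := hS
  obtain ⟨d, hd⟩ := hdist s hs
  obtain ⟨R, hR⟩ := hd.bddAbove_range
  have hbdd : ∀ k, ‖z k‖ ≤ √R + ‖s‖ := fun k => by
    have h1 : ‖z k - s‖ ≤ √R := Real.le_sqrt_of_sq_le (hR ⟨k, rfl⟩)
    have h2 := norm_add_le (z k - s) s
    rw [sub_add_cancel] at h2
    linarith
  have hex : ∀ U : Ultrafilter ℕ, ∃ b : H, ∀ q, Tendsto (fun k => ⟪z k, q⟫) U (nhds ⟪b, q⟫) :=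
    fun U => exists_tendsto_inner_of_ultrafilter U (Eventually.of_forall hbdd)
  choose b hb using hex
  have huniq : ∀ U V : Ultrafilter ℕ, (U : Filter ℕ) ≤ atTop → (V : Filter ℕ) ≤ atTop →
      b U = b V := fun U V hU hV => by
    obtain ⟨d₁, hd₁⟩ := hdist _ (hclust U hU _ (hb U))
    obtain ⟨d₂, hd₂⟩ := hdist _ (hclust V hV _ (hb V))
    have hlim : Tendsto (fun k => ⟪z k, b U - b V⟫) atTop
        (nhds ((d₂ - d₁ + (‖b U‖ ^ 2 - ‖b V‖ ^ 2)) / 2)) := by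
      refine (((hd₂.sub hd₁).add_const (‖b U‖ ^ 2 - ‖b V‖ ^ 2)).div_const 2).congr fun k => ?_
      rw [norm_sub_sq_real, norm_sub_sq_real, inner_sub_right]
      ring
    have h1 := tendsto_nhds_unique (hb U (b U - b V)) (hlim.mono_left hU)
    have h2 := tendsto_nhds_unique (hb V (b U - b V)) (hlim.mono_left hV)
    rw [← sub_eq_zero, ← inner_self_eq_zero (𝕜 := ℝ), inner_sub_left, h1, h2, sub_self]
  have hyper := Ultrafilter.of_le (atTop : Filter ℕ)
  refine ⟨b (Ultrafilter.of atTop), hclust _ hyper _ (hb _), fun q => ?_⟩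
  rw [tendsto_iff_ultrafilter]
  intro U hU
  rw [huniq _ U hyper hU]
  exact hb U q

end WeakConvergence

lemma smul_momentum_extrapolation {E : Type*} [AddCommGroup E] [Module ℝ E] {k : ℝ} (α c : ℝ)
    (hkα : k + α ≠ 0) (a b d q : E) :
    (k + α) • (a - b + (b + (1 - α / (k + α)) • (b - d) + (1 - c / (k + α)) • (q - b) - a))
      = k • (b - d) + (k + α - c) • (q - b) := by
  have h1 : (k + α) * (1 - α / (k + α)) = k := by field_simp; ring
  have h2 : (k + α) * (1 - c / (k + α)) = k + α - c := by field_simp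
  rw [show a - b + (b + (1 - α / (k + α)) • (b - d) + (1 - c / (k + α)) • (q - b) - a)
    = (1 - α / (k + α)) • (b - d) + (1 - c / (k + α)) • (q - b) by abel, smul_add, smul_smul,
    smul_smul, h1, h2]

theorem stmt_11
    {X : Type*} [NormedAddCommGroup X] [InnerProductSpace ℝ X] [CompleteSpace X]
    {Y : Type*} [NormedAddCommGroup Y] [InnerProductSpace ℝ Y] [CompleteSpace Y]
    (f : X → ℝ) (g : Y → ℝ) (Φ : X → Y → ℝ) (Φx : X → Y → X) (Φy : X → Y → Y) (L α c γ : ℝ)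
    (hf : ConvexOn ℝ Set.univ f) (hflsc : LowerSemicontinuous f)
    (hg : ConvexOn ℝ Set.univ g) (hglsc : LowerSemicontinuous g)
    (hΦx : ∀ (a : X) (b : Y), HasGradientAt (fun x' => Φ x' b) (Φx a b) a)
    (hΦy : ∀ (a : X) (b : Y), HasGradientAt (fun y' => Φ a y') (Φy a b) b)
    (hΦcvx : ∀ b : Y, ConvexOn ℝ Set.univ fun x' => Φ x' b)
    (hΦccv : ∀ a : X, ConcaveOn ℝ Set.univ fun y' => Φ a y')
    (hL : 0 < L)
    (hΦlip : ∀ (a : X) (b : Y) (a' : X) (b' : Y),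
      ‖Φx a b - Φx a' b'‖ ^ 2 + ‖Φy a b - Φy a' b'‖ ^ 2 ≤ L ^ 2 * (‖a - a'‖ ^ 2 + ‖b - b'‖ ^ 2))
    (hα : 2 < α) (hcl : α / 2 < c) (hcu : c < α - 1)
    (hγ0 : 0 < γ) (hγ : γ < 1 / (2 * L))
    (x y1 w1 : ℕ → X) (lam y2 w2 : ℕ → Y) (u : ℕ → X) (v : ℕ → Y)
    (hy1 : ∀ k : ℕ, 1 ≤ k → y1 k = x k + (1 - α / ((k : ℝ) + α)) • (x k - x (k - 1))
        + (1 - c / ((k : ℝ) + α)) • (y1 (k - 1) - x k))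
    (hy2 : ∀ k : ℕ, 1 ≤ k → y2 k = lam k + (1 - α / ((k : ℝ) + α)) • (lam k - lam (k - 1))
        + (1 - c / ((k : ℝ) + α)) • (y2 (k - 1) - lam k))
    (hw1 : ∀ k : ℕ, 1 ≤ k → w1 k = y1 k - (y1 (k - 1) - x k))
    (hw2 : ∀ k : ℕ, 1 ≤ k → w2 k = y2 k - (y2 (k - 1) - lam k))
    (hu : ∀ k : ℕ, u (k + 1) = γ⁻¹ • (y1 k - x (k + 1)) - Φx (w1 k) (w2 k))
    (husub : ∀ k : ℕ, ∀ x' : X, f (x (k + 1)) + ⟪u (k + 1), x' - x (k + 1)⟫ ≤ f x')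
    (hvdef : ∀ k : ℕ, v (k + 1) = γ⁻¹ • (y2 k - lam (k + 1)) + Φy (w1 k) (w2 k))
    (hvsub : ∀ k : ℕ, ∀ b' : Y, g (lam (k + 1)) + ⟪v (k + 1), b' - lam (k + 1)⟫ ≤ g b')
    (hsad : ∃ (xs : X) (ls : Y), ∀ (x' : X) (l' : Y),
      f xs + Φ xs l' - g l' ≤ f xs + Φ xs ls - g ls ∧
      f xs + Φ xs ls - g ls ≤ f x' + Φ x' ls - g ls) :
    ∃ (xb : X) (lb : Y),
      (∀ (x' : X) (l' : Y),
        f xb + Φ xb l' - g l' ≤ f xb + Φ xb lb - g lb ∧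
        f xb + Φ xb lb - g lb ≤ f x' + Φ x' lb - g lb) ∧
      (∀ p : X, Tendsto (fun k : ℕ => ⟪x k, p⟫) atTop (nhds ⟪xb, p⟫)) ∧
      (∀ q : Y, Tendsto (fun k : ℕ => ⟪lam k, q⟫) atTop (nhds ⟪lb, q⟫)) := by
  have hκ : γ * L < 1 / 2 := by
    rw [lt_div_iff₀ (by positivity)] at hγ
    linarith
  obtain ⟨z, hz⟩ : ∃ z : ℕ → WithLp 2 (X × Y), z = fun k => WithLp.toLp 2 (x k, lam k) :=
    ⟨_, rfl⟩
  obtain ⟨p, hp⟩ : ∃ p : ℕ → WithLp 2 (X × Y),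
    p = fun k => WithLp.toLp 2 (y1 (k - 1) - x k, y2 (k - 1) - lam k) := ⟨_, rfl⟩
  obtain ⟨P, hP⟩ : ∃ P : ℕ → WithLp 2 (X × Y), P = fun k => γ • WithLp.toLp 2
    (u k + Φx (x k) (lam k), v k - Φy (x k) (lam k)) := ⟨_, rfl⟩
  have hgap : ∀ k : ℕ, 1 ≤ k → ∀ s : WithLp 2 (X × Y),
      γ * (f (x k) + Φ (x k) s.snd - g s.snd - (f s.fst + Φ s.fst (lam k) - g (lam k)))
        ≤ ⟪z k - s, P k⟫ := fun k hk s => by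
    obtain ⟨j, rfl⟩ := Nat.exists_eq_add_of_le' hk
    have h1 := husub j s.fst
    have h2 := hvsub j s.snd
    have h3 := (hΦcvx (lam (j + 1))).add_inner_gradient_le (hΦx (x (j + 1)) _) s.fst
    have h4 := (hΦccv (x (j + 1))).neg.add_inner_gradient_le
      (G := -Φy (x (j + 1)) (lam (j + 1))) (a := lam (j + 1)) (by
        have := (hΦy (x (j + 1)) (lam (j + 1))).hasFDerivAt.neg
        rw [hasGradientAt_iff_hasFDerivAt, map_neg]
        exact this) s.snd
    have h5 : ⟪z (j + 1) - s, P (j + 1)⟫ = γ * (-⟪u (j + 1), s.fst - x (j + 1)⟫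
        - ⟪Φx (x (j + 1)) (lam (j + 1)), s.fst - x (j + 1)⟫ - ⟪v (j + 1), s.snd - lam (j + 1)⟫
        - ⟪-Φy (x (j + 1)) (lam (j + 1)), s.snd - lam (j + 1)⟫) := by
      rw [hz, hP, real_inner_smul_right, real_inner_comm, WithLp.prod_inner_apply]
      simp only [WithLp.ofLp_sub, Prod.fst_sub, Prod.snd_sub, inner_add_left, inner_sub_left,
        inner_sub_right, inner_neg_left, WithLp.ofLp_fst, WithLp.ofLp_snd]
      ring
    rw [h5]
    refine mul_le_mul_of_nonneg_left ?_ hγ0.le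
    simp only [Pi.neg_apply] at h4
    linarith
  have hrec : ∀ k : ℕ, 1 ≤ k → ((k : ℝ) + α) • (z (k + 1) - z k + p (k + 1))
      = (k : ℝ) • (z k - z (k - 1)) + ((k : ℝ) + α - c) • p k := fun k hk => by
    have hkα : (k : ℝ) + α ≠ 0 := by positivity
    have e1 := smul_momentum_extrapolation α c hkα (x (k + 1)) (x k) (x (k - 1)) (y1 (k - 1))
    have e2 := smul_momentum_extrapolation α c hkα (lam (k + 1)) (lam k) (lam (k - 1)) (y2 (k - 1))
    rw [← hy1 k hk] at e1
    rw [← hy2 k hk] at e2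
    rw [hz, hp]
    exact congrArg (WithLp.toLp 2) (Prod.ext e1 e2)
  have herr : ∀ k : ℕ, 1 ≤ k →
      ‖p (k + 1) - P (k + 1)‖ ≤ γ * L * ‖p (k + 1) - p k‖ := fun k hk => by
    have e1 : p (k + 1) - P (k + 1) = γ • WithLp.toLp 2
        (Φx (w1 k) (w2 k) - Φx (x (k + 1)) (lam (k + 1)),
          -(Φy (w1 k) (w2 k) - Φy (x (k + 1)) (lam (k + 1)))) := by
      rw [hp, hP]
      refine congrArg (WithLp.toLp 2) (Prod.ext ?_ ?_)
      · change y1 k - x (k + 1) - γ • (u (k + 1) + Φx (x (k + 1)) (lam (k + 1)))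
          = γ • (Φx (w1 k) (w2 k) - Φx (x (k + 1)) (lam (k + 1)))
        rw [hu, smul_add, smul_sub, smul_inv_smul₀ hγ0.ne', smul_sub]
        abel
      · change y2 k - lam (k + 1) - γ • (v (k + 1) - Φy (x (k + 1)) (lam (k + 1)))
          = γ • (-(Φy (w1 k) (w2 k) - Φy (x (k + 1)) (lam (k + 1))))
        rw [hvdef, smul_sub, smul_add, smul_inv_smul₀ hγ0.ne', smul_neg, smul_sub]
        abel
    have e2 : p (k + 1) - p k = WithLp.toLp 2 (w1 k - x (k + 1), w2 k - lam (k + 1)) := by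
      rw [hp]
      refine congrArg (WithLp.toLp 2) (Prod.ext ?_ ?_)
      · change y1 k - x (k + 1) - (y1 (k - 1) - x k) = w1 k - x (k + 1)
        rw [hw1 k hk]; abel
      · change y2 k - lam (k + 1) - (y2 (k - 1) - lam k) = w2 k - lam (k + 1)
        rw [hw2 k hk]; abel
    rw [e1, e2, norm_smul, Real.norm_of_nonneg hγ0.le, mul_assoc]
    refine mul_le_mul_of_nonneg_left ?_ hγ0.le
    refine le_of_sq_le_sq ?_ (by positivity)
    rw [mul_pow, WithLp.prod_norm_sq_eq_of_L2, WithLp.prod_norm_sq_eq_of_L2]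
    simp only [WithLp.toLp_fst, WithLp.toLp_snd, norm_neg]
    exact hΦlip _ _ _ _
  have hmono : ∀ k : ℕ, 1 ≤ k → 0 ≤ ⟪P (k + 1) - P k, z (k + 1) - z k⟫ := fun k hk => by
    have h1 := hgap k hk (z (k + 1))
    have h2 := hgap (k + 1) (by omega) (z k)
    have h3 : ⟪P (k + 1) - P k, z (k + 1) - z k⟫
        = ⟪z k - z (k + 1), P k⟫ + ⟪z (k + 1) - z k, P (k + 1)⟫ := by
      rw [real_inner_comm, inner_sub_right, ← neg_sub (z (k + 1)) (z k), inner_neg_left]; ring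
    have e1 : ∀ k, (z k).fst = x k := fun k => by rw [hz]; rfl
    have e2 : ∀ k, (z k).snd = lam k := fun k => by rw [hz]; rfl
    rw [e1, e2] at h1 h2
    rw [h3]
    linarith
  obtain ⟨S, hS⟩ : ∃ S : Set (WithLp 2 (X × Y)), S = {s | ∀ (x' : X) (l' : Y),
    f s.fst + Φ s.fst l' - g l' ≤ f x' + Φ x' s.snd - g s.snd} := ⟨_, rfl⟩
  have hconv : ∀ s ∈ S, (∃ d, Tendsto (fun k => ‖z k - s‖ ^ 2) atTop (nhds d)) ∧
      Tendsto P atTop (nhds 0) := fun s hs => by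
    refine ogda_dist_tendsto (by linarith) hcu (by positivity) hκ hrec herr hmono fun k hk => ?_
    rw [hS] at hs
    exact le_trans (mul_nonneg hγ0.le (sub_nonneg.2 (hs (x k) (lam k)))) (hgap k hk s)
  have hSne : S.Nonempty := by
    obtain ⟨xs, ls, h⟩ := hsad
    rw [hS]
    exact ⟨WithLp.toLp 2 (xs, ls), fun x' l' => (h x' l').1.trans (h x' l').2⟩
  obtain ⟨s₀, hs₀⟩ := hSne
  obtain ⟨⟨d₀, hd₀⟩, hP0⟩ := hconv s₀ hs₀
  obtain ⟨b, hbS, hb⟩ := exists_tendsto_inner_of_opial ⟨s₀, hs₀⟩ (fun s hs => (hconv s hs).1)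
    fun U hU b hb => by
      rw [hS]
      intro x' l'
      obtain ⟨h, hh⟩ : ∃ h : WithLp 2 (X × Y) → ℝ, h = fun s =>
        (f s.fst + Φ s.fst l') + (g s.snd + -Φ x' s.snd) := ⟨_, rfl⟩
      have hlsc : LowerSemicontinuous h := by
        have c1 : Continuous fun a => Φ a l' :=
          continuous_iff_continuousAt.2 fun a => (hΦx a l').continuousAt
        have c2 : Continuous fun b' => -Φ x' b' :=
          (continuous_iff_continuousAt.2 fun b' => (hΦy x' b').continuousAt).neg
        rw [hh]
        exact ((hflsc.add c1.lowerSemicontinuous).comp (WithLp.continuous_fst 2 X Y)).add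
          ((hglsc.add c2.lowerSemicontinuous).comp (WithLp.continuous_snd 2 X Y))
      have hcvx : ConvexOn ℝ Set.univ h := by
        rw [hh]
        exact ((hf.add (hΦcvx l')).comp_linearMap (WithLp.fstₗ 2 ℝ X Y)).add
          ((hg.add (hΦccv x').neg).comp_linearMap (WithLp.sndₗ 2 ℝ X Y))
      have hle : ∀ ε > 0, h b ≤ f x' + g l' + ε := fun ε hε => by
        have hconvex := hcvx.convex_le (f x' + g l' + ε)
        have hclosed := hlsc.isClosed_preimage (f x' + g l' + ε)
        have hlim : Tendsto (fun k => ⟪z k - WithLp.toLp 2 (x', l'), P k⟫) atTop (nhds 0) := by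
          obtain ⟨R, hR⟩ := hd₀.bddAbove_range
          have hb0 : Tendsto (fun k => (√R + ‖s₀ - WithLp.toLp 2 (x', l')‖) * ‖P k‖) atTop
              (nhds 0) := by simpa using hP0.norm.const_mul _
          refine squeeze_zero_norm (fun k => (norm_inner_le_norm _ _).trans ?_) hb0
          gcongr
          rw [← sub_add_sub_cancel (z k) s₀]
          exact (norm_add_le _ _).trans (by gcongr; exact Real.le_sqrt_of_sq_le (hR ⟨k, rfl⟩))
        have hev : ∀ᶠ k in atTop, z k ∈ {s | s ∈ Set.univ ∧ h s ≤ f x' + g l' + ε} := by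
          filter_upwards [(tendsto_order.1 hlim).2 (γ * ε) (by positivity),
            eventually_ge_atTop 1] with k hk hk1
          have h1 := le_of_mul_le_mul_left ((hgap k hk1 _).trans hk.le) hγ0
          refine ⟨trivial, ?_⟩
          rw [hh, hz]
          simp only [WithLp.toLp_fst, WithLp.toLp_snd] at h1 ⊢
          linarith
        refine (hconvex.mem_of_tendsto_inner ?_ hb (hU hev)).2
        simpa [Set.preimage] using hclosed
      have h0 := le_of_forall_pos_le_add hle
      rw [hh] at h0
      linarith
  rw [hS] at hbS
  refine ⟨b.fst, b.snd, fun x' l' => ⟨hbS b.fst l', hbS x' b.snd⟩, fun q => ?_, fun q => ?_⟩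
  · simpa [WithLp.prod_inner_apply, hz] using hb (WithLp.toLp 2 (q, 0))
  · simpa [WithLp.prod_inner_apply, hz] using hb (WithLp.toLp 2 (0, q))
end
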